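/- Let χ be a nonprincipal Dirichlet character modulo a prime p. Let u be a squarefree positive integer all of whose prime factors are less than p, and set n = ω(u) + 1 where ω(u) is the number of distinct prime factors of u. Suppose χ(m) = 1 whenever 0 < m ≤ H < p and gcd(m, u) = 1. Set B = n/(2(n+1)) and X* = (π/3)(2e)^{-1/2}((n+1)/n)^{n-1} · p^{1/4}/(log p)^{(n-1)/2} · (1 − ((n+1)/n) e^{-1/n} (log p)^{-1}). If X* > 3.8 and log p > max{exp(8/3), 8(n−1)}, then H ≤ p^{1/4} (log p)^{(n+1)/2} · g(n,p), where g(n,p) = (π/3)√(2e) · (n/(n+1)) · ((1 + √2/(2B log p − 3)) / (1 − (π²/9)(log X* + 9)/(3X*)))^{1/2}. -/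

import Mathlib

open Real

/-- `X* = (π/3)(2e)^(-1/2) ((n+1)/n)^(n-1) p^(1/4)/(log p)^((n-1)/2)
       · (1 - ((n+1)/n) e^(-1/n) (log p)^(-1))`. -/
noncomputable def Xstar (n : ℕ) (p : ℝ) : ℝ :=
  (π / 3) * (2 * Real.exp 1) ^ (-(1 : ℝ) / 2) * (((n : ℝ) + 1) / (n : ℝ)) ^ (n - 1) *
    p ^ ((1 : ℝ) / 4) / Real.log p ^ (((n : ℝ) - 1) / 2) *
    (1 - ((n : ℝ) + 1) / (n : ℝ) * Real.exp (-1 / (n : ℝ)) / Real.log p)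

/-- `g(n,p) = (π/3)√(2e) (n/(n+1))
      ((1 + √2/(2B log p - 3))/(1 - (π²/9)(log X* + 9)/(3X*)))^(1/2)`
with `B = n/(2(n+1))`. -/
noncomputable def gconst (n : ℕ) (p : ℝ) : ℝ :=
  (π / 3) * Real.sqrt (2 * Real.exp 1) * ((n : ℝ) / ((n : ℝ) + 1)) *
    ((1 + Real.sqrt 2 / (2 * ((n : ℝ) / (2 * ((n : ℝ) + 1))) * Real.log p - 3)) /
        (1 - (π ^ 2 / 9) * (Real.log (Xstar n p) + 9) / (3 * Xstar n p))) ^ ((1 : ℝ) / 2)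

open Polynomial in
lemma exists_hasseDeriv_pow {K : Type*} [Field K] (f : K[X]) (N r : ℕ) :
    ∃ w : K[X], hasseDeriv r (f ^ N) = f ^ (N - r) * w ∧ w.natDegree ≤ r * f.natDegree := by
  induction N generalizing r with
  | zero =>
    refine ⟨hasseDeriv r (f ^ 0), by simp, ?_⟩
    refine (natDegree_hasseDeriv_le _ _).trans ?_
    simp
  | succ N ih =>
    rcases lt_or_ge N r with h | h
    · refine ⟨hasseDeriv r (f ^ (N + 1)),
          by simp [Nat.sub_eq_zero_of_le (show N + 1 ≤ r by omega)], ?_⟩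
      refine (natDegree_hasseDeriv_le _ _).trans ?_
      refine (Nat.sub_le _ _).trans (natDegree_pow_le.trans ?_)
      exact Nat.mul_le_mul_right _ h
    · choose w hw hdeg using ih
      refine ⟨∑ ab ∈ Finset.HasAntidiagonal.antidiagonal r,
        if ab.2 = 0 then w r else f ^ (ab.2 - 1) * w ab.1 * hasseDeriv ab.2 f, ?_, ?_⟩
      · rw [pow_succ, hasseDeriv_mul, Finset.mul_sum]
        refine Finset.sum_congr rfl ?_
        rintro ⟨a, b⟩ hab
        rw [Finset.HasAntidiagonal.mem_antidiagonal] at hab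
        simp only at hab ⊢
        split_ifs with hb
        · subst hb
          simp only [add_zero] at hab
          subst hab
          rw [hw, hasseDeriv_zero', Nat.succ_sub h, pow_succ]
          ring
        · rw [hw, show N - a = (N + 1 - r) + (b - 1) by omega, pow_add]
          ring
      · refine natDegree_sum_le_of_forall_le _ _ ?_
        rintro ⟨a, b⟩ hab
        rw [Finset.HasAntidiagonal.mem_antidiagonal] at hab
        simp only at hab ⊢
        split_ifs with hb
        · exact hdeg r
        · refine natDegree_mul_le.trans ?_
          have h1 : (f ^ (b - 1) * w a).natDegree ≤ (b - 1) * f.natDegree + a * f.natDegree :=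
            natDegree_mul_le.trans (add_le_add natDegree_pow_le (hdeg a))
          have h2 : (hasseDeriv b f).natDegree ≤ f.natDegree :=
            (natDegree_hasseDeriv_le _ _).trans (Nat.sub_le _ _)
          calc _ ≤ (b - 1) * f.natDegree + a * f.natDegree + f.natDegree := add_le_add h1 h2
            _ = ((b - 1) + a + 1) * f.natDegree := by ring
            _ = r * f.natDegree := by congr 1; omega

open Polynomial in
lemma exists_hasseDeriv_X_pow_mul_pow {K : Type*} [Field K] (f : K[X]) (s N r : ℕ) (hr : r ≤ N) :
    ∃ w : K[X], hasseDeriv r (X ^ s * f ^ N) = f ^ (N - r) * w ∧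
      w.natDegree ≤ s + r * f.natDegree := by
  choose w hw hdeg using exists_hasseDeriv_pow f N
  refine ⟨∑ ab ∈ Finset.HasAntidiagonal.antidiagonal r,
      hasseDeriv ab.1 (X ^ s) * (f ^ ab.1 * w ab.2), ?_, ?_⟩
  · rw [hasseDeriv_mul, Finset.mul_sum]
    refine Finset.sum_congr rfl ?_
    rintro ⟨a, b⟩ hab
    rw [Finset.HasAntidiagonal.mem_antidiagonal] at hab
    simp only at hab ⊢
    rw [hw, show N - b = (N - r) + a by omega, pow_add]
    ring
  · refine natDegree_sum_le_of_forall_le _ _ ?_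
    rintro ⟨a, b⟩ hab
    rw [Finset.HasAntidiagonal.mem_antidiagonal] at hab
    simp only at hab ⊢
    refine natDegree_mul_le.trans (add_le_add ?_ ?_)
    · refine (natDegree_hasseDeriv_le _ _).trans ?_
      rw [natDegree_X_pow]
      exact Nat.sub_le _ _
    · refine natDegree_mul_le.trans ((add_le_add natDegree_pow_le (hdeg b)).trans ?_)
      rw [← add_mul, hab]

open Polynomial in
lemma hasseDeriv_mul_X_pow_card {K : Type*} [Field K] [Fintype K] (G : K[X]) (i r : ℕ)
    (hr : r < Fintype.card K) :
    hasseDeriv r (G * X ^ (Fintype.card K * i)) = hasseDeriv r G * X ^ (Fintype.card K * i) := by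
  obtain ⟨p, hp⟩ := CharP.exists K
  have := hp
  obtain ⟨n, hpp, hn⟩ := FiniteField.card K p
  rw [hasseDeriv_mul, Finset.sum_eq_single (r, 0)]
  · simp
  · rintro ⟨a, b⟩ hab hne
    rw [Finset.HasAntidiagonal.mem_antidiagonal] at hab
    simp only at hab ⊢
    have hb0 : b ≠ 0 := by
      rintro rfl
      apply hne
      simp at hab
      simp [hab]
    have hz : hasseDeriv b (X ^ (Fintype.card K * i) : K[X]) = 0 := by
      rw [← one_mul (X ^ _), ← C_1, C_mul_X_pow_eq_monomial, hasseDeriv_monomial]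
      have : ((Fintype.card K * i).choose b : K) = 0 := by
        rw [CharP.cast_eq_zero_iff K p]
        have hbQ : b < p ^ (n : ℕ) := by rw [← hn]; omega
        have h1 := Nat.add_one_mul_choose_eq (Fintype.card K * i - 1) (b - 1)
        rcases Nat.eq_zero_or_pos (Fintype.card K * i) with h0 | h0
        · rw [h0, Nat.choose_eq_zero_of_lt (Nat.pos_of_ne_zero hb0)]; exact dvd_zero _
        · rw [Nat.sub_add_cancel h0,
            Nat.sub_add_cancel (Nat.pos_of_ne_zero hb0)] at h1
          have h2 : p ^ (n : ℕ) ∣ (Fintype.card K * i).choose b * b := by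
            rw [← h1, hn, mul_assoc]
            exact dvd_mul_right _ _
          by_contra hnd
          have h3 : p ^ (n : ℕ) ∣ b :=
            (Nat.Coprime.pow_left _
              ((Nat.Prime.coprime_iff_not_dvd hpp).2 hnd)).dvd_of_dvd_mul_left h2
          exact absurd (Nat.le_of_dvd (Nat.pos_of_ne_zero hb0) h3) (by omega)
      rw [this, zero_mul, monomial_zero_right]
    rw [hz, mul_zero]
  · intro h
    simp at h

open Polynomial in
lemma sum_ne_zero_of_injOn_natTrailingDegree {K ι : Type*} [Field K] (s : Finset ι) (T : ι → K[X])
    (hinj : ∀ a ∈ s, ∀ b ∈ s, T a ≠ 0 → T b ≠ 0 →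
      (T a).natTrailingDegree = (T b).natTrailingDegree → a = b)
    (hne : ∃ a ∈ s, T a ≠ 0) : ∑ a ∈ s, T a ≠ 0 := by
  classical
  obtain ⟨a, ha, hmin⟩ := Finset.exists_min_image (s.filter fun a => T a ≠ 0)
    (fun a => (T a).natTrailingDegree) (by
      obtain ⟨a, ha, h⟩ := hne
      exact ⟨a, by simp [ha, h]⟩)
  simp only [Finset.mem_filter] at ha hmin
  intro h0
  have h1 : (∑ b ∈ s, T b).coeff (T a).natTrailingDegree = (T a).coeff (T a).natTrailingDegree := by
    rw [finsetSum_coeff, Finset.sum_eq_single a]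
    · intro b hb hba
      by_cases hb0 : T b = 0
      · simp [hb0]
      · apply coeff_eq_zero_of_lt_natTrailingDegree
        refine lt_of_le_of_ne (hmin b ⟨hb, hb0⟩) ?_
        intro h
        exact hba (hinj b hb a ha.1 hb0 ha.2 h.symm)
    · intro h
      exact absurd ha.1 h
  rw [h0, coeff_zero] at h1
  exact ha.2 (trailingCoeff_eq_zero.1 h1.symm)

open Polynomial in
lemma card_mul_le_natDegree_of_hasseDeriv {K : Type*} [Field K] (S : Finset K) (M : ℕ) (P : K[X])
    (hP : P ≠ 0) (h : ∀ x ∈ S, ∀ r < M, (hasseDeriv r P).eval x = 0) :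
    S.card * M ≤ P.natDegree := by
  have hdvd : ∏ x ∈ S, (X - C x) ^ M ∣ P := by
    apply Finset.prod_dvd_of_coprime
    · intro x _ y _ hxy
      exact (pairwise_coprime_X_sub_C Function.injective_id hxy).pow
    · intro x hx
      rw [X_sub_C_pow_dvd_iff, X_pow_dvd_iff]
      intro d hd
      have := h x hx d hd
      rwa [← taylor_coeff] at this
  have := natDegree_le_of_dvd hdvd hP
  rw [natDegree_prod_of_monic _ _ (fun x _ => (monic_X_sub_C x).pow _)] at this
  simpa [natDegree_pow] using this

open Polynomial in
/-- The auxiliary polynomial of Stepanov's method. -/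
noncomputable def stepanovPoly {K : Type*} [Field K] [Fintype K] (f : K[X]) (k c R M δ : ℕ)
    (v : Fin R × Fin k × Fin δ → K) : K[X] :=
  ∑ i : Fin R, ∑ j : Fin k, ∑ s : Fin δ,
    C (v (i, j, s)) * ((X ^ (s : ℕ) * f ^ (M + c * j)) * X ^ (Fintype.card K * i))

open Polynomial in
lemma stepanovPoly_ne_zero {K : Type*} [Field K] [Fintype K] (f : K[X]) (hf : f ≠ 0)
    (k c R M δ : ℕ) (hQ : Fintype.card K = k * c + 1) (hδ : δ + R ≤ c)
    (he : Nat.Coprime f.natTrailingDegree k)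
    (v : Fin R × Fin k × Fin δ → K) (hv : v ≠ 0) : stepanovPoly f k c R M δ v ≠ 0 := by
  set h : Fin R × Fin k → K[X] := fun ij => ∑ s : Fin δ, C (v (ij.1, ij.2, s)) * X ^ (s : ℕ) with hh
  have hcoeff : ∀ i j (s : Fin δ), (h (i, j)).coeff s = v (i, j, s) := by
    intro i j s
    simp only [hh, finsetSum_coeff, coeff_C_mul, coeff_X_pow]
    rw [Finset.sum_eq_single s]
    · simp
    · intro b _ hb
      have : ¬ (s : ℕ) = b := fun h => hb (Fin.ext h.symm)
      simp [this]
    · simp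
  have hdeg : ∀ ij, h ij ≠ 0 → (h ij).natTrailingDegree < δ := by
    intro ij h0
    have h1 : (h ij).degree < δ := by
      refine (degree_sum_le _ _).trans_lt ?_
      refine (Finset.sup_lt_iff (WithBot.bot_lt_coe δ)).2 fun s _ => ?_
      refine (degree_C_mul_X_pow_le _ _).trans_lt ?_
      exact (Nat.cast_lt (α := WithBot ℕ)).2 s.2
    rw [← natDegree_lt_iff_degree_lt h0] at h1
    exact (natTrailingDegree_le_natDegree _).trans_lt h1
  have heq : stepanovPoly f k c R M δ v =
      ∑ ij : Fin R × Fin k, h ij * (f ^ (M + c * ij.2) * X ^ (Fintype.card K * ij.1)) := by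
    rw [stepanovPoly, Fintype.sum_prod_type]
    refine Finset.sum_congr rfl fun i _ => Finset.sum_congr rfl fun j _ => ?_
    rw [hh, Finset.sum_mul]
    refine Finset.sum_congr rfl fun s _ => ?_
    ring
  have hfX : ∀ ij : Fin R × Fin k,
      (f ^ (M + c * ij.2) * X ^ (Fintype.card K * ij.1) : K[X]) ≠ 0 := fun ij =>
    mul_ne_zero (pow_ne_zero _ hf) (pow_ne_zero _ X_ne_zero)
  have hpow : ∀ N : ℕ, (f ^ N).natTrailingDegree = N * f.natTrailingDegree := by
    intro N
    induction N with
    | zero => simp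
    | succ N ih =>
      rw [pow_succ, natTrailingDegree_mul (pow_ne_zero _ hf) hf, ih]
      ring
  rw [heq]
  apply sum_ne_zero_of_injOn_natTrailingDegree
  · rintro ⟨i, j⟩ - ⟨i', j'⟩ - hne hne' htd
    have hn1 : h (i, j) ≠ 0 := left_ne_zero_of_mul hne
    have hn2 : h (i', j') ≠ 0 := left_ne_zero_of_mul hne'
    rw [natTrailingDegree_mul hn1 (hfX _), natTrailingDegree_mul hn2 (hfX _),
      natTrailingDegree_mul (pow_ne_zero _ hf) (pow_ne_zero _ X_ne_zero),
      natTrailingDegree_mul (pow_ne_zero _ hf) (pow_ne_zero _ X_ne_zero), hpow, hpow] at htd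
    simp only [natTrailingDegree_X_pow] at htd
    have l1 := hdeg _ hn1
    have l2 := hdeg _ hn2
    generalize (h (i, j)).natTrailingDegree = τ at *
    generalize (h (i', j')).natTrailingDegree = τ' at *
    have hi := i.2
    have hi' := i'.2
    set e := f.natTrailingDegree
    have hc : 0 < c := by omega
    have e1 : (τ + i) + c * (j * e + k * i) = (τ' + i') + c * (j' * e + k * i') := by
      rw [hQ] at htd
      have : M * e + ((τ + i) + c * (j * e + k * i))
          = M * e + ((τ' + i') + c * (j' * e + k * i')) := by
        linarith
      exact Nat.add_left_cancel this
    have e2 : (j * e + k * i : ℕ) = j' * e + k * i' := by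
      have := congrArg (· / c) e1
      simp only [Nat.add_mul_div_left _ _ hc] at this
      rwa [Nat.div_eq_of_lt (by omega), Nat.div_eq_of_lt (by omega), zero_add, zero_add] at this
    have e3 : (j : ℕ) ≡ j' [MOD k] := by
      have h3 : (j * e : ℕ) ≡ j' * e [MOD k] := by
        have := congrArg (· % k) e2
        simpa [Nat.ModEq] using this
      exact Nat.ModEq.cancel_right_of_coprime (by rwa [Nat.coprime_comm] at he) h3
    have e4 : j = j' := Fin.ext (by
      rw [Nat.ModEq, Nat.mod_eq_of_lt j.2, Nat.mod_eq_of_lt j'.2] at e3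
      exact e3)
    subst e4
    have e5 : i = i' := by
      have hk : 0 < k := j.pos
      have := Nat.add_left_cancel e2
      exact Fin.ext (Nat.eq_of_mul_eq_mul_left hk this)
    rw [e5]
  · by_contra! hall
    apply hv
    funext ⟨i, j, s⟩
    have := hall (i, j) (Finset.mem_univ _)
    rcases mul_eq_zero.1 this with h0 | h0
    · rw [← hcoeff, h0]; simp
    · exact absurd h0 (hfX _)

open Polynomial in
lemma natDegree_stepanovPoly_le {K : Type*} [Field K] [Fintype K] (f : K[X])
    (k c R M δ : ℕ) (hQ : Fintype.card K = k * c + 1) (hδ : δ + R ≤ c)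
    (v : Fin R × Fin k × Fin δ → K) :
    (stepanovPoly f k c R M δ v).natDegree ≤
      c + (M + Fintype.card K) * f.natDegree + Fintype.card K * R := by
  refine natDegree_sum_le_of_forall_le _ _ fun i _ => natDegree_sum_le_of_forall_le _ _ fun j _ =>
    natDegree_sum_le_of_forall_le _ _ fun s _ => ?_
  refine (natDegree_C_mul_le _ _).trans (natDegree_mul_le.trans (add_le_add
    (natDegree_mul_le.trans (add_le_add ?_ ?_)) ?_))
  · rw [natDegree_X_pow]
    have := s.2
    omega
  · refine natDegree_pow_le.trans (Nat.mul_le_mul_right _ ?_)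
    have : c * j ≤ c * k := Nat.mul_le_mul_left _ j.2.le
    rw [hQ]
    linarith
  · rw [natDegree_X_pow]
    exact Nat.mul_le_mul_left _ i.2.le

open Polynomial in
lemma stepanov_card_mul_le {K : Type*} [Field K] [Fintype K] [DecidableEq K] (f : K[X]) (hf : f ≠ 0)
    (k c R M δ : ℕ) (hQ : Fintype.card K = k * c + 1) (hδ : δ + R ≤ c)
    (hM : M ≤ Fintype.card K)
    (he : Nat.Coprime f.natTrailingDegree k) (hlt : M * (c + M * f.natDegree) < R * (k * δ))
    (ζ : K) :
    (Finset.univ.filter fun x : K => f.eval x ^ c = ζ).card * M ≤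
      c + (M + Fintype.card K) * f.natDegree + Fintype.card K * R := by
  set m := f.natDegree with hm
  have hw : ∀ (r : Fin M) (j : Fin k) (s : Fin δ), ∃ w : K[X],
      hasseDeriv (r : ℕ) (X ^ (s : ℕ) * f ^ (M + c * j)) = f ^ (M + c * j - r) * w ∧
      w.natDegree ≤ s + r * m := fun r j s =>
    exists_hasseDeriv_X_pow_mul_pow f s (M + c * j) r (by have := r.2; omega)
  choose w hw hdeg using hw
  let E : Fin M → (Fin R × Fin k × Fin δ → K) →ₗ[K] K[X] := fun r =>
    { toFun := fun v => ∑ i : Fin R, ∑ j : Fin k, ∑ s : Fin δ,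
        C (v (i, j, s)) * (C (ζ ^ (j : ℕ)) * w r j s * X ^ (i : ℕ))
      map_add' := by
        intro v v'
        simp only [Pi.add_apply, C_add, add_mul, Finset.sum_add_distrib]
      map_smul' := by
        intro a v
        simp only [Pi.smul_apply, smul_eq_mul, C_mul, Finset.smul_sum, RingHom.id_apply,
          smul_eq_C_mul, mul_assoc] }
  have hE : ∀ r v, E r v = ∑ i : Fin R, ∑ j : Fin k, ∑ s : Fin δ,
        C (v (i, j, s)) * (C (ζ ^ (j : ℕ)) * w r j s * X ^ (i : ℕ)) := fun r v => rfl
  let Φ : (Fin R × Fin k × Fin δ → K) →ₗ[K] (Fin M × Fin (c + M * m) → K) :=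
    LinearMap.pi fun rd => (lcoeff K (rd.2 : ℕ)).comp (E rd.1)
  have hker : LinearMap.ker Φ ≠ ⊥ := by
    apply LinearMap.ker_ne_bot_of_finrank_lt
    simpa using hlt
  obtain ⟨v, hv, hv0⟩ := (Submodule.ne_bot_iff _).1 hker
  rw [LinearMap.mem_ker] at hv
  have hEdeg : ∀ r, (E r v).natDegree < c + M * m ∨ E r v = 0 := by
    intro r
    rcases Nat.eq_zero_or_pos δ with h0 | hpos
    · right
      subst h0
      rw [hE]
      simp
    rcases Nat.eq_zero_or_pos R with h0 | hRpos
    · right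
      subst h0
      rw [hE]
      simp
    left
    refine lt_of_le_of_lt (b := (c - 1) + r * m) ?_ ?_
    · rw [hE]
      refine natDegree_sum_le_of_forall_le _ _
          fun i _ => natDegree_sum_le_of_forall_le _ _ fun j _ =>
        natDegree_sum_le_of_forall_le _ _ fun s _ => ?_
      refine (natDegree_C_mul_le _ _).trans (natDegree_mul_le.trans ?_)
      refine (add_le_add ((natDegree_C_mul_le _ _).trans (hdeg r j s))
          (natDegree_X_pow_le _)).trans ?_
      have := s.2
      have := i.2
      omega
    · have : (r : ℕ) * m ≤ M * m := Nat.mul_le_mul_right _ r.2.le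
      omega
  have hE0 : ∀ r, E r v = 0 := by
    intro r
    rcases hEdeg r with h | h
    · ext d
      rw [coeff_zero]
      rcases lt_or_ge d (c + M * m) with hd | hd
      · have := congrFun hv (r, ⟨d, hd⟩)
        simpa [Φ] using this
      · exact coeff_eq_zero_of_natDegree_lt (h.trans_le hd)
    · exact h
  refine (card_mul_le_natDegree_of_hasseDeriv _ M (stepanovPoly f k c R M δ v)
    (stepanovPoly_ne_zero f hf k c R M δ hQ hδ he v hv0) ?_).trans
    (natDegree_stepanovPoly_le f k c R M δ hQ hδ v)
  intro x hx r hr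
  simp only [Finset.mem_filter, Finset.mem_univ, true_and] at hx
  have key : (hasseDeriv r (stepanovPoly f k c R M δ v)).eval x =
      f.eval x ^ (M - r) * (E ⟨r, hr⟩ v).eval x := by
    rw [hE, stepanovPoly]
    simp only [map_sum, eval_finsetSum, Finset.mul_sum]
    refine Finset.sum_congr rfl fun i _ => Finset.sum_congr rfl fun j _ =>
      Finset.sum_congr rfl fun s _ => ?_
    rw [← smul_eq_C_mul, map_smul, hasseDeriv_mul_X_pow_card _ _ _ (hr.trans_le hM),
      show hasseDeriv r (X ^ (s : ℕ) * f ^ (M + c * j)) = _ from hw ⟨r, hr⟩ j s]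
    simp only [eval_smul, eval_mul, eval_pow, eval_X, eval_C, smul_eq_mul]
    rw [pow_mul x, FiniteField.pow_card, show M + c * j - r = (M - r) + c * j by omega, pow_add,
      pow_mul, hx]
    ring
  rw [key, hE0, eval_zero, mul_zero]

open Polynomial in
/-- **Stepanov's bound** for the number of points where `f` has a given power residue symbol. -/
theorem exists_stepanov_bound (k m : ℕ) (hk : 0 < k) : ∃ C : ℝ, 0 ≤ C ∧
    ∀ (K : Type) [Field K] [Fintype K] [DecidableEq K] (f : K[X]) (c : ℕ), f ≠ 0 →
      f.natDegree = m → Fintype.card K = k * c + 1 → Nat.Coprime f.natTrailingDegree k →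
      ∀ ζ : K, ((Finset.univ.filter fun x : K => f.eval x ^ c = ζ).card : ℝ) ≤
        (Fintype.card K : ℝ) / k + C * √(Fintype.card K) := by
  set s₀ : ℕ := 2 * k ^ 2 * (k * m + 1) + 1 with hs₀
  refine ⟨m + 4 * (m + 1 + s₀) + (2 * s₀ + k + 2), by positivity, ?_⟩
  intro K _ _ _ f c hf hm hQ he ζ
  set Q := Fintype.card K with hQdef
  set S := Finset.univ.filter fun x : K => f.eval x ^ c = ζ
  set R := Nat.sqrt Q with hR
  have hR1 : R * R ≤ Q := Nat.sqrt_le Q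
  have hR2 : Q < (R + 1) * (R + 1) := Nat.lt_succ_sqrt Q
  have hk' : (0 : ℝ) < k := by exact_mod_cast hk
  have hsqrt : √(Q : ℝ) ≤ R + 1 := by
    rw [Real.sqrt_le_left (by positivity)]
    have : (Q : ℝ) < (R + 1) * (R + 1) := by exact_mod_cast hR2
    nlinarith
  have hsq : √(Q : ℝ) * √(Q : ℝ) = Q := Real.mul_self_sqrt (by positivity)
  have hs0 : 0 ≤ √(Q : ℝ) := Real.sqrt_nonneg _
  rcases lt_or_ge R (2 * s₀ + k + 2) with hlt | hge
  · have h1 : (S.card : ℝ) ≤ Q := by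
      exact_mod_cast (Finset.card_le_univ S)
    have h2 : (R : ℝ) + 1 ≤ 2 * s₀ + k + 2 := by exact_mod_cast hlt
    have h3 : (Q : ℝ) ≤ (2 * s₀ + k + 2) * √(Q : ℝ) := by
      nlinarith
    have h4 : (0 : ℝ) ≤ (m + 4 * (m + 1 + s₀)) * √(Q : ℝ) := by positivity
    have h5 : (0 : ℝ) ≤ (Q : ℝ) / k := by positivity
    linarith
  · have hRk : k * R + 2 * R ≤ R * R := by
      rw [← add_mul]; exact Nat.mul_le_mul_right _ (by omega)
    have hkR : R ≤ k * R := Nat.le_mul_of_pos_left _ hk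
    have hRc : R ≤ c := by
      refine Nat.le_of_mul_le_mul_left (c := k) ?_ hk
      omega
    obtain ⟨M, hM⟩ : ∃ M, M + s₀ = k * R := ⟨k * R - s₀, by omega⟩
    obtain ⟨δ, hδ⟩ : ∃ δ, δ + R = c := ⟨c - R, by omega⟩
    have hlt : M * (c + M * m) < R * (k * δ) := by
      have e1 : k * (M * (c + M * m) + (s₀ * c)) ≤ k * (k * R * c + k * R * (k * R) * m) := by
        refine Nat.mul_le_mul_left _ ?_
        have hMk : M ≤ k * R := by omega
        have : M * M * m ≤ k * R * (k * R) * m :=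
          Nat.mul_le_mul_right _ (Nat.mul_le_mul hMk hMk)
        have h2 : (M + s₀) * c = k * R * c := by rw [hM]
        nlinarith
      have e2 : k ^ 2 * (R * R) * (1 + k * m) < s₀ * (k * c) := by
        have h1 : R * R ≤ k * c + 1 := by omega
        have h2 : R * R ≤ 2 * (k * c) := by
          have : 2 ≤ k * c := by
            have : 2 ≤ R := by omega
            nlinarith
          omega
        have h3 : 0 < k * c := by
          have : 2 ≤ R := by omega
          nlinarith
        have h4 := Nat.mul_le_mul_left (k ^ 2 * (1 + k * m)) h2
        rw [hs₀]
        nlinarith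
      have e3 : R * (k * δ) + R * (k * R) = R * (k * c) := by rw [← hδ]; ring
      refine Nat.lt_of_mul_lt_mul_left (a := k) ?_
      have e4 : k * (R * (k * δ)) + k * (R * (k * R)) = k * (R * (k * c)) := by
        rw [← mul_add, e3]
      nlinarith
    have hmain := stepanov_card_mul_le f hf k c R M δ hQ hδ.le (by omega) he
      (by rw [hm]; exact hlt) ζ
    rw [hm, ← hQdef] at hmain
    have hmain' : (S.card : ℝ) * M ≤ c + (M + Q) * m + Q * R := by exact_mod_cast hmain
    have hcQ : (c : ℝ) ≤ Q := by
      have : c ≤ Q := by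
        have := Nat.le_mul_of_pos_left c hk
        omega
      exact_mod_cast this
    have hMr : (M : ℝ) + s₀ = k * R := by exact_mod_cast hM
    have hMpos : (0 : ℝ) < M := by
      have : 0 < M := by omega
      exact_mod_cast this
    have hM2 : (R : ℝ) ≤ 2 * M := by
      have : R ≤ 2 * M := by omega
      exact_mod_cast this
    have hR1' : (1 : ℝ) ≤ R := by
      have : 1 ≤ R := by omega
      exact_mod_cast this
    have hQM : (Q : ℝ) ≤ 4 * M * √(Q : ℝ) := by
      have h1 : √(Q : ℝ) ≤ 4 * M := by linarith
      have := mul_le_mul_of_nonneg_right h1 hs0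
      rwa [hsq] at this
    have hone : 1 ≤ √(Q : ℝ) := by
      rw [Real.one_le_sqrt]
      have : 1 ≤ Q := by omega
      exact_mod_cast this
    refine le_of_mul_le_mul_right (hmain'.trans ?_) hMpos
    have t1 : (Q : ℝ) / k * M = Q * R - Q * s₀ / k := by
      rw [eq_sub_iff_add_eq]
      field_simp
      rw [hMr, mul_assoc]
    have t2 : (Q : ℝ) * s₀ / k ≤ Q * s₀ := by
      apply div_le_self (by positivity)
      exact_mod_cast hk
    have t3 : (Q : ℝ) * (m + 1 + s₀) ≤ 4 * M * √(Q : ℝ) * (m + 1 + s₀) :=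
      mul_le_mul_of_nonneg_right hQM (by positivity)
    have t4 : (M : ℝ) * m ≤ M * m * √(Q : ℝ) := le_mul_of_one_le_right (by positivity) hone
    have t5 : (0 : ℝ) ≤ (2 * s₀ + k + 2) * √(Q : ℝ) * M := by positivity
    linear_combination hcQ + t2 + t3 + t4 + t5 - t1

open Polynomial in
lemma norm_coeff_one_le_of_recurrence (a s : ℕ → ℂ) (d : ℕ) (q C : ℝ) (hq : 0 < q)
    (ha0 : a 0 = 1) (had : ∀ n, d < n → a n = 0)
    (hs : ∀ j, ‖s j‖ ≤ C * q ^ j)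
    (hrec : ∀ n : ℕ, (n : ℂ) * a n =
      ∑ kl ∈ Finset.HasAntidiagonal.antidiagonal n, s kl.1 * a kl.2) :
    ‖a 1‖ ≤ d * q := by
  set L : ℂ[X] := ∑ n ∈ Finset.range (d + 1), Polynomial.C (a n) * X ^ n with hL
  have hcoeff : ∀ n, L.coeff n = a n := by
    intro n
    rw [hL, finsetSum_coeff]
    simp only [coeff_C_mul_X_pow]
    rw [Finset.sum_ite_eq]
    split_ifs with h
    · rfl
    · rw [had n (by simpa using h)]
  have hdeg : L.natDegree ≤ d := by
    rw [natDegree_le_iff_coeff_eq_zero]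
    intro n hn
    rw [hcoeff, had n hn]
  have hL0 : L.eval 0 = 1 := by rw [← coeff_zero_eq_eval_zero, hcoeff, ha0]
  have hL1 : L.derivative.eval 0 = a 1 := by
    rw [← coeff_zero_eq_eval_zero, coeff_derivative, hcoeff]; simp
  have hLne : L ≠ 0 := by
    intro h; rw [h] at hL0; simp at hL0
  have hCnn : 0 ≤ C := by
    have := (norm_nonneg _).trans (hs 0)
    simpa using this
  have hsumS : ∀ T : ℂ, ‖T‖ * q < 1 → Summable fun j => ‖s j * T ^ j‖ := by
    intro T hT
    refine Summable.of_nonneg_of_le (fun _ => norm_nonneg _) (fun j => ?_)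
      ((summable_geometric_of_lt_one (by positivity) hT).mul_left C)
    rw [norm_mul, norm_pow, mul_pow]
    calc ‖s j‖ * ‖T‖ ^ j ≤ C * q ^ j * ‖T‖ ^ j := by gcongr; exact hs j
      _ = _ := by ring
  have hid : ∀ T : ℂ, ‖T‖ * q < 1 →
      T * L.derivative.eval T = (∑' j, s j * T ^ j) * L.eval T := by
    intro T hT
    have hfin : ∀ n ∉ Finset.range (d + 1), a n * T ^ n = 0 := by
      intro n hn
      rw [had n (by simpa using hn), zero_mul]
    have hsumA : Summable fun n => ‖a n * T ^ n‖ := by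
      apply summable_of_ne_finset_zero (s := Finset.range (d + 1))
      intro n hn
      rw [hfin n hn, norm_zero]
    have hA : L.eval T = ∑' n, a n * T ^ n := by
      rw [tsum_eq_sum hfin, hL, eval_finsetSum]
      simp
    rw [hA, tsum_mul_tsum_eq_tsum_sum_antidiagonal_of_summable_norm (hsumS T hT) hsumA]
    have h1 : ∀ n : ℕ, ∑ kl ∈ Finset.HasAntidiagonal.antidiagonal n,
        s kl.1 * T ^ kl.1 * (a kl.2 * T ^ kl.2) = n * a n * T ^ n := by
      intro n
      rw [hrec, Finset.sum_mul]
      refine Finset.sum_congr rfl fun kl hkl => ?_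
      rw [Finset.HasAntidiagonal.mem_antidiagonal] at hkl
      rw [← hkl, pow_add]
      ring
    simp_rw [h1]
    rw [tsum_eq_sum (s := Finset.range (d + 1)) (fun n hn => by
      rw [mul_assoc, hfin n hn, mul_zero]), hL, derivative_sum, eval_finsetSum, Finset.mul_sum]
    refine Finset.sum_congr rfl fun n _ => ?_
    rw [derivative_C_mul_X_pow]
    rcases n with _ | n
    · simp
    · simp [pow_succ]; ring
  have hroot : ∀ z ∈ L.roots, 1 ≤ ‖z‖ * q := by
    intro z hz
    by_contra! hlt
    have hzr : L.IsRoot z := isRoot_of_mem_roots hz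
    obtain ⟨G, hG, hGz⟩ := exists_eq_pow_rootMultiplicity_mul_and_not_dvd L hLne z
    set k := L.rootMultiplicity z with hk
    have hkpos : 0 < k := (rootMultiplicity_pos hLne).2 hzr
    have hz0 : z ≠ 0 := by
      rintro rfl
      rw [IsRoot.def, hL0] at hzr
      exact one_ne_zero hzr
    have hGz' : G.eval z ≠ 0 := fun h => hGz (dvd_iff_isRoot.2 h)
    obtain ⟨ρ, hρ1, hρ2⟩ : ∃ ρ, ‖z‖ < ρ ∧ ρ * q < 1 := by
      have : ‖z‖ < 1 / q := by rwa [lt_div_iff₀ hq]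
      obtain ⟨ρ, h1, h2⟩ := exists_between this
      exact ⟨ρ, h1, by rwa [lt_div_iff₀ hq] at h2⟩
    have hρ0 : 0 ≤ ρ := (norm_nonneg z).trans hρ1.le
    set D := C * (1 - ρ * q)⁻¹ with hD
    have hbound : ∀ T : ℂ, ‖T‖ < ρ → ‖∑' j, s j * T ^ j‖ ≤ D := by
      intro T hT
      have hgeo := (hasSum_geometric_of_lt_one (by positivity) hρ2).mul_left C
      refine tsum_of_norm_bounded hgeo fun j => ?_
      rw [norm_mul, norm_pow, mul_pow]
      calc ‖s j‖ * ‖T‖ ^ j ≤ C * q ^ j * ρ ^ j := by gcongr; exact hs j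
        _ = _ := by ring
    have hder : L.derivative = (X - Polynomial.C z) ^ (k - 1) *
        (Polynomial.C (k : ℂ) * G + (X - Polynomial.C z) * G.derivative) := by
      rw [hG, derivative_mul, derivative_X_sub_C_pow]
      obtain ⟨k', hk'⟩ : ∃ k', k = k' + 1 := ⟨k - 1, by omega⟩
      rw [hk']
      simp only [Nat.add_sub_cancel]
      push_cast
      ring
    have hineq : ∀ T : ℂ, ‖T‖ < ρ → T ≠ z →
        ‖T * (k * G.eval T + (T - z) * G.derivative.eval T)‖ ≤ D * ‖(T - z) * G.eval T‖ := by
      intro T hT hTz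
      have h1 := hid T (lt_of_le_of_lt (mul_le_mul_of_nonneg_right hT.le hq.le) hρ2)
      rw [hder, hG] at h1
      simp only [eval_mul, eval_pow, eval_sub, eval_X, eval_C, eval_add] at h1
      have hTz' : (T - z) ^ (k - 1) ≠ 0 := pow_ne_zero _ (sub_ne_zero.2 hTz)
      have h2 : T * (k * G.eval T + (T - z) * G.derivative.eval T) =
          (∑' j, s j * T ^ j) * ((T - z) * G.eval T) := by
        apply mul_left_cancel₀ hTz'
        rw [show (T - z) ^ k = (T - z) ^ (k - 1) * (T - z) by
          rw [← pow_succ, Nat.sub_add_cancel hkpos]] at h1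
        linear_combination h1
      rw [h2, norm_mul]
      exact mul_le_mul_of_nonneg_right (hbound T hT) (norm_nonneg _)
    have hlim1 : Filter.Tendsto (fun T : ℂ =>
        ‖T * (k * G.eval T + (T - z) * G.derivative.eval T)‖) (nhdsWithin z {z}ᶜ)
        (nhds ‖z * (k * G.eval z + (z - z) * G.derivative.eval z)‖) := by
      apply Filter.Tendsto.mono_left _ nhdsWithin_le_nhds
      apply Continuous.tendsto
      fun_prop
    have hlim2 : Filter.Tendsto (fun T : ℂ => D * ‖(T - z) * G.eval T‖) (nhdsWithin z {z}ᶜ)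
        (nhds (D * ‖(z - z) * G.eval z‖)) := by
      apply Filter.Tendsto.mono_left _ nhdsWithin_le_nhds
      apply Continuous.tendsto
      fun_prop
    have hle := le_of_tendsto_of_tendsto hlim1 hlim2 (by
      have h1 : ∀ᶠ T in nhdsWithin z {z}ᶜ, ‖T‖ < ρ :=
        nhdsWithin_le_nhds ((continuous_norm.tendsto z).eventually_lt_const hρ1)
      filter_upwards [h1, self_mem_nhdsWithin] with T hT hTz
      exact hineq T hT hTz)
    simp only [sub_self, zero_mul, add_zero, norm_zero, mul_zero] at hle
    have := norm_le_zero_iff.1 hle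
    have hkne : (k : ℂ) ≠ 0 := by exact_mod_cast hkpos.ne'
    exact mul_ne_zero hz0 (mul_ne_zero hkne hGz') this
  have hsum := (IsAlgClosed.splits L).eval_derivative_div_eval_of_ne_zero
    (x := 0) (by rw [hL0]; exact one_ne_zero)
  rw [hL0, hL1, div_one] at hsum
  rw [hsum]
  have hb : ∀ y ∈ L.roots.map (fun z => ‖1 / (0 - z)‖), y ≤ q := by
    intro y hy
    rw [Multiset.mem_map] at hy
    obtain ⟨z, hz, rfl⟩ := hy
    have h1 := hroot z hz
    have hzpos : 0 < ‖z‖ := by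
      by_contra! h
      have := norm_nonneg z
      have h0 : ‖z‖ = 0 := le_antisymm h this
      rw [h0, zero_mul] at h1
      linarith
    rw [zero_sub, norm_div, norm_neg, norm_one, div_le_iff₀ hzpos]
    linarith
  calc ‖(L.roots.map fun z => 1 / (0 - z)).sum‖
      ≤ ((L.roots.map fun z => 1 / (0 - z)).map (fun x => ‖x‖)).sum := norm_multiset_sum_le _
    _ = (L.roots.map fun z => ‖1 / (0 - z)‖).sum := by rw [Multiset.map_map]; rfl
    _ ≤ (L.roots.map fun z => ‖1 / (0 - z)‖).card • q := Multiset.sum_le_card_nsmul _ _ hb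
    _ ≤ d * q := by
      rw [Multiset.card_map, nsmul_eq_mul]
      have : (L.roots.card : ℝ) ≤ d := by exact_mod_cast (card_roots' L).trans hdeg
      gcongr

open Polynomial in
/-- Square-root cancellation, with an unspecified constant, for complete character sums. -/
theorem exists_charSum_bound (ℓ m : ℕ) (hℓ : ℓ.Prime) : ∃ C : ℝ, 0 ≤ C ∧
    ∀ (K : Type) [Field K] [Fintype K] (ψ : MulChar K ℂ) (f : K[X]) (a : K), ψ ≠ 1 → ψ ^ ℓ = 1 →
      f ≠ 0 → f.natDegree = m → ¬ ℓ ∣ f.rootMultiplicity a →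
      ‖∑ x : K, ψ (f.eval x)‖ ≤ C * √(Fintype.card K) := by
  classical
  obtain ⟨C, hC0, hC⟩ := exists_stepanov_bound ℓ m hℓ.pos
  refine ⟨ℓ * C + m, by positivity, ?_⟩
  intro K _ _ ψ f₀ a hψ hψℓ hf₀ hm₀ ha
  set f := f₀.comp (X + Polynomial.C a) with hfdef
  have hsum : ∑ x : K, ψ (f₀.eval x) = ∑ x : K, ψ (f.eval x) := by
    rw [← Equiv.sum_comp (Equiv.addRight a)]
    simp [hfdef]
  have hm : f.natDegree = m := by rw [hfdef, natDegree_comp, natDegree_X_add_C, mul_one, hm₀]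
  have hf : f ≠ 0 := by
    intro h
    rw [hfdef, comp_eq_zero_iff] at h
    rcases h with h | ⟨-, h⟩
    · exact hf₀ h
    · have := congrArg natDegree h
      rw [natDegree_X_add_C, natDegree_C] at this
      exact one_ne_zero this
  have he : Nat.Coprime f.natTrailingDegree ℓ := by
    rw [Nat.coprime_comm, Nat.Prime.coprime_iff_not_dvd hℓ, hfdef,
      ← rootMultiplicity_eq_natTrailingDegree]
    exact ha
  have : Fact ℓ.Prime := ⟨hℓ⟩
  have hord : orderOf ψ = ℓ := orderOf_eq_prime hψℓ hψ
  set Q := Fintype.card K with hQdef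
  have hQpos : 0 < Q := Fintype.card_pos
  obtain ⟨c, hc⟩ : ℓ ∣ Q - 1 := hord ▸ ψ.orderOf_dvd_card_sub_one
  have hQ : Q = ℓ * c + 1 := by omega
  obtain ⟨g, hg⟩ := IsCyclic.exists_generator (α := Kˣ)
  have hgo : orderOf g = ℓ * c := by
    rw [orderOf_eq_card_of_forall_mem_zpowers hg, Nat.card_eq_fintype_card, Fintype.card_units,
      ← hQdef, hc]
  have hcpos : 0 < c := by
    rcases Nat.eq_zero_or_pos c with h | h
    · rw [h, mul_zero] at hgo
      have := orderOf_pos g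
      omega
    · exact h
  have hgc : orderOf (g ^ c) = ℓ := by
    rw [orderOf_pow' _ hcpos.ne', hgo, Nat.gcd_eq_right (dvd_mul_left _ _),
      Nat.mul_div_cancel _ hcpos]
  set ω := ψ (g : K) with hω
  have hωℓ : ω ^ ℓ = 1 := by
    rw [hω, ← MulChar.pow_apply_coe, hψℓ, MulChar.one_apply_coe]
  have hval : ∀ t : ℕ, ψ ((g : K) ^ t) = ω ^ t := fun t => map_pow ψ _ _
  have hω1 : ω ≠ 1 := by
    intro h
    apply hψ
    ext x
    obtain ⟨t, rfl⟩ : ∃ t : ℕ, g ^ t = x := by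
      have := hg x
      rwa [← mem_powers_iff_mem_zpowers] at this
    rw [MulChar.one_apply_coe, Units.val_pow_eq_pow_val, hval, h, one_pow]
  have hωnorm : ‖ω‖ = 1 := Complex.norm_eq_one_of_pow_eq_one hωℓ hℓ.ne_zero
  set N : ℕ → Finset K := fun t => Finset.univ.filter fun x => f.eval x ^ c = ((g : K) ^ c) ^ t
    with hN
  have hgeom : ∑ t ∈ Finset.range ℓ, ω ^ t = 0 := by
    have := mul_geom_sum ω ℓ
    rw [hωℓ, sub_self] at this
    exact (mul_eq_zero.1 this).resolve_left (sub_ne_zero.2 hω1)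
  have hdisj : (↑(Finset.range ℓ) : Set ℕ).PairwiseDisjoint N := by
    intro t ht t' ht' hne
    rw [Function.onFun, Finset.disjoint_left]
    intro x hx hx'
    simp only [hN, Finset.mem_filter, Finset.mem_univ, true_and] at hx hx'
    apply hne
    have h1 : (g ^ c) ^ t = (g ^ c) ^ t' := by
      ext
      push_cast
      rw [← hx, hx']
    rw [pow_inj_mod, hgc] at h1
    simp only [Finset.coe_range, Set.mem_Iio] at ht ht'
    rwa [Nat.mod_eq_of_lt ht, Nat.mod_eq_of_lt ht'] at h1
  have hunion : (Finset.range ℓ).biUnion N = Finset.univ.filter fun x => f.eval x ≠ 0 := by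
    ext x
    simp only [Finset.mem_biUnion, hN, Finset.mem_filter, Finset.mem_univ, true_and,
      Finset.mem_range]
    constructor
    · rintro ⟨t, -, h⟩ h0
      rw [h0, zero_pow hcpos.ne'] at h
      exact (pow_ne_zero _ (pow_ne_zero _ g.ne_zero)) h.symm
    · intro h0
      obtain ⟨t, ht⟩ : ∃ t : ℕ, g ^ t = Units.mk0 _ h0 := by
        have := hg (Units.mk0 _ h0)
        rwa [← mem_powers_iff_mem_zpowers] at this
      refine ⟨t % ℓ, Nat.mod_lt _ hℓ.pos, ?_⟩
      have h1 : (g ^ c) ^ (t % ℓ) = (g ^ c) ^ t := by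
        rw [pow_inj_mod, hgc, Nat.mod_mod]
      have h2 : (Units.mk0 _ h0) ^ c = (g ^ c) ^ (t % ℓ) := by
        rw [h1, ← ht, ← pow_mul, ← pow_mul, mul_comm]
      have := congrArg Units.val h2
      simpa using this
  have hψN : ∀ t, ∀ x ∈ N t, ψ (f.eval x) = ω ^ t := by
    intro t x hx
    simp only [hN, Finset.mem_filter, Finset.mem_univ, true_and] at hx
    have h0 : f.eval x ≠ 0 := by
      intro h0
      rw [h0, zero_pow hcpos.ne'] at hx
      exact (pow_ne_zero _ (pow_ne_zero _ g.ne_zero)) hx.symm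
    obtain ⟨u, hu⟩ : ∃ u : ℕ, g ^ u = Units.mk0 _ h0 := by
      have := hg (Units.mk0 _ h0)
      rwa [← mem_powers_iff_mem_zpowers] at this
    have hu' : (g : K) ^ u = f.eval x := by
      have := congrArg Units.val hu
      simpa using this
    have h1 : (g ^ c) ^ u = (g ^ c) ^ t := by
      ext
      push_cast
      rw [← hx, ← hu', ← pow_mul, ← pow_mul, mul_comm]
    rw [pow_inj_mod, hgc] at h1
    rw [← hu', hval, pow_eq_pow_mod u hωℓ, pow_eq_pow_mod t hωℓ, h1]
  have hS : ∑ x : K, ψ (f.eval x) = ∑ t ∈ Finset.range ℓ, ((N t).card : ℂ) * ω ^ t := by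
    rw [← Finset.sum_filter_of_ne (p := fun x => f.eval x ≠ 0), ← hunion,
      Finset.sum_biUnion hdisj]
    · refine Finset.sum_congr rfl fun t _ => ?_
      rw [Finset.sum_congr rfl (hψN t), Finset.sum_const, nsmul_eq_mul]
    · intro x _ h h0
      rw [h0, MulChar.map_zero] at h
      exact h rfl
  set B : ℝ := (Q : ℝ) / ℓ + C * √(Q : ℝ) with hB
  have hNB : ∀ t, ((N t).card : ℝ) ≤ B := by
    intro t
    have := hC K f c hf hm hQ he (((g : K) ^ c) ^ t)
    convert this
  have hcard : (Q : ℝ) - m ≤ ∑ t ∈ Finset.range ℓ, ((N t).card : ℝ) := by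
    have h1 : ∑ t ∈ Finset.range ℓ, (N t).card
        = (Finset.univ.filter fun x => f.eval x ≠ 0).card := by
      rw [← hunion, Finset.card_biUnion hdisj]
    have h2 : (Finset.univ.filter fun x => f.eval x = 0).card ≤ m := by
      rw [← hm]
      refine (Finset.card_le_card ?_).trans ((Multiset.toFinset_card_le _).trans (card_roots' f))
      intro x hx
      simpa [hf] using hx
    have h3 := Finset.card_filter_add_card_filter_not (s := (Finset.univ : Finset K))
      (fun x => f.eval x = 0)
    rw [Finset.card_univ, ← hQdef] at h3
    have h4 : Q ≤ m + ∑ t ∈ Finset.range ℓ, (N t).card := by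
      rw [h1, ← h3]
      exact Nat.add_le_add_right h2 _
    have : (Q : ℝ) ≤ m + ∑ t ∈ Finset.range ℓ, ((N t).card : ℝ) := by exact_mod_cast h4
    linarith
  have hS' : ∑ x : K, ψ (f.eval x) =
      - ∑ t ∈ Finset.range ℓ, (((B - (N t).card : ℝ)) : ℂ) * ω ^ t := by
    rw [hS]
    push_cast
    simp_rw [sub_mul]
    rw [Finset.sum_sub_distrib, ← Finset.mul_sum, hgeom]
    ring
  rw [hsum, hS', norm_neg]
  have hℓ0 : (ℓ : ℝ) ≠ 0 := by exact_mod_cast hℓ.ne_zero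
  have hone : 1 ≤ √(Q : ℝ) := by
    rw [Real.one_le_sqrt]
    exact_mod_cast hQpos
  calc ‖∑ t ∈ Finset.range ℓ, (((B - (N t).card : ℝ)) : ℂ) * ω ^ t‖
      ≤ ∑ t ∈ Finset.range ℓ, ‖(((B - (N t).card : ℝ)) : ℂ) * ω ^ t‖ := norm_sum_le _ _
    _ = ∑ t ∈ Finset.range ℓ, (B - (N t).card) := by
      refine Finset.sum_congr rfl fun t _ => ?_
      rw [norm_mul, norm_pow, hωnorm, one_pow, mul_one, Complex.norm_real, Real.norm_of_nonneg]
      linarith [hNB t]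
    _ = ℓ * B - ∑ t ∈ Finset.range ℓ, ((N t).card : ℝ) := by
      rw [Finset.sum_sub_distrib, Finset.sum_const, Finset.card_range, nsmul_eq_mul]
    _ ≤ ℓ * B - (Q - m) := by linarith
    _ = ℓ * C * √(Q : ℝ) + m := by rw [hB]; field_simp; ring
    _ ≤ (ℓ * C + m) * √(Q : ℝ) := by
      have : (m : ℝ) ≤ m * √(Q : ℝ) := le_mul_of_one_le_right (by positivity) hone
      linarith

open Polynomial IntermediateField in
lemma norm_algebraMap_sub {F L : Type*} [Field F] [Field L] [Algebra F L] [FiniteDimensional F L]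
    (a : F) (x : L) : Algebra.norm F (algebraMap F L a - x) =
      (minpoly F x).eval a ^ (Module.finrank F L / (minpoly F x).natDegree) := by
  set y := x - algebraMap F L a with hy
  have hmin : minpoly F y = (minpoly F x).comp (X + C a) := minpoly.sub_algebraMap x a
  have hyint : IsIntegral F y := Algebra.IsIntegral.isIntegral y
  have hdeg : (minpoly F y).natDegree = (minpoly F x).natDegree := by
    rw [hmin, natDegree_comp, natDegree_X_add_C, mul_one]
  have hdpos : 0 < (minpoly F x).natDegree :=
    minpoly.natDegree_pos (Algebra.IsIntegral.isIntegral x)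
  have hfin : Module.finrank F F⟮y⟯ = (minpoly F x).natDegree := by
    rw [adjoin.finrank hyint, hdeg]
  have htower : (minpoly F x).natDegree * Module.finrank F⟮y⟯ L = Module.finrank F L := by
    rw [← hfin, Module.finrank_mul_finrank]
  have hgen : Algebra.norm F (AdjoinSimple.gen F y) =
      (-1) ^ (minpoly F x).natDegree * (minpoly F x).eval a := by
    have h1 := Algebra.PowerBasis.norm_gen_eq_coeff_zero_minpoly (adjoin.powerBasis hyint)
    rw [adjoin.powerBasis_gen, adjoin.powerBasis_dim, minpoly_gen, hdeg, hmin,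
      coeff_zero_eq_eval_zero, eval_comp] at h1
    simpa using h1
  have hneg : algebraMap F L a - x = algebraMap F L (-1) * y := by
    rw [hy]; simp
  rw [hneg, map_mul, Algebra.norm_algebraMap, Algebra.norm_eq_norm_adjoin F y, hgen,
    ← htower, Nat.mul_div_cancel_left _ hdpos, mul_pow, ← mul_assoc, ← pow_mul, ← mul_pow]
  simp

open Polynomial in
lemma finite_monic_natDegree_eq (F : Type*) [Field F] [Finite F] (n : ℕ) :
    {g : F[X] | g.Monic ∧ g.natDegree = n}.Finite := by
  have h1 : Finite (degreeLT F (n + 1)) :=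
    Finite.of_equiv _ (degreeLTEquiv F (n + 1)).toEquiv.symm
  refine Set.Finite.subset (Set.toFinite (degreeLT F (n + 1) : Set F[X])) ?_
  rintro g ⟨hg, hn⟩
  rw [SetLike.mem_coe, mem_degreeLT, degree_eq_natDegree hg.ne_zero, hn]
  exact (Nat.cast_lt (α := WithBot ℕ)).2 (Nat.lt_succ_self n)

open Polynomial in
/-- The monic polynomials of degree `n` over a finite field. -/
noncomputable def monicFinset (F : Type*) [Field F] [Finite F] (n : ℕ) : Finset F[X] :=
  (finite_monic_natDegree_eq F n).toFinset

open Polynomial in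
lemma mem_monicFinset {F : Type*} [Field F] [Finite F] {n : ℕ} {g : F[X]} :
    g ∈ monicFinset F n ↔ g.Monic ∧ g.natDegree = n := by
  simp [monicFinset]

open Polynomial Classical in
/-- The monic irreducible polynomials of degree at most `n` over a finite field. -/
noncomputable def monicIrreducibleFinset (F : Type*) [Field F] [Finite F] (n : ℕ) : Finset F[X] :=
  ((Finset.range (n + 1)).biUnion (monicFinset F)).filter Irreducible

open Polynomial in
lemma mem_monicIrreducibleFinset {F : Type*} [Field F] [Finite F] {n : ℕ} {g : F[X]} :
    g ∈ monicIrreducibleFinset F n ↔ g.Monic ∧ g.natDegree ≤ n ∧ Irreducible g := by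
  simp only [monicIrreducibleFinset, Finset.mem_filter, Finset.mem_biUnion, Finset.mem_range,
    mem_monicFinset]
  constructor
  · rintro ⟨⟨a, ha, hg, rfl⟩, hi⟩
    exact ⟨hg, by omega, hi⟩
  · rintro ⟨hg, hn, hi⟩
    exact ⟨⟨_, by omega, hg, rfl⟩, hi⟩

open Polynomial in
lemma card_minpoly_eq {F K : Type*} [Field F] [Finite F] [Field K] [Fintype K] [Algebra F K]
    [DecidableEq F[X]]
    (P : F[X]) (hP : P.Monic) (hirr : Irreducible P) (hd : P.natDegree ∣ Module.finrank F K) :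
    (Finset.univ.filter fun x : K => minpoly F x = P).card = P.natDegree := by
  classical
  have : Fact (Irreducible P) := ⟨hirr⟩
  have hroot : ∃ x : K, minpoly F x = P := by
    have hfin : Module.finrank F (AdjoinRoot P) = P.natDegree := by
      rw [(AdjoinRoot.powerBasis hirr.ne_zero).finrank, AdjoinRoot.powerBasis_dim]
    obtain ⟨φ⟩ := FiniteField.nonempty_algHom_of_finrank_dvd (F := F) (K := AdjoinRoot P) (L := K)
      (by rw [hfin]; exact hd)
    refine ⟨φ (AdjoinRoot.root P), ?_⟩
    rw [minpoly.algHom_eq _ φ.injective, AdjoinRoot.minpoly_root hirr.ne_zero, hP.leadingCoeff]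
    simp
  have hfilter : (Finset.univ.filter fun x : K => minpoly F x = P) = (P.rootSet K).toFinset := by
    ext x
    simp only [Finset.mem_filter, Finset.mem_univ, true_and, Set.mem_toFinset,
      mem_rootSet, hP.ne_zero, ne_eq, not_false_eq_true]
    constructor
    · rintro rfl; exact minpoly.aeval F x
    · intro h
      exact (minpoly.eq_of_irreducible_of_monic hirr h hP).symm
  rw [hfilter, Set.toFinset_card]
  obtain ⟨x, hx⟩ := hroot
  refine card_rootSet_eq_natDegree (PerfectField.separable_of_irreducible hirr) ?_
  rw [← hx]
  exact Normal.splits inferInstance x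

open Polynomial in
lemma sum_minpoly_eq {F K : Type*} [Field F] [Finite F] [Field K] [Fintype K] [Algebra F K]
    (Ξ : F[X] → ℂ) :
    ∑ x : K, Ξ (minpoly F x) =
      ∑ P ∈ monicIrreducibleFinset F (Module.finrank F K) with
        P.natDegree ∣ Module.finrank F K, (P.natDegree : ℂ) * Ξ P := by
  classical
  have : FiniteDimensional F K := Module.Finite.of_finite
  have hmaps : ∀ x ∈ (Finset.univ : Finset K), minpoly F x ∈
      (monicIrreducibleFinset F (Module.finrank F K)).filter
        (fun P => P.natDegree ∣ Module.finrank F K) := by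
    intro x _
    have hx : IsIntegral F x := Algebra.IsIntegral.isIntegral x
    rw [Finset.mem_filter, mem_monicIrreducibleFinset]
    exact ⟨⟨minpoly.monic hx, minpoly.natDegree_le x, minpoly.irreducible hx⟩,
        minpoly.degree_dvd hx⟩
  rw [← Finset.sum_fiberwise_of_maps_to hmaps]
  refine Finset.sum_congr rfl fun P hP => ?_
  rw [Finset.mem_filter, mem_monicIrreducibleFinset] at hP
  rw [Finset.sum_congr rfl (g := fun _ => Ξ P) (fun x hx => by
    rw [(Finset.mem_filter.1 hx).2]), Finset.sum_const, nsmul_eq_mul,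
    card_minpoly_eq P hP.1.1 hP.1.2.2 hP.2]

open Polynomial in
/-- The completely multiplicative function `g ↦ ∏ χ(g(a))^{e(a)}` on polynomials. -/
noncomputable def polyChar {F : Type*} [Field F] (χ : MulChar F ℂ) (A : Finset F) (e : F → ℕ)
    (g : F[X]) : ℂ :=
  ∏ a ∈ A, χ (g.eval a) ^ e a

open Polynomial in
lemma polyChar_mul {F : Type*} [Field F] (χ : MulChar F ℂ) (A : Finset F) (e : F → ℕ)
    (g h : F[X]) : polyChar χ A e (g * h) = polyChar χ A e g * polyChar χ A e h := by
  simp [polyChar, eval_mul, map_mul, mul_pow, Finset.prod_mul_distrib]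

open Polynomial in
lemma polyChar_pow {F : Type*} [Field F] (χ : MulChar F ℂ) (A : Finset F) (e : F → ℕ)
    (g : F[X]) (k : ℕ) : polyChar χ A e (g ^ k) = polyChar χ A e g ^ k := by
  induction k with
  | zero => simp [polyChar]
  | succ k ih => rw [pow_succ, polyChar_mul, ih, pow_succ]

/-- The sum of `polyChar` over the monic polynomials of degree `n`. -/
noncomputable def polyCharSum {F : Type*} [Field F] [Finite F] (χ : MulChar F ℂ) (A : Finset F)
    (e : F → ℕ) (n : ℕ) : ℂ :=
  ∑ g ∈ monicFinset F n, polyChar χ A e g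

/-- The coefficients of the logarithmic derivative of the generating series of `polyCharSum`. -/
noncomputable def polyCharPrimeSum {F : Type*} [Field F] [Finite F] (χ : MulChar F ℂ) (A : Finset F)
    (e : F → ℕ) (j : ℕ) : ℂ :=
  ∑ P ∈ monicIrreducibleFinset F j with P.natDegree ∣ j,
    (P.natDegree : ℂ) * polyChar χ A e P ^ (j / P.natDegree)

open Polynomial in
lemma polyCharSum_eq_zero {F : Type*} [Field F] [Fintype F] (χ : MulChar F ℂ) (A : Finset F)
    (e : F → ℕ) (a₀ : F) (ha₀ : a₀ ∈ A) (hχ : χ ^ e a₀ ≠ 1) (n : ℕ) (hn : A.card ≤ n) :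
    polyCharSum χ A e n = 0 := by
  classical
  set B : F[X] := ∏ a ∈ A.erase a₀, (X - C a) with hB
  have hBdeg : B.natDegree < n := by
    rw [hB, natDegree_prod_of_monic _ _ (fun a _ => monic_X_sub_C a)]
    simp only [natDegree_X_sub_C, Finset.sum_const, smul_eq_mul, mul_one]
    rw [Finset.card_erase_of_mem ha₀]
    have : 0 < A.card := Finset.card_pos.2 ⟨a₀, ha₀⟩
    omega
  have hB0 : B.eval a₀ ≠ 0 := by
    rw [hB, eval_prod, Finset.prod_ne_zero_iff]
    intro a ha
    simp only [eval_sub, eval_X, eval_C]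
    exact sub_ne_zero.2 (Finset.ne_of_mem_erase ha).symm
  have hBa : ∀ a ∈ A.erase a₀, B.eval a = 0 := by
    intro a ha
    rw [hB, eval_prod, Finset.prod_eq_zero ha]
    simp
  have hshift : ∀ c : F, ∑ g ∈ monicFinset F n, polyChar χ A e (g + C c * B) =
      polyCharSum χ A e n := by
    intro c
    have hmem : ∀ (c : F) (g : F[X]), g ∈ monicFinset F n → g + C c * B ∈ monicFinset F n := by
      intro c g hg
      rw [mem_monicFinset] at hg ⊢
      have hd : (C c * B).degree < g.degree := by
        rw [degree_eq_natDegree hg.1.ne_zero, hg.2]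
        refine lt_of_le_of_lt (degree_le_natDegree) ?_
        exact (Nat.cast_lt (α := WithBot ℕ)).2 ((natDegree_C_mul_le _ _).trans_lt hBdeg)
      exact ⟨hg.1.add_of_left hd, by rw [natDegree_add_eq_left_of_degree_lt hd, hg.2]⟩
    refine Finset.sum_bij' (fun g _ => g + C c * B) (fun g _ => g + C (-c) * B)
      (fun g hg => hmem c g hg) (fun g hg => hmem (-c) g hg) ?_ ?_ (fun _ _ => rfl)
    · intro g _; simp
    · intro g _; simp
  have hsum : ∑ c : F, ∑ g ∈ monicFinset F n, polyChar χ A e (g + C c * B) = 0 := by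
    rw [Finset.sum_comm]
    refine Finset.sum_eq_zero fun g _ => ?_
    have h1 : ∀ c : F, polyChar χ A e (g + C c * B) =
        (χ ^ e a₀) (g.eval a₀ + c * B.eval a₀) *
          ∏ a ∈ A.erase a₀, χ (g.eval a) ^ e a := by
      intro c
      rw [polyChar, ← Finset.mul_prod_erase _ _ ha₀]
      congr 1
      · have he : e a₀ ≠ 0 := by
          intro h; rw [h, pow_zero] at hχ; exact hχ rfl
        rw [MulChar.pow_apply' _ he]
        simp
      · refine Finset.prod_congr rfl fun a ha => ?_
        simp [hBa a ha]
    simp_rw [h1]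
    rw [← Finset.sum_mul]
    have h2 : ∑ c : F, (χ ^ e a₀) (g.eval a₀ + c * B.eval a₀) = ∑ y : F, (χ ^ e a₀) y := by
      refine Fintype.sum_equiv ((Equiv.mulRight₀ _ hB0).trans (Equiv.addLeft (g.eval a₀))) _ _ ?_
      intro c
      simp
    rw [h2, MulChar.sum_eq_zero_of_ne_one hχ, zero_mul]
  simp_rw [hshift] at hsum
  rw [Finset.sum_const, nsmul_eq_mul] at hsum
  refine (mul_eq_zero.1 hsum).resolve_left ?_
  rw [Finset.card_univ]
  exact_mod_cast Fintype.card_ne_zero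

open Polynomial in
lemma polyCharSum_zero {F : Type*} [Field F] [Finite F] (χ : MulChar F ℂ) (A : Finset F)
    (e : F → ℕ) : polyCharSum χ A e 0 = 1 := by
  have : monicFinset F 0 = {1} := by
    ext g
    rw [mem_monicFinset, Finset.mem_singleton]
    constructor
    · rintro ⟨h1, h2⟩; exact h1.natDegree_eq_zero.1 h2
    · rintro rfl; exact ⟨monic_one, natDegree_one⟩
  rw [polyCharSum, this]
  simp [polyChar]

open Polynomial in
lemma polyCharSum_one {F : Type*} [Field F] [Fintype F] (χ : MulChar F ℂ) (A : Finset F)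
    (e : F → ℕ) : polyCharSum χ A e 1 = ∑ x : F, ∏ a ∈ A, χ (x + a) ^ e a := by
  symm
  rw [polyCharSum]
  refine Finset.sum_bij (fun x _ => X + C x) ?_ ?_ ?_ ?_
  · intro x _
    exact mem_monicFinset.2 ⟨monic_X_add_C x, natDegree_X_add_C x⟩
  · intro x _ y _ h
    exact C_injective (add_left_cancel h)
  · intro g hg
    rw [mem_monicFinset] at hg
    refine ⟨g.coeff 0, Finset.mem_univ _, ?_⟩
    rw [hg.1.eq_X_add_C hg.2]
    simp
  · intro x _
    simp [polyChar, add_comm]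

open Polynomial UniqueFactorizationMonoid Classical in
lemma sum_natDegree_mul_card {F : Type*} [Field F] [Finite F] (n : ℕ) (g : F[X])
    (hg : g ∈ monicFinset F n) :
    ∑ P ∈ monicIrreducibleFinset F n, P.natDegree *
      ((Finset.Icc 1 n).filter fun j => P.natDegree ∣ j ∧ P ^ (j / P.natDegree) ∣ g).card = n := by
  rw [mem_monicFinset] at hg
  obtain ⟨hmon, hdeg⟩ := hg
  have hcard : ∀ P ∈ monicIrreducibleFinset F n,
      ((Finset.Icc 1 n).filter fun j => P.natDegree ∣ j ∧ P ^ (j / P.natDegree) ∣ g).card =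
      (normalizedFactors g).count P := by
    intro P hP
    rw [mem_monicIrreducibleFinset] at hP
    have hPd : 0 < P.natDegree := hP.2.2.natDegree_pos
    have hdvd : ∀ k, P ^ k ∣ g ↔ k ≤ (normalizedFactors g).count P := by
      intro k
      rw [pow_dvd_iff_le_emultiplicity,
          emultiplicity_eq_count_normalizedFactors hP.2.2 hmon.ne_zero,
        hP.1.normalize_eq_self]
      exact Nat.cast_le
    have himg : ((Finset.Icc 1 n).filter fun j => P.natDegree ∣ j ∧ P ^ (j / P.natDegree) ∣ g) =
        (Finset.Icc 1 ((normalizedFactors g).count P)).image (P.natDegree * ·) := by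
      ext j
      simp only [Finset.mem_filter, Finset.mem_Icc, Finset.mem_image]
      constructor
      · rintro ⟨⟨h1, h2⟩, ⟨k, rfl⟩, h3⟩
        rw [Nat.mul_div_cancel_left _ hPd, hdvd] at h3
        exact ⟨k, ⟨Nat.pos_of_mul_pos_left h1, h3⟩, rfl⟩
      · rintro ⟨k, ⟨h1, h2⟩, rfl⟩
        have h3 := (hdvd k).2 h2
        have h4 := natDegree_le_of_dvd h3 hmon.ne_zero
        rw [natDegree_pow, hdeg] at h4
        refine ⟨⟨Nat.mul_pos hPd h1, by rwa [mul_comm]⟩, dvd_mul_right _ _, ?_⟩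
        rwa [Nat.mul_div_cancel_left _ hPd]
    rw [himg, Finset.card_image_of_injective _ (fun a b h => Nat.eq_of_mul_eq_mul_left hPd h)]
    simp
  rw [Finset.sum_congr rfl (fun P hP => by rw [hcard P hP])]
  have hmem : ∀ P ∈ normalizedFactors g, P.Monic := fun P hP => by
    have hirr := irreducible_of_normalized_factor P hP
    have := normalize_normalized_factor P hP
    rw [← this]
    exact monic_normalize hirr.ne_zero
  have hmonic : (normalizedFactors g).prod.Monic := by
    simpa using monic_multiset_prod_of_monic (normalizedFactors g) id hmem
  have hprod : (normalizedFactors g).prod = g :=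
    eq_of_monic_of_associated hmonic hmon (prod_normalizedFactors hmon.ne_zero)
  have h1 : ((normalizedFactors g).map natDegree).sum = n := by
    rw [← natDegree_multiset_prod_of_monic _ hmem, hprod, hdeg]
  rw [Finset.sum_multiset_map_count] at h1
  refine Eq.trans ?_ h1
  symm
  simp only [smul_eq_mul]
  rw [Finset.sum_congr rfl (fun P _ => mul_comm _ _)]
  refine Finset.sum_subset ?_ ?_
  · intro P hP
    rw [Multiset.mem_toFinset] at hP
    rw [mem_monicIrreducibleFinset]
    refine ⟨hmem P hP, ?_, irreducible_of_normalized_factor P hP⟩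
    rw [← hdeg]
    exact natDegree_le_of_dvd (dvd_of_mem_normalizedFactors hP) hmon.ne_zero
  · intro P _ hP
    rw [Multiset.mem_toFinset] at hP
    rw [Multiset.count_eq_zero_of_notMem hP, mul_zero]

open Polynomial Classical in
lemma sum_polyChar_filter_dvd {F : Type*} [Field F] [Finite F] (χ : MulChar F ℂ) (A : Finset F)
    (e : F → ℕ) (n : ℕ) (Q : F[X]) (hQ : Q.Monic) (hQn : Q.natDegree ≤ n) :
    ∑ g ∈ monicFinset F n with Q ∣ g, polyChar χ A e g =
      polyChar χ A e Q * polyCharSum χ A e (n - Q.natDegree) := by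
  rw [polyCharSum, Finset.mul_sum]
  symm
  refine Finset.sum_bij (fun h _ => Q * h) ?_ ?_ ?_ ?_
  · intro h hh
    rw [mem_monicFinset] at hh
    rw [Finset.mem_filter, mem_monicFinset]
    refine ⟨⟨hQ.mul hh.1, ?_⟩, dvd_mul_right _ _⟩
    rw [hQ.natDegree_mul hh.1, hh.2]
    omega
  · intro h _ h' _ hh
    exact mul_left_cancel₀ hQ.ne_zero hh
  · intro g hg
    rw [Finset.mem_filter, mem_monicFinset] at hg
    obtain ⟨⟨hm, hd⟩, h, rfl⟩ := hg
    have hmh : h.Monic := hQ.of_mul_monic_left hm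
    refine ⟨h, ?_, rfl⟩
    rw [mem_monicFinset]
    refine ⟨hmh, ?_⟩
    rw [hQ.natDegree_mul hmh] at hd
    omega
  · intro h _
    rw [polyChar_mul]

open Polynomial Classical in
lemma polyCharSum_recurrence {F : Type*} [Field F] [Finite F] (χ : MulChar F ℂ) (A : Finset F)
    (e : F → ℕ) (n : ℕ) :
    (n : ℂ) * polyCharSum χ A e n = ∑ kl ∈ Finset.HasAntidiagonal.antidiagonal n,
      polyCharPrimeSum χ A e kl.1 * polyCharSum χ A e kl.2 := by
  have hS0 : polyCharPrimeSum χ A e 0 = 0 := by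
    rw [polyCharPrimeSum]
    refine Finset.sum_eq_zero fun P hP => ?_
    rw [Finset.mem_filter, mem_monicIrreducibleFinset] at hP
    have := hP.1.2.2.natDegree_pos
    omega
  have hSj : ∀ j ∈ Finset.Icc 1 n, polyCharPrimeSum χ A e j * polyCharSum χ A e (n - j) =
      ∑ P ∈ monicIrreducibleFinset F n, if P.natDegree ∣ j then
        (P.natDegree : ℂ) * ∑ g ∈ monicFinset F n with P ^ (j / P.natDegree) ∣ g,
          polyChar χ A e g else 0 := by
    intro j hj
    rw [Finset.mem_Icc] at hj
    rw [polyCharPrimeSum, Finset.sum_mul, ← Finset.sum_filter]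
    refine Finset.sum_congr ?_ ?_
    · ext P
      rw [Finset.mem_filter, Finset.mem_filter, mem_monicIrreducibleFinset,
        mem_monicIrreducibleFinset]
      constructor
      · rintro ⟨⟨h1, h2, h3⟩, h4⟩
        exact ⟨⟨h1, h2.trans hj.2, h3⟩, h4⟩
      · rintro ⟨⟨h1, h2, h3⟩, h4⟩
        exact ⟨⟨h1, Nat.le_of_dvd hj.1 h4, h3⟩, h4⟩
    · intro P hP
      rw [Finset.mem_filter, mem_monicIrreducibleFinset] at hP
      obtain ⟨⟨h1, h2, h3⟩, h4⟩ := hP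
      have hd : (P ^ (j / P.natDegree)).natDegree = j := by
        rw [natDegree_pow, Nat.div_mul_cancel h4]
      rw [sum_polyChar_filter_dvd χ A e n _ (h1.pow _) (by rw [hd]; exact hj.2), hd, polyChar_pow,
        mul_assoc]
  rw [Finset.Nat.sum_antidiagonal_eq_sum_range_succ_mk, Finset.sum_range_succ', hS0, zero_mul,
    add_zero]
  have hrange : ∑ k ∈ Finset.range n, polyCharPrimeSum χ A e (k + 1) *
      polyCharSum χ A e (n - (k + 1)) =
      ∑ j ∈ Finset.Icc 1 n, polyCharPrimeSum χ A e j * polyCharSum χ A e (n - j) := by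
    rw [Finset.range_eq_Ico, Finset.sum_Ico_add' (fun j => polyCharPrimeSum χ A e j *
      polyCharSum χ A e (n - j)) 0 n 1]
    rfl
  rw [hrange, Finset.sum_congr rfl hSj, Finset.sum_comm, polyCharSum, Finset.mul_sum]
  have hg : ∀ g ∈ monicFinset F n, (n : ℂ) * polyChar χ A e g =
      ∑ P ∈ monicIrreducibleFinset F n, ∑ j ∈ Finset.Icc 1 n,
        if P.natDegree ∣ j ∧ P ^ (j / P.natDegree) ∣ g then
          (P.natDegree : ℂ) * polyChar χ A e g else 0 := by
    intro g hg
    conv_lhs => rw [← sum_natDegree_mul_card n g hg]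
    push_cast
    rw [Finset.sum_mul]
    refine Finset.sum_congr rfl fun P _ => ?_
    rw [← Finset.sum_filter, Finset.sum_const, nsmul_eq_mul]
    ring
  rw [Finset.sum_congr rfl hg, Finset.sum_comm]
  refine Finset.sum_congr rfl fun P _ => ?_
  rw [Finset.sum_comm]
  refine Finset.sum_congr rfl fun j _ => ?_
  split_ifs with h
  · rw [Finset.sum_filter, Finset.mul_sum]
    refine Finset.sum_congr rfl fun g _ => ?_
    simp [h]
  · refine Finset.sum_eq_zero fun g _ => ?_
    simp [h]

/-- The composition of a multiplicative character with the norm of a field extension. -/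
noncomputable def MulChar.compNorm {F : Type*} [Field F] (K : Type*) [Field K] [Algebra F K]
    [FiniteDimensional F K] (χ : MulChar F ℂ) : MulChar K ℂ where
  toFun x := χ (Algebra.norm F x)
  map_one' := by simp
  map_mul' := by simp
  map_nonunit' x hx := by
    have hx0 : x = 0 := by
      by_contra h
      exact hx (isUnit_iff_ne_zero.2 h)
    subst hx0
    rw [Algebra.norm_zero]
    exact χ.map_nonunit not_isUnit_zero

lemma MulChar.compNorm_apply {F : Type*} [Field F] (K : Type*) [Field K] [Algebra F K]
    [FiniteDimensional F K] (χ : MulChar F ℂ) (x : K) :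
    χ.compNorm K x = χ (Algebra.norm F x) := rfl

open Polynomial in
lemma polyCharPrimeSum_eq {F : Type*} [Field F] [Finite F] (K : Type*) [Field K] [Fintype K]
    [Algebra F K] (χ : MulChar F ℂ) (A : Finset F) (e : F → ℕ) :
    polyCharPrimeSum χ A e (Module.finrank F K) =
      ∑ x : K, χ.compNorm K ((∏ a ∈ A, (C (algebraMap F K a) - X) ^ e a).eval x) := by
  have h := sum_minpoly_eq (F := F) (K := K)
    (fun P => polyChar χ A e P ^ (Module.finrank F K / P.natDegree))
  rw [polyCharPrimeSum, ← h]
  refine Finset.sum_congr rfl fun x _ => ?_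
  rw [eval_prod, map_prod, polyChar, ← Finset.prod_pow]
  refine Finset.prod_congr rfl fun a _ => ?_
  rw [eval_pow, map_pow, eval_sub, eval_C, eval_X, MulChar.compNorm_apply, norm_algebraMap_sub,
    map_pow, ← pow_mul, ← pow_mul, mul_comm]

open Polynomial in
lemma exists_polyCharPrimeSum_bound (p : ℕ) [Fact p.Prime] (ℓ : ℕ) (hℓ : ℓ.Prime)
    (χ : MulChar (ZMod p) ℂ) (hχ : χ ≠ 1) (hχℓ : χ ^ ℓ = 1) (A : Finset (ZMod p))
    (e : ZMod p → ℕ) (a₀ : ZMod p) (ha₀ : a₀ ∈ A) (he : ¬ ℓ ∣ e a₀) :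
    ∃ C : ℝ, ∀ j, ‖polyCharPrimeSum χ A e j‖ ≤ C * √p ^ j := by
  classical
  obtain ⟨C, hC0, hC⟩ := exists_charSum_bound ℓ (∑ a ∈ A, e a) hℓ
  refine ⟨C, fun j => ?_⟩
  rcases Nat.eq_zero_or_pos j with rfl | hj
  · have hS0 : polyCharPrimeSum χ A e 0 = 0 := by
      rw [polyCharPrimeSum]
      refine Finset.sum_eq_zero fun P hP => ?_
      rw [Finset.mem_filter, mem_monicIrreducibleFinset] at hP
      have := hP.1.2.2.natDegree_pos
      omega
    rw [hS0]
    simpa using hC0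
  · have hj0 : j ≠ 0 := hj.ne'
    have : Fintype (GaloisField p j) := Fintype.ofFinite _
    set K := GaloisField p j
    have hfr : Module.finrank (ZMod p) K = j := GaloisField.finrank p hj0
    have hcard : Fintype.card K = p ^ j := by
      rw [← Nat.card_eq_fintype_card]; exact GaloisField.card p j hj0
    have hdeg1 : ∀ b : K, (Polynomial.C b - X : K[X]).natDegree = 1 := fun b => by
      rw [← neg_sub, natDegree_neg, natDegree_X_sub_C]
    have hne1 : ∀ b : K, (Polynomial.C b - X : K[X]) ≠ 0 := fun b h => by
      have := hdeg1 b
      rw [h] at this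
      simp at this
    have h := hC K (χ.compNorm K) (∏ a ∈ A, (Polynomial.C (algebraMap (ZMod p) K a) - X) ^ e a)
      (algebraMap (ZMod p) K a₀) ?_ ?_ ?_ ?_ ?_
    · rw [← polyCharPrimeSum_eq, hfr, hcard] at h
      rw [Nat.cast_pow] at h
      rw [← Real.sqrt_sq (by positivity : 0 ≤ √(p:ℝ) ^ j), ← pow_mul, mul_comm j,
        pow_mul, Real.sq_sqrt (by positivity)]
      exact h
    · obtain ⟨x, hx⟩ := MulChar.ne_one_iff.1 hχ
      obtain ⟨y, hy⟩ := FiniteField.norm_surjective (ZMod p) K (x : ZMod p)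
      intro h1
      have h2 : χ.compNorm K y = 1 := by
        rw [h1, MulChar.one_apply]
        by_contra h
        have : y = 0 := by
          by_contra h'
          exact h (isUnit_iff_ne_zero.2 h')
        rw [this, Algebra.norm_zero] at hy
        exact x.ne_zero hy.symm
      rw [MulChar.compNorm_apply, hy] at h2
      exact hx h2
    · ext y
      rw [MulChar.pow_apply_coe, MulChar.compNorm_apply, ← MulChar.pow_apply' _ hℓ.ne_zero, hχℓ,
        MulChar.one_apply, MulChar.one_apply y.isUnit]
      exact y.isUnit.map _
    · exact Finset.prod_ne_zero_iff.2 fun a _ => pow_ne_zero _ (hne1 _)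
    · rw [natDegree_prod _ _ fun a _ => pow_ne_zero _ (hne1 _)]
      refine Finset.sum_congr rfl fun a _ => ?_
      rw [natDegree_pow, hdeg1, mul_one]
    · have hrm : (∏ a ∈ A, (Polynomial.C (algebraMap (ZMod p) K a) - X) ^ e a).rootMultiplicity
          (algebraMap (ZMod p) K a₀) = e a₀ := by
        rw [← Finset.mul_prod_erase _ _ ha₀, rootMultiplicity_mul
          (mul_ne_zero (pow_ne_zero _ (hne1 _)) (Finset.prod_ne_zero_iff.2
            fun a _ => pow_ne_zero _ (hne1 _)))]
        have h1 : (∏ a ∈ A.erase a₀, (Polynomial.C (algebraMap (ZMod p) K a) - X) ^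
            e a).rootMultiplicity (algebraMap (ZMod p) K a₀) = 0 := by
          refine rootMultiplicity_eq_zero ?_
          rw [IsRoot, eval_prod, Finset.prod_eq_zero_iff]
          rintro ⟨a, ha, h⟩
          rw [eval_pow, eval_sub, eval_C, eval_X] at h
          have h' := (algebraMap (ZMod p) K).injective
              (sub_eq_zero.1 (by simpa using
                (pow_eq_zero_iff (fun h0 => by simp [h0] at h)).1 h))
          exact (Finset.ne_of_mem_erase ha) h'
        have h2 : ((Polynomial.C (algebraMap (ZMod p) K a₀) - X) ^ e a₀).rootMultiplicity
            (algebraMap (ZMod p) K a₀) = e a₀ := by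
          rw [← count_roots, roots_pow, Multiset.count_nsmul, ← neg_sub, roots_neg, roots_X_sub_C]
          simp
        rw [h1, h2, add_zero]
      rwa [hrm]

/-- Weil's bound for a character of prime order evaluated at a product of linear factors. -/
theorem weil_bound (p : ℕ) [Fact p.Prime] (ℓ : ℕ) (hℓ : ℓ.Prime)
    (χ : MulChar (ZMod p) ℂ) (hχ : χ ≠ 1) (hχℓ : χ ^ ℓ = 1) (A : Finset (ZMod p))
    (e : ZMod p → ℕ) (a₀ : ZMod p) (ha₀ : a₀ ∈ A) (he : ¬ ℓ ∣ e a₀) :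
    ‖∑ x : ZMod p, ∏ a ∈ A, χ (x + a) ^ e a‖ ≤ ((A.card : ℝ) - 1) * √p := by
  obtain ⟨C, hC⟩ := exists_polyCharPrimeSum_bound p ℓ hℓ χ hχ hχℓ A e a₀ ha₀ he
  have hp : 0 < p := (Fact.out : p.Prime).pos
  have : Fact ℓ.Prime := ⟨hℓ⟩
  have hord : orderOf χ = ℓ := orderOf_eq_prime hχℓ hχ
  have hpow : χ ^ e a₀ ≠ 1 := fun h => he (hord ▸ orderOf_dvd_of_pow_eq_one h)
  have hA : 1 ≤ A.card := Finset.card_pos.2 ⟨a₀, ha₀⟩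
  have h := norm_coeff_one_le_of_recurrence (polyCharSum χ A e) (polyCharPrimeSum χ A e)
    (A.card - 1) (√p) C (Real.sqrt_pos.2 (by exact_mod_cast hp)) (polyCharSum_zero χ A e)
    (fun n hn => polyCharSum_eq_zero χ A e a₀ ha₀ hpow n (by omega)) hC
    (polyCharSum_recurrence χ A e)
  rw [polyCharSum_one] at h
  rw [Nat.cast_sub hA, Nat.cast_one] at h
  exact h

/-- The number of ways to distribute `t` over two binomials of order `r` in classes that agree
modulo `ℓ`. -/
noncomputable def congruentChoose (ℓ r t : ℕ) : ℝ :=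
  ∑ jl ∈ Finset.HasAntidiagonal.antidiagonal t with ℓ ∣ jl.1 + (ℓ - 1) * jl.2,
    ((r.choose jl.1 : ℝ) * r.choose jl.2)

lemma congruentChoose_nonneg (ℓ r t : ℕ) : 0 ≤ congruentChoose ℓ r t :=
  Finset.sum_nonneg fun _ _ => by positivity

lemma congruentChoose_le (ℓ r t : ℕ) : congruentChoose ℓ r t ≤ (2 * r).choose t := by
  have h : ((2 * r).choose t : ℝ) = ∑ jl ∈ Finset.HasAntidiagonal.antidiagonal t,
      ((r.choose jl.1 : ℝ) * r.choose jl.2) := by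
    rw [two_mul, Nat.add_choose_eq]
    push_cast
    rfl
  rw [h]
  exact Finset.sum_le_sum_of_subset_of_nonneg (Finset.filter_subset _ _)
    fun _ _ _ => by positivity

lemma mul_le_of_sq_le_four_mul {Q U V a : ℝ} (hU : 0 ≤ U) (hV : 0 ≤ V) (h : Q ^ 2 ≤ 4 * (U * V)) :
    Q * a ≤ U * a ^ 2 + V := by
  have h1 : (Q * a) ^ 2 ≤ (U * a ^ 2 + V) ^ 2 := by
    have : (Q * a) ^ 2 ≤ 4 * (U * V) * a ^ 2 := by
      rw [mul_pow]; exact mul_le_mul_of_nonneg_right h (sq_nonneg a)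
    nlinarith [sq_nonneg (U * a ^ 2 - V)]
  exact (le_abs_self _).trans (abs_le_of_sq_le_sq h1 (by positivity)) |>.trans le_rfl

lemma congruentChoose_two_odd (r i : ℕ) : congruentChoose 2 r (2 * i + 1) = 0 := by
  refine Finset.sum_eq_zero fun jl h => ?_
  rw [Finset.mem_filter, Finset.HasAntidiagonal.mem_antidiagonal] at h
  omega

lemma congruentChoose_zero (ℓ r : ℕ) : congruentChoose ℓ r 0 = 1 := by
  simp [congruentChoose, Finset.sum_filter]

lemma congruentChoose_one (ℓ r : ℕ) (hℓ : 3 ≤ ℓ) : congruentChoose ℓ r 1 = 0 := by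
  have h1 : ¬ ℓ ∣ 1 := fun h => by have := Nat.le_of_dvd (by norm_num) h; omega
  have h2 : ¬ ℓ ∣ ℓ - 1 := fun h => by have := Nat.le_of_dvd (by omega) h; omega
  rw [congruentChoose, Finset.sum_filter, Finset.Nat.antidiagonal_succ]
  simp [h1, h2]

lemma congruentChoose_two (ℓ r : ℕ) (hℓ : 3 ≤ ℓ) : congruentChoose ℓ r 2 = (r : ℝ) ^ 2 := by
  have h1 : ¬ ℓ ∣ 2 := fun h => by have := Nat.le_of_dvd (by norm_num) h; omega
  have h2 : ¬ ℓ ∣ (ℓ - 1) * 2 := fun h => by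
    obtain ⟨c, hc⟩ := h
    have h3 : ℓ * (2 - c) = 2 := by rw [Nat.mul_sub]; omega
    exact h1 ⟨_, h3.symm⟩
  have h3 : ℓ ∣ 1 + (ℓ - 1) := ⟨1, by omega⟩
  have : Finset.HasAntidiagonal.antidiagonal 2 = {(0, 2), (1, 1), (2, 0)} := by rfl
  rw [congruentChoose, Finset.sum_filter, this]
  simp [h1, h2, h3]
  ring

lemma congruentChoose_three (ℓ r : ℕ) (hℓ : 3 ≤ ℓ) :
    congruentChoose ℓ r 3 ≤ 2 * (r.choose 3 : ℝ) := by
  have h1 : ¬ ℓ ∣ 1 + (ℓ - 1) * 2 := fun h => by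
    obtain ⟨c, hc⟩ := h
    have h3 : ℓ * (2 - c) = 1 := by rw [Nat.mul_sub]; omega
    have := Nat.le_of_dvd (by norm_num) ⟨_, h3.symm⟩
    omega
  have h2 : ¬ ℓ ∣ 2 + (ℓ - 1) * 1 := fun h => by
    have h3 : ℓ ∣ 1 := by
      have : 2 + (ℓ - 1) * 1 = ℓ + 1 := by omega
      rw [this] at h
      exact (Nat.dvd_add_right (dvd_refl ℓ)).1 h
    have := Nat.le_of_dvd (by norm_num) h3
    omega
  have : Finset.HasAntidiagonal.antidiagonal 3 = {(0, 3), (1, 2), (2, 1), (3, 0)} := by rfl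
  rw [congruentChoose, Finset.sum_filter, this]
  rw [Finset.sum_insert (by decide), Finset.sum_insert (by decide), Finset.sum_insert (by decide),
    Finset.sum_singleton]
  simp only [h1, h2, if_false]
  have : (0:ℝ) ≤ r.choose 3 := by positivity
  split_ifs <;> simp <;> linarith

lemma choose_sq_le (r i : ℕ) (hi : 1 ≤ i) (hir : i < r) :
    ((2 * r).choose (2 * i + 1) : ℝ) ^ 2 ≤
      4 * ((1 / 2 * (2 * r).choose (2 * i)) * (4 / 3 * (2 * r).choose (2 * (i + 1)))) := by
  have h1 := Nat.choose_succ_right_eq (2 * r) (2 * i)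
  have h2 := Nat.choose_succ_right_eq (2 * r) (2 * i + 1)
  obtain ⟨d, rfl⟩ : ∃ d, r = i + 1 + d := ⟨r - (i + 1), by omega⟩
  rw [show 2 * (i + 1 + d) - 2 * i = 2 * d + 2 by omega] at h1
  rw [show 2 * (i + 1 + d) - (2 * i + 1) = 2 * d + 1 by omega] at h2
  rw [show 2 * (i + 1) = 2 * i + 1 + 1 by ring]
  set P : ℕ := (2 * (i + 1 + d)).choose (2 * i)
  set Q : ℕ := (2 * (i + 1 + d)).choose (2 * i + 1)
  set R : ℕ := (2 * (i + 1 + d)).choose (2 * i + 1 + 1)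
  have h1' : (Q : ℝ) * (2 * i + 1) = P * (2 * d + 2) := by exact_mod_cast h1
  have h2' : (R : ℝ) * (2 * i + 1 + 1) = Q * (2 * d + 1) := by exact_mod_cast h2
  have hi' : (1 : ℝ) ≤ i := by exact_mod_cast hi
  have hd : (0 : ℝ) ≤ d := by positivity
  have hP : (P : ℝ) = Q * (2 * i + 1) / (2 * d + 2) := by field_simp; linarith
  have hR : (R : ℝ) = Q * (2 * d + 1) / (2 * i + 2) := by field_simp; linarith
  rw [hP, hR]
  have : 4 * (1 / 2 * ((Q : ℝ) * (2 * i + 1) / (2 * d + 2))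
      * (4 / 3 * (Q * (2 * d + 1) / (2 * i + 2))))
      = (Q : ℝ) ^ 2 * ((8 * ((2 * i + 1) * (2 * d + 1))) / (3 * ((2 * d + 2) * (2 * i + 2)))) := by
    field_simp
    ring
  rw [this]
  refine le_mul_of_one_le_right (sq_nonneg _) ?_
  rw [one_le_div (by positivity)]
  nlinarith

lemma sum_range_two_mul_add_one (f : ℕ → ℝ) (r : ℕ) :
    ∑ t ∈ Finset.range (2 * r + 1), f t =
      ∑ i ∈ Finset.range (r + 1), f (2 * i) + ∑ i ∈ Finset.range r, f (2 * i + 1) := by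
  induction r with
  | zero => simp
  | succ r ih =>
    rw [show 2 * (r + 1) + 1 = 2 * r + 1 + 1 + 1 by ring, Finset.sum_range_succ,
      Finset.sum_range_succ, ih, Finset.sum_range_succ _ (r + 1),
      Finset.sum_range_succ (fun i => f (2 * i + 1)) r,
      show 2 * (r + 1) = 2 * r + 1 + 1 by ring]
    abel

lemma sum_congruentChoose_le (ℓ r : ℕ) (hℓ : 2 ≤ ℓ) (a : ℝ) (ha : 0 ≤ a) :
    ∑ t ∈ Finset.range (2 * r + 1), congruentChoose ℓ r t * a ^ (2 * r - t) ≤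
      ∑ i ∈ Finset.range (r + 1), (2 * r).choose (2 * i) * ((2 * i - 1).doubleFactorial : ℝ) *
        a ^ (2 * (r - i)) := by
  have hdf : ∀ i, (1 : ℝ) ≤ ((2 * i - 1).doubleFactorial : ℝ) := fun i => by
    exact_mod_cast Nat.doubleFactorial_pos _
  rw [sum_range_two_mul_add_one]
  rcases Nat.eq_or_lt_of_le hℓ with h2 | h3
  · subst h2
    have : ∑ i ∈ Finset.range r, congruentChoose 2 r (2 * i + 1) * a ^ (2 * r - (2 * i + 1)) = 0 :=
      Finset.sum_eq_zero fun i _ => by rw [congruentChoose_two_odd, zero_mul]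
    rw [this, add_zero]
    refine Finset.sum_le_sum fun i hi => ?_
    rw [show 2 * r - 2 * i = 2 * (r - i) by omega]
    refine mul_le_mul_of_nonneg_right ?_ (by positivity)
    refine (congruentChoose_le 2 r _).trans (le_mul_of_one_le_right (by positivity) (hdf i))
  · have hℓ3 : 3 ≤ ℓ := h3
    let U : ℕ → ℝ := fun i => if i = 0 then 0 else if i = 1 then (r : ℝ) * (r - 1) / 4 else
      1 / 2 * (2 * r).choose (2 * i)
    let V : ℕ → ℝ := fun i => if i ≤ 1 then 0 else 4 / 3 * (2 * r).choose (2 * i)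
    have hc2 : ((2 * r).choose 2 : ℝ) = r * (2 * r - 1) := by
      rw [Nat.cast_choose_two]; push_cast; ring
    have hrr : (0 : ℝ) ≤ (r : ℝ) * (r - 1) := by
      rcases Nat.eq_zero_or_pos r with h | h
      · simp [h]
      · have : (1 : ℝ) ≤ r := by exact_mod_cast h
        exact mul_nonneg (by positivity) (by linarith)
    have hU0 : ∀ i, 0 ≤ U i := by
      intro i
      simp only [U]
      split_ifs
      · exact le_rfl
      · positivity
      · positivity
    have hV0 : ∀ i, 0 ≤ V i := by
      intro i
      simp only [V]
      split_ifs
      · exact le_rfl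
      · positivity
    have hodd : ∀ i ∈ Finset.range r, congruentChoose ℓ r (2 * i + 1) * a ^ (2 * r - (2 * i + 1)) ≤
        U i * a ^ (2 * (r - i)) + V (i + 1) * a ^ (2 * (r - (i + 1))) := by
      intro i hi
      rw [Finset.mem_range] at hi
      rw [show 2 * r - (2 * i + 1) = 2 * (r - (i + 1)) + 1 by omega,
        show 2 * (r - i) = 2 * (r - (i + 1)) + 2 by omega]
      have hx : 0 ≤ a ^ (2 * (r - (i + 1))) := by positivity
      rw [pow_succ a _, pow_add a _ 2]
      suffices h : congruentChoose ℓ r (2 * i + 1) * a ≤ U i * a ^ 2 + V (i + 1) by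
        calc _ = (congruentChoose ℓ r (2 * i + 1) * a) * a ^ (2 * (r - (i + 1))) := by ring
          _ ≤ (U i * a ^ 2 + V (i + 1)) * a ^ (2 * (r - (i + 1))) :=
            mul_le_mul_of_nonneg_right h hx
          _ = _ := by ring
      rcases Nat.lt_or_ge i 1 with h0 | h1
      · obtain rfl : i = 0 := by omega
        rw [mul_zero, zero_add, congruentChoose_one ℓ r hℓ3]
        simp [U, V]
      refine mul_le_of_sq_le_four_mul (hU0 _) (hV0 _) ?_
      rcases Nat.eq_or_lt_of_le h1 with h1 | h1
      · subst h1
        have hle : congruentChoose ℓ r (2 * 1 + 1) ^ 2 ≤ (2 * (r.choose 3 : ℝ)) ^ 2 :=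
          pow_le_pow_left₀ (congruentChoose_nonneg _ _ _) (congruentChoose_three ℓ r hℓ3) 2
        refine hle.trans ?_
        obtain ⟨d, rfl⟩ : ∃ d, r = d + 2 := ⟨r - 2, by omega⟩
        have e1 := Nat.choose_succ_right_eq (d + 2) 2
        have e2 := Nat.choose_succ_right_eq (2 * (d + 2)) 2
        have e3 := Nat.choose_succ_right_eq (2 * (d + 2)) 3
        rw [show d + 2 - 2 = d by omega] at e1
        rw [show 2 * (d + 2) - 2 = 2 * d + 2 by omega] at e2
        rw [show 2 * (d + 2) - 3 = 2 * d + 1 by omega] at e3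
        have e1' : ((d + 2).choose 3 : ℝ) * 3 = (d + 2).choose 2 * d := by exact_mod_cast e1
        have e2' : ((2 * (d + 2)).choose 3 : ℝ) * 3 = (2 * (d + 2)).choose 2 * (2 * d + 2) := by
          exact_mod_cast e2
        have e3' : ((2 * (d + 2)).choose 4 : ℝ) * 4 = (2 * (d + 2)).choose 3 * (2 * d + 1) := by
          exact_mod_cast e3
        have e0 : ((d + 2).choose 2 : ℝ) = (d + 2) * (d + 1) / 2 := by
          rw [Nat.cast_choose_two]; push_cast; ring
        rw [hc2] at e2'
        rw [e0] at e1'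
        push_cast at e2'
        have f1 : ((d + 2).choose 3 : ℝ) = (d + 2) * (d + 1) * d / 6 := by linarith
        have f3 : ((2 * (d + 2)).choose 3 : ℝ) =
          (d + 2) * (2 * (d + 2) - 1) * (2 * d + 2) / 3 := by linarith
        rw [f3] at e3'
        have f4 : ((2 * (d + 2)).choose 4 : ℝ) =
          (d + 2) * (2 * (d + 2) - 1) * (2 * d + 2) / 3 * (2 * d + 1) / 4 := by linarith
        simp only [U, V]
        norm_num
        rw [f1, f4]
        have hd : (0 : ℝ) ≤ d := by positivity
        have : (0 : ℝ) ≤ ((d + 2) * (d + 1)) ^ 2 * (7 * d ^ 2 + 16 * d + 6) := by positivity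
        nlinarith
      · have hle : congruentChoose ℓ r (2 * i + 1) ^ 2 ≤ ((2 * r).choose (2 * i + 1) : ℝ) ^ 2 :=
          pow_le_pow_left₀ (congruentChoose_nonneg _ _ _) (congruentChoose_le ℓ r _) 2
        refine hle.trans ((choose_sq_le r i (by omega) hi).trans (le_of_eq ?_))
        simp only [U, V]
        rw [if_neg (by omega), if_neg (by omega), if_neg (by omega)]
    have hV : ∑ i ∈ Finset.range r, V (i + 1) * a ^ (2 * (r - (i + 1))) =
        ∑ i ∈ Finset.range (r + 1), V i * a ^ (2 * (r - i)) := by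
      rw [Finset.sum_range_succ' _ r]
      simp [V]
    have hU : ∑ i ∈ Finset.range r, U i * a ^ (2 * (r - i)) ≤
        ∑ i ∈ Finset.range (r + 1), U i * a ^ (2 * (r - i)) := by
      rw [Finset.sum_range_succ _ r]
      have := mul_nonneg (hU0 r) (by positivity : 0 ≤ a ^ (2 * (r - r)))
      linarith
    have hsum := Finset.sum_le_sum hodd
    rw [Finset.sum_add_distrib, hV] at hsum
    refine (add_le_add_right (hsum.trans (add_le_add_left hU _)) _).trans ?_
    rw [← Finset.sum_add_distrib, ← Finset.sum_add_distrib]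
    refine Finset.sum_le_sum fun i hi => ?_
    rw [show 2 * r - 2 * i = 2 * (r - i) by omega, ← add_mul, ← add_mul]
    refine mul_le_mul_of_nonneg_right ?_ (by positivity)
    rcases i with _ | _ | i
    · simp [U, V, congruentChoose_zero]
    · rw [zero_add, mul_one, congruentChoose_two ℓ r hℓ3, hc2]
      simp [U, V]
      nlinarith
    · have h3 : (3 : ℝ) ≤ ((2 * (i + 1 + 1) - 1).doubleFactorial : ℝ) := by
        have h : 3 ≤ (2 * (i + 1 + 1) - 1).doubleFactorial := by
          rw [show 2 * (i + 1 + 1) - 1 = (2 * i + 1) + 2 by omega, Nat.doubleFactorial]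
          have := Nat.doubleFactorial_pos (2 * i + 1)
          nlinarith
        exact_mod_cast h
      have hC := congruentChoose_le ℓ r (2 * (i + 1 + 1))
      have hC0 : (0 : ℝ) ≤ (2 * r).choose (2 * (i + 1 + 1)) := by positivity
      simp only [U, V]
      rw [if_neg (by omega), if_neg (by omega), if_neg (by omega)]
      nlinarith

lemma IsPrimitiveRoot.sum_pow_mul {η : ℂ} {ℓ : ℕ} (hη : IsPrimitiveRoot η ℓ) (m : ℕ) :
    ∑ k : Fin ℓ, (η ^ (k : ℕ)) ^ m = if ℓ ∣ m then (ℓ : ℂ) else 0 := by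
  rw [Fin.sum_univ_eq_sum_range (fun k => (η ^ k) ^ m) ℓ]
  have h : ∀ k, (η ^ k) ^ m = (η ^ m) ^ k := fun k => by rw [← pow_mul, ← pow_mul, mul_comm]
  simp_rw [h]
  split_ifs with hd
  · rw [(hη.pow_eq_one_iff_dvd m).2 hd]
    simp
  · have hne : η ^ m ≠ 1 := fun h => hd ((hη.pow_eq_one_iff_dvd m).1 h)
    rw [geom_sum_eq hne, ← h ℓ, hη.pow_eq_one, one_pow, sub_self, zero_div]

lemma IsPrimitiveRoot.conj_pow_eq {η : ℂ} {ℓ : ℕ} (hη : IsPrimitiveRoot η ℓ) (hℓ : 0 < ℓ) (k : ℕ) :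
    (starRingEnd ℂ) (η ^ k) = (η ^ k) ^ (ℓ - 1) := by
  have h1 : (η ^ k) ^ ℓ = 1 := by rw [← pow_mul, mul_comm, pow_mul, hη.pow_eq_one, one_pow]
  have h2 : ‖η ^ k‖ = 1 := Complex.norm_eq_one_of_pow_eq_one h1 hℓ.ne'
  have h3 : η ^ k ≠ 0 := fun h => by rw [h] at h2; simp at h2
  have h4 : (starRingEnd ℂ) (η ^ k) = (η ^ k)⁻¹ := (Complex.inv_eq_conj h2).symm
  rw [h4]
  refine inv_eq_of_mul_eq_one_right ?_
  rw [mul_comm, ← pow_succ, Nat.sub_add_cancel hℓ, h1]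

/-- Averaging `|S + ζ|^{2r}` over the `ℓ`-th roots of unity. -/
lemma sum_norm_add_root_pow_le {η : ℂ} {ℓ : ℕ} (hη : IsPrimitiveRoot η ℓ) (hℓ : 2 ≤ ℓ) (r : ℕ)
    (S : ℂ) :
    ∑ k : Fin ℓ, ‖η ^ (k : ℕ) + S‖ ^ (2 * r) ≤
      ℓ * ∑ i ∈ Finset.range (r + 1), (2 * r).choose (2 * i) * ((2 * i - 1).doubleFactorial : ℝ) *
        ‖S‖ ^ (2 * (r - i)) := by
  have hℓ0 : 0 < ℓ := by omega
  refine le_trans ?_ (mul_le_mul_of_nonneg_left (sum_congruentChoose_le ℓ r hℓ ‖S‖ (norm_nonneg S))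
    (by positivity))
  have hexp : ∀ k : Fin ℓ, ((‖η ^ (k : ℕ) + S‖ ^ (2 * r) : ℝ) : ℂ) =
      ∑ j ∈ Finset.range (r + 1), ∑ l ∈ Finset.range (r + 1),
        ((r.choose j : ℂ) * r.choose l * S ^ (r - j) * (starRingEnd ℂ) S ^ (r - l)) *
          (η ^ (k : ℕ)) ^ (j + (ℓ - 1) * l) := by
    intro k
    have h1 : ((‖η ^ (k : ℕ) + S‖ ^ (2 * r) : ℝ) : ℂ) =
        (η ^ (k : ℕ) + S) ^ r * ((η ^ (k : ℕ)) ^ (ℓ - 1) + (starRingEnd ℂ) S) ^ r := by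
      rw [← hη.conj_pow_eq hℓ0, ← map_add, ← mul_pow, Complex.mul_conj, pow_mul,
        Complex.normSq_eq_norm_sq]
      push_cast
      rfl
    rw [h1, add_pow, add_pow, Finset.sum_mul_sum]
    refine Finset.sum_congr rfl fun j _ => Finset.sum_congr rfl fun l _ => ?_
    rw [pow_add, pow_mul]
    ring
  have hsum : ((∑ k : Fin ℓ, ‖η ^ (k : ℕ) + S‖ ^ (2 * r) : ℝ) : ℂ) =
      ∑ j ∈ Finset.range (r + 1), ∑ l ∈ Finset.range (r + 1),
        ((r.choose j : ℂ) * r.choose l * S ^ (r - j) * (starRingEnd ℂ) S ^ (r - l)) *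
          (if ℓ ∣ j + (ℓ - 1) * l then (ℓ : ℂ) else 0) := by
    rw [Complex.ofReal_sum, Finset.sum_congr rfl fun k _ => hexp k, Finset.sum_comm]
    refine Finset.sum_congr rfl fun j _ => ?_
    rw [Finset.sum_comm]
    refine Finset.sum_congr rfl fun l _ => ?_
    rw [← Finset.mul_sum, hη.sum_pow_mul]
  have hnonneg : 0 ≤ ∑ k : Fin ℓ, ‖η ^ (k : ℕ) + S‖ ^ (2 * r) :=
    Finset.sum_nonneg fun _ _ => by positivity
  rw [← abs_of_nonneg hnonneg, ← Real.norm_eq_abs, ← Complex.norm_real, hsum]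
  have hbound : ‖∑ j ∈ Finset.range (r + 1), ∑ l ∈ Finset.range (r + 1),
        ((r.choose j : ℂ) * r.choose l * S ^ (r - j) * (starRingEnd ℂ) S ^ (r - l)) *
          (if ℓ ∣ j + (ℓ - 1) * l then (ℓ : ℂ) else 0)‖ ≤
      ∑ j ∈ Finset.range (r + 1), ∑ l ∈ Finset.range (r + 1),
        (ℓ : ℝ) * (if ℓ ∣ j + (ℓ - 1) * l then
          ((r.choose j : ℝ) * r.choose l * ‖S‖ ^ (2 * r - (j + l))) else 0) := by
    refine (norm_sum_le _ _).trans (Finset.sum_le_sum fun j hj => ?_)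
    refine (norm_sum_le _ _).trans (Finset.sum_le_sum fun l hl => ?_)
    rw [Finset.mem_range] at hj hl
    split_ifs
    · rw [norm_mul, norm_mul, norm_mul, norm_mul, norm_pow, norm_pow, RCLike.norm_conj,
        Complex.norm_natCast, Complex.norm_natCast, Complex.norm_natCast,
        show 2 * r - (j + l) = r - j + (r - l) by omega, pow_add]
      exact le_of_eq (by ring)
    · simp
  refine hbound.trans (le_of_eq ?_)
  simp_rw [← Finset.mul_sum]
  congr 1
  rw [← Finset.sum_product']
  have hR : ∀ t ∈ Finset.range (2 * r + 1), congruentChoose ℓ r t * ‖S‖ ^ (2 * r - t) =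
      ∑ jl ∈ Finset.range (r + 1) ×ˢ Finset.range (r + 1) with jl.1 + jl.2 = t,
        if ℓ ∣ jl.1 + (ℓ - 1) * jl.2 then
          ((r.choose jl.1 : ℝ) * r.choose jl.2 * ‖S‖ ^ (2 * r - (jl.1 + jl.2))) else 0 := by
    intro t _
    rw [congruentChoose, Finset.sum_mul, Finset.sum_filter]
    symm
    have h1 : ∑ jl ∈ Finset.range (r + 1) ×ˢ Finset.range (r + 1) with jl.1 + jl.2 = t,
        (if ℓ ∣ jl.1 + (ℓ - 1) * jl.2 then
          ((r.choose jl.1 : ℝ) * r.choose jl.2 * ‖S‖ ^ (2 * r - (jl.1 + jl.2))) else 0) =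
        ∑ jl ∈ Finset.range (r + 1) ×ˢ Finset.range (r + 1) with jl.1 + jl.2 = t,
        (if ℓ ∣ jl.1 + (ℓ - 1) * jl.2 then
          ((r.choose jl.1 : ℝ) * r.choose jl.2 * ‖S‖ ^ (2 * r - t)) else 0) := by
      refine Finset.sum_congr rfl fun jl h => ?_
      rw [(Finset.mem_filter.1 h).2]
    rw [h1]
    refine Finset.sum_subset ?_ ?_
    · intro jl h
      exact Finset.HasAntidiagonal.mem_antidiagonal.2 (Finset.mem_filter.1 h).2
    · intro jl h h'
      rw [Finset.HasAntidiagonal.mem_antidiagonal] at h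
      have : r < jl.1 ∨ r < jl.2 := by
        by_contra hcon
        refine h' (Finset.mem_filter.2 ⟨Finset.mem_product.2 ?_, h⟩)
        simp only [Finset.mem_range]
        omega
      rcases this with h0 | h0
      · simp [Nat.choose_eq_zero_of_lt h0]
      · simp [Nat.choose_eq_zero_of_lt h0]
  rw [Finset.sum_congr rfl hR]
  symm
  refine Finset.sum_fiberwise_of_maps_to ?_ _
  intro jl h
  rw [Finset.mem_product, Finset.mem_range, Finset.mem_range] at h
  rw [Finset.mem_range]
  omega

lemma doubleFactorial_two_mul_sub_one (r : ℕ) :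
    ((2 * r - 1).doubleFactorial : ℝ) * (2 ^ r * r.factorial) = (2 * r).factorial := by
  rcases r with _ | r
  · simp
  · have h1 := Nat.factorial_eq_mul_doubleFactorial (2 * r + 1)
    have h2 := Nat.doubleFactorial_two_mul (r + 1)
    rw [show 2 * (r + 1) - 1 = 2 * r + 1 by omega, show 2 * (r + 1) = 2 * r + 1 + 1 by ring, h1]
    rw [show 2 * (r + 1) = 2 * r + 1 + 1 by ring] at h2
    rw [h2]
    push_cast
    ring

lemma choose_mul_doubleFactorial (r i : ℕ) (hi : i ≤ r) :
    ((2 * r).choose (2 * i) : ℝ) * (2 * i - 1).doubleFactorial *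
      (2 * (r - i) - 1).doubleFactorial = (2 * r - 1).doubleFactorial * r.choose i := by
  have h0 := doubleFactorial_two_mul_sub_one r
  have h1 := doubleFactorial_two_mul_sub_one i
  have h2 := doubleFactorial_two_mul_sub_one (r - i)
  have h3 : ((2 * r).choose (2 * i) : ℝ) * (2 * i).factorial * (2 * (r - i)).factorial =
      (2 * r).factorial := by
    have := Nat.choose_mul_factorial_mul_factorial (show 2 * i ≤ 2 * r by omega)
    rw [show 2 * r - 2 * i = 2 * (r - i) by omega] at this
    exact_mod_cast this
  have h4 : (r.choose i : ℝ) * i.factorial * (r - i).factorial = r.factorial := by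
    exact_mod_cast Nat.choose_mul_factorial_mul_factorial hi
  have h5 : (2 : ℝ) ^ r = 2 ^ i * 2 ^ (r - i) := by rw [← pow_add]; congr 1; omega
  have hpos : (0 : ℝ) < 2 ^ i * 2 ^ (r - i) * i.factorial * (r - i).factorial := by positivity
  refine mul_right_cancel₀ hpos.ne' ?_
  rw [← h1, ← h2, ← h0, h5, ← h4] at h3
  linear_combination h3

lemma sum_norm_sum_root_pow_le {η : ℂ} {ℓ : ℕ} (hη : IsPrimitiveRoot η ℓ) (hℓ : 2 ≤ ℓ) (h : ℕ) :
    ∀ r : ℕ, ∑ ξ : Fin h → Fin ℓ, ‖∑ a, η ^ (ξ a : ℕ)‖ ^ (2 * r) ≤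
      (ℓ : ℝ) ^ h * ((2 * r - 1).doubleFactorial * (h : ℝ) ^ r) := by
  induction h with
  | zero =>
    intro r
    rcases r with _ | r
    · simp
    · simp
  | succ h ih =>
    intro r
    rw [← Equiv.sum_comp (Fin.consEquiv fun _ : Fin (h + 1) => Fin ℓ), Fintype.sum_prod_type,
      Finset.sum_comm]
    have h1 : ∀ ξ : Fin h → Fin ℓ, ∑ k : Fin ℓ,
        ‖∑ a, η ^ (((Fin.consEquiv fun _ : Fin (h + 1) => Fin ℓ) (k, ξ)) a : ℕ)‖ ^ (2 * r) ≤
        ℓ * ∑ i ∈ Finset.range (r + 1), (2 * r).choose (2 * i) *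
          ((2 * i - 1).doubleFactorial : ℝ) * ‖∑ a, η ^ (ξ a : ℕ)‖ ^ (2 * (r - i)) := by
      intro ξ
      refine le_trans (le_of_eq ?_) (sum_norm_add_root_pow_le hη hℓ r (∑ a, η ^ (ξ a : ℕ)))
      refine Finset.sum_congr rfl fun k _ => ?_
      rw [Fin.sum_univ_succ]
      rfl
    refine (Finset.sum_le_sum fun ξ _ => h1 ξ).trans ?_
    rw [← Finset.mul_sum, Finset.sum_comm, pow_succ, mul_comm (_ ^ h) (ℓ : ℝ), mul_assoc]
    refine mul_le_mul_of_nonneg_left ?_ (by positivity)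
    have h2 : ∀ i ∈ Finset.range (r + 1), ∑ ξ : Fin h → Fin ℓ, ((2 * r).choose (2 * i) : ℝ) *
        ((2 * i - 1).doubleFactorial : ℝ) * ‖∑ a, η ^ (ξ a : ℕ)‖ ^ (2 * (r - i)) ≤
        (ℓ : ℝ) ^ h * ((2 * r - 1).doubleFactorial * ((1 : ℝ) ^ i * (h : ℝ) ^ (r - i) *
          r.choose i)) := by
      intro i hi
      rw [Finset.mem_range] at hi
      rw [← Finset.mul_sum]
      refine (mul_le_mul_of_nonneg_left (ih (r - i)) (by positivity)).trans (le_of_eq ?_)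
      have := choose_mul_doubleFactorial r i (by omega)
      linear_combination (ℓ : ℝ) ^ h * (h : ℝ) ^ (r - i) * this
    refine (Finset.sum_le_sum h2).trans (le_of_eq ?_)
    rw [← Finset.mul_sum, ← Finset.mul_sum, ← add_pow]
    push_cast
    rw [add_comm (1 : ℝ)]

/-- The exponent with which the point `b` occurs in the expansion of `|∑ f|^{2r}` at the tuple `t`,
for a function `f` whose conjugate is `f ^ (ℓ - 1)`. -/
def tupleExponent {α : Type*} [DecidableEq α] (ℓ : ℕ) {r : ℕ} (t : Fin r ⊕ Fin r → α) (b : α) : ℕ :=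
  ∑ i with t i = b, Sum.elim (fun _ => 1) (fun _ => ℓ - 1) i

lemma norm_sum_pow_eq {ι : Type*} [Fintype ι] (ℓ r : ℕ) (f : ι → ℂ)
    (hf : ∀ a, (starRingEnd ℂ) (f a) = f a ^ (ℓ - 1)) :
    ((‖∑ a, f a‖ ^ (2 * r) : ℝ) : ℂ) = ∑ t : Fin r ⊕ Fin r → ι,
      ∏ i, f (t i) ^ (Sum.elim (fun _ => 1) (fun _ => ℓ - 1) i : ℕ) := by
  classical
  have h1 : ((‖∑ a, f a‖ ^ (2 * r) : ℝ) : ℂ) =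
      (∑ a, f a) ^ r * (∑ a, f a ^ (ℓ - 1)) ^ r := by
    rw [← Finset.sum_congr rfl fun a _ => hf a, ← map_sum, ← mul_pow, Complex.mul_conj, pow_mul,
      Complex.normSq_eq_norm_sq]
    push_cast
    rfl
  have h2 : ∏ i : Fin r ⊕ Fin r, ∑ a, f a ^ (Sum.elim (fun _ => 1) (fun _ => ℓ - 1) i : ℕ) =
      (∑ a, f a) ^ r * (∑ a, f a ^ (ℓ - 1)) ^ r := by
    rw [Fintype.prod_sum_type]
    simp
  rw [h1, ← h2, Finset.prod_univ_sum, Fintype.piFinset_univ]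

lemma prod_pow_tupleExponent {α : Type*} [DecidableEq α] (ℓ : ℕ) {r : ℕ}
    (t : Fin r ⊕ Fin r → α) (f : α → ℂ) (A : Finset α) (hA : ∀ i, t i ∈ A) :
    ∏ i, f (t i) ^ (Sum.elim (fun _ => 1) (fun _ => ℓ - 1) i : ℕ) =
      ∏ b ∈ A, f b ^ tupleExponent ℓ t b := by
  rw [← Finset.prod_fiberwise_of_maps_to (s := Finset.univ) (t := A) (g := t) (fun i _ => hA i)]
  refine Finset.prod_congr rfl fun b _ => ?_
  rw [tupleExponent, ← Finset.prod_pow_eq_pow_sum]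
  refine Finset.prod_congr rfl fun i hi => ?_
  rw [(Finset.mem_filter.1 hi).2]

open Classical in
/-- The number of tuples all of whose exponents are divisible by `ℓ`. -/
lemma card_tupleExponent_dvd_le (ℓ : ℕ) (hℓ : 2 ≤ ℓ) (h r : ℕ) :
    ((Finset.univ.filter fun t : Fin r ⊕ Fin r → Fin h => ∀ b, ℓ ∣ tupleExponent ℓ t b).card : ℝ) ≤
      (2 * r - 1).doubleFactorial * (h : ℝ) ^ r := by
  have hℓ0 : 0 < ℓ := by omega
  set η : ℂ := Complex.exp (2 * π * Complex.I / ℓ)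
  have hη : IsPrimitiveRoot η ℓ := Complex.isPrimitiveRoot_exp ℓ hℓ0.ne'
  have key : ((∑ ξ : Fin h → Fin ℓ, ‖∑ a, η ^ (ξ a : ℕ)‖ ^ (2 * r) : ℝ) : ℂ) =
      (ℓ : ℂ) ^ h * (Finset.univ.filter fun t : Fin r ⊕ Fin r → Fin h =>
        ∀ b, ℓ ∣ tupleExponent ℓ t b).card := by
    rw [Complex.ofReal_sum]
    have h1 : ∀ ξ : Fin h → Fin ℓ, ((‖∑ a, η ^ (ξ a : ℕ)‖ ^ (2 * r) : ℝ) : ℂ) =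
        ∑ t : Fin r ⊕ Fin r → Fin h, ∏ b, (η ^ (ξ b : ℕ)) ^ tupleExponent ℓ t b := by
      intro ξ
      rw [norm_sum_pow_eq ℓ r (fun a => η ^ (ξ a : ℕ)) (fun a => hη.conj_pow_eq hℓ0 _)]
      refine Finset.sum_congr rfl fun t _ => ?_
      exact prod_pow_tupleExponent ℓ t (fun a => η ^ (ξ a : ℕ))
          Finset.univ fun i => Finset.mem_univ _
    rw [Finset.sum_congr rfl fun ξ _ => h1 ξ, Finset.sum_comm]
    have h2 : ∀ t : Fin r ⊕ Fin r → Fin h,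
        ∑ ξ : Fin h → Fin ℓ, ∏ b, (η ^ (ξ b : ℕ)) ^ tupleExponent ℓ t b =
        if ∀ b, ℓ ∣ tupleExponent ℓ t b then (ℓ : ℂ) ^ h else 0 := by
      intro t
      have h3 := Finset.prod_univ_sum (fun _ : Fin h => (Finset.univ : Finset (Fin ℓ)))
        (fun b k => (η ^ (k : ℕ)) ^ tupleExponent ℓ t b)
      rw [Fintype.piFinset_univ] at h3
      rw [← h3]
      simp_rw [hη.sum_pow_mul]
      split_ifs with hd
      · simp [hd]
      · push Not at hd
        obtain ⟨b, hb⟩ := hd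
        exact Finset.prod_eq_zero (Finset.mem_univ b) (by simp [hb])
    rw [Finset.sum_congr rfl fun t _ => h2 t, ← Finset.sum_filter, Finset.sum_const, nsmul_eq_mul,
      mul_comm]
  have hbound := sum_norm_sum_root_pow_le hη hℓ h r
  have key' : (∑ ξ : Fin h → Fin ℓ, ‖∑ a, η ^ (ξ a : ℕ)‖ ^ (2 * r) : ℝ) =
      (ℓ : ℝ) ^ h * (Finset.univ.filter fun t : Fin r ⊕ Fin r → Fin h =>
        ∀ b, ℓ ∣ tupleExponent ℓ t b).card := by exact_mod_cast key
  rw [key'] at hbound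
  exact le_of_mul_le_mul_left hbound (by positivity)

/-- The `2r`-th moment of the shifted sums of a character of prime order. -/
theorem moment_bound (p : ℕ) [Fact p.Prime] (ℓ : ℕ) (hℓ : ℓ.Prime)
    (χ : MulChar (ZMod p) ℂ) (hχ : χ ≠ 1) (hχℓ : χ ^ ℓ = 1) (h r : ℕ) (hr : 0 < r)
    (d : Fin h → ZMod p) (hd : Function.Injective d) :
    ∑ x : ZMod p, ‖∑ a, χ (x + d a)‖ ^ (2 * r) ≤
      (2 * r - 1).doubleFactorial * (h : ℝ) ^ r * p + (2 * r - 1) * √p * (h : ℝ) ^ (2 * r) := by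
  classical
  have hp : 0 < p := (Fact.out : p.Prime).pos
  have hnorm : ∀ y : ZMod p, ‖χ y‖ ≤ 1 := by
    intro y
    by_cases hy : IsUnit y
    · have h1 : χ y ^ ℓ = 1 := by
        rw [← MulChar.pow_apply' _ hℓ.ne_zero, hχℓ, MulChar.one_apply hy]
      exact (Complex.norm_eq_one_of_pow_eq_one h1 hℓ.ne_zero).le
    · rw [χ.map_nonunit hy]; simp
  have hconj : ∀ y : ZMod p, (starRingEnd ℂ) (χ y) = χ y ^ (ℓ - 1) := by
    intro y
    by_cases hy : IsUnit y
    · have h1 : χ y ^ ℓ = 1 := by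
        rw [← MulChar.pow_apply' _ hℓ.ne_zero, hχℓ, MulChar.one_apply hy]
      have h2 := Complex.norm_eq_one_of_pow_eq_one h1 hℓ.ne_zero
      rw [← Complex.inv_eq_conj h2]
      refine inv_eq_of_mul_eq_one_right ?_
      rw [← pow_succ', Nat.sub_add_cancel hℓ.pos, h1]
    · rw [χ.map_nonunit hy, map_zero, zero_pow]
      have := hℓ.two_le
      omega
  set T : (Fin r ⊕ Fin r → Fin h) → ℂ := fun t => ∑ x : ZMod p,
    ∏ i, χ (x + d (t i)) ^ (Sum.elim (fun _ => 1) (fun _ => ℓ - 1) i : ℕ) with hT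
  have hexp : ((∑ x : ZMod p, ‖∑ a, χ (x + d a)‖ ^ (2 * r) : ℝ) : ℂ) = ∑ t, T t := by
    rw [Complex.ofReal_sum, hT, Finset.sum_comm]
    refine Finset.sum_congr rfl fun x _ => ?_
    exact norm_sum_pow_eq ℓ r (fun a => χ (x + d a)) fun a => hconj _
  have htriv : ∀ t, ‖T t‖ ≤ p := by
    intro t
    refine (norm_sum_le _ _).trans ?_
    refine (Finset.sum_le_card_nsmul _ _ 1 fun x _ => ?_).trans ?_
    · rw [norm_prod]
      refine Finset.prod_le_one (fun _ _ => norm_nonneg _) fun i _ => ?_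
      rw [norm_pow]
      exact pow_le_one₀ (norm_nonneg _) (hnorm _)
    · rw [Finset.card_univ, ZMod.card]; simp
  have hweil : ∀ t, (¬ ∀ b, ℓ ∣ tupleExponent ℓ t b) → ‖T t‖ ≤ (2 * r - 1) * √p := by
    intro t ht
    push Not at ht
    obtain ⟨b, hb⟩ := ht
    have hexq : tupleExponent ℓ (d ∘ t) (d b) = tupleExponent ℓ t b := by
      rw [tupleExponent, tupleExponent]
      refine Finset.sum_congr ?_ fun _ _ => rfl
      ext i
      simp [hd.eq_iff]
    have hbm : d b ∈ Finset.univ.image (d ∘ t) := by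
      by_contra hcon
      refine hb ?_
      rw [tupleExponent, Finset.sum_eq_zero]
      · exact dvd_zero _
      · intro i hi
        exact absurd (Finset.mem_image.2 ⟨i, Finset.mem_univ _, by
          simp [(Finset.mem_filter.1 hi).2]⟩) hcon
    have hw := weil_bound p ℓ hℓ χ hχ hχℓ (Finset.univ.image (d ∘ t)) (tupleExponent ℓ (d ∘ t))
      (d b) hbm (by rwa [hexq])
    have hTt : T t = ∑ x : ZMod p, ∏ a ∈ Finset.univ.image (d ∘ t),
        χ (x + a) ^ tupleExponent ℓ (d ∘ t) a := by
      rw [hT]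
      refine Finset.sum_congr rfl fun x _ => ?_
      exact prod_pow_tupleExponent ℓ (d ∘ t) (fun a => χ (x + a)) _
        fun i => Finset.mem_image_of_mem _ (Finset.mem_univ i)
    rw [hTt]
    refine hw.trans (mul_le_mul_of_nonneg_right ?_ (Real.sqrt_nonneg _))
    have hc : (Finset.univ.image (d ∘ t)).card ≤ 2 * r := by
      refine Finset.card_image_le.trans ?_
      simp
      omega
    have : ((Finset.univ.image (d ∘ t)).card : ℝ) ≤ 2 * r := by exact_mod_cast hc
    linarith
  have hr1 : (1 : ℝ) ≤ r := by exact_mod_cast hr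
  have hle : ∀ t, ‖T t‖ ≤ (if ∀ b, ℓ ∣ tupleExponent ℓ t b then (p : ℝ) else 0) +
      (2 * r - 1) * √p := by
    intro t
    have h0 : 0 ≤ (2 * (r : ℝ) - 1) * √p := mul_nonneg (by linarith) (Real.sqrt_nonneg _)
    split_ifs with hv
    · linarith [htriv t]
    · linarith [hweil t hv]
  have hnonneg : 0 ≤ ∑ x : ZMod p, ‖∑ a, χ (x + d a)‖ ^ (2 * r) :=
    Finset.sum_nonneg fun _ _ => by positivity
  rw [← abs_of_nonneg hnonneg, ← Real.norm_eq_abs, ← Complex.norm_real, hexp]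
  refine (norm_sum_le _ _).trans ((Finset.sum_le_sum fun t _ => hle t).trans ?_)
  rw [Finset.sum_add_distrib, ← Finset.sum_filter, Finset.sum_const, Finset.sum_const,
    nsmul_eq_mul, nsmul_eq_mul]
  have hcard : ((Finset.univ : Finset (Fin r ⊕ Fin r → Fin h)).card : ℝ) = (h : ℝ) ^ (2 * r) := by
    rw [Finset.card_univ, Fintype.card_fun]
    simp
    ring
  rw [hcard]
  have := card_tupleExponent_dvd_le ℓ hℓ.two_le h r
  have h1 := mul_le_mul_of_nonneg_right this (by positivity : (0:ℝ) ≤ p)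
  linarith

open ArithmeticFunction in
lemma sum_moebius_mul_eq_totient (q : ℕ) (hq : 0 < q) :
    ∑ x ∈ q.divisorsAntidiagonal, (moebius x.1 : ℝ) * x.2 = q.totient := by
  have h := (sum_eq_iff_sum_mul_moebius_eq (R := ℝ) (f := fun n => (n.totient : ℝ))
    (g := fun n => (n : ℝ))).1 (fun n _ => by exact_mod_cast Nat.sum_totient n) q hq
  exact h

open ArithmeticFunction in
lemma sum_totient_mul_eq (X : ℝ) (N : ℕ) :
    ∑ q ∈ Finset.Ioc 0 N, (q.totient : ℝ) * (2 * X / q - 1) =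
      ∑ d ∈ Finset.Ioc 0 N, (moebius d : ℝ) *
        (2 * X / d * (N / d : ℕ) - ((N / d : ℕ) : ℝ) * ((N / d : ℕ) + 1) / 2) := by
  let f : ArithmeticFunction ℝ := ⟨fun d => (moebius d : ℝ) / d, by simp⟩
  let g : ArithmeticFunction ℝ := ⟨fun d => (moebius d : ℝ), by simp⟩
  let i : ArithmeticFunction ℝ := ⟨fun d => (d : ℝ), by simp⟩
  let o : ArithmeticFunction ℝ := ⟨fun d => if d = 0 then 0 else 1, by simp⟩
  have h1 : ∀ q ∈ Finset.Ioc 0 N, (q.totient : ℝ) * (2 * X / q - 1) =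
      2 * X * (f * o) q - (g * i) q := by
    intro q hq
    have hq0 : 0 < q := (Finset.mem_Ioc.1 hq).1
    have e2 : (g * i) q = q.totient := by
      rw [mul_apply, ← sum_moebius_mul_eq_totient q hq0]
      rfl
    have e1 : (f * o) q = q.totient / q := by
      rw [mul_apply, ← sum_moebius_mul_eq_totient q hq0, Finset.sum_div]
      refine Finset.sum_congr rfl fun x hx => ?_
      rw [Nat.mem_divisorsAntidiagonal] at hx
      have hx1 : x.1 ≠ 0 := fun h => by rw [h] at hx; simp at hx; omega
      have hx2 : x.2 ≠ 0 := fun h => by rw [h] at hx; simp at hx; omega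
      have hq' : (q : ℝ) = x.1 * x.2 := by exact_mod_cast hx.1.symm
      have a1 : (x.1 : ℝ) ≠ 0 := by exact_mod_cast hx1
      have a2 : (x.2 : ℝ) ≠ 0 := by exact_mod_cast hx2
      simp only [f, o, coe_mk, if_neg hx2, hq']
      field_simp
    rw [e1, e2]
    ring
  have hi : ∀ M : ℕ, ∑ m ∈ Finset.Ioc 0 M, (i m : ℝ) = (M : ℝ) * (M + 1) / 2 := by
    intro M
    induction M with
    | zero => simp
    | succ M ih =>
      rw [Finset.sum_Ioc_succ_top (by omega), ih]
      simp only [i, coe_mk]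
      push_cast
      ring
  have ho : ∀ M : ℕ, ∑ m ∈ Finset.Ioc 0 M, (o m : ℝ) = M := by
    intro M
    rw [Finset.sum_congr rfl (g := fun _ => (1 : ℝ))]
    · simp
    · intro m hm
      have : m ≠ 0 := (Finset.mem_Ioc.1 hm).1.ne'
      simp [o, this]
  rw [Finset.sum_congr rfl h1, Finset.sum_sub_distrib, ← Finset.mul_sum, sum_Ioc_mul_eq_sum_sum,
    sum_Ioc_mul_eq_sum_sum, Finset.mul_sum, ← Finset.sum_sub_distrib]
  refine Finset.sum_congr rfl fun d _ => ?_
  rw [hi, ho]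
  simp only [f, g, coe_mk]
  ring

open ArithmeticFunction in
lemma sum_moebius_div_le (N : ℕ) (hN : 3 ≤ N) :
    ∑ d ∈ Finset.Ioc 0 N, (moebius d : ℝ) / d ≤ 3 / 4 - 5 / (4 * N) := by
  have hN0 : (0 : ℝ) < N := by exact_mod_cast (by omega : 0 < N)
  have h1 : ∑ d ∈ Finset.Ioc 0 N, (moebius d : ℝ) * (N / d : ℕ) = 1 := by
    have h := sum_Ioc_mul_zeta_eq_sum (R := ℤ) moebius N
    have hz : (moebius * (zeta : ArithmeticFunction ℤ)) = 1 := moebius_mul_coe_zeta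
    rw [hz, Finset.sum_eq_single 1] at h
    · rw [one_one] at h
      have h' := congrArg (Int.cast : ℤ → ℝ) h
      simp only [Int.cast_sum, Int.cast_mul, Int.cast_natCast, Int.cast_one] at h'
      exact h'.symm
    · intro b _ hb
      exact one_apply_ne hb
    · intro hcon
      exact absurd (Finset.mem_Ioc.2 ⟨by norm_num, by omega⟩) hcon
  have h2 : ∀ d ∈ Finset.Ioc 0 N, (moebius d : ℝ) * ((N : ℝ) / d - (N / d : ℕ)) ≤
      1 - (if d ≤ 3 then (1 : ℝ) else 0) - (if 4 ∣ d then (1 : ℝ) else 0) := by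
    intro d hd
    rw [Finset.mem_Ioc] at hd
    have hd0 : (0 : ℝ) < d := by exact_mod_cast hd.1
    have hfr0 : 0 ≤ (N : ℝ) / d - (N / d : ℕ) := by
      have := Nat.cast_div_le (α := ℝ) (m := N) (n := d)
      linarith
    have hfr1 : (N : ℝ) / d - (N / d : ℕ) ≤ 1 := by
      have h := Nat.lt_div_mul_add (a := N) hd.1
      have h' : (N : ℝ) < (N / d : ℕ) * d + d := by exact_mod_cast h
      rw [sub_le_iff_le_add, div_le_iff₀ hd0]
      nlinarith
    by_cases h4 : 4 ∣ d
    · have hd3 : ¬ d ≤ 3 := fun h => by have := Nat.le_of_dvd hd.1 h4; omega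
      have hm : moebius d = 0 := by
        refine moebius_eq_zero_of_not_squarefree fun hsq => ?_
        have := hsq 2 (by simpa using h4)
        simp at this
      simp [hm, h4, hd3]
    · by_cases hd3 : d ≤ 3
      · rw [if_pos hd3, if_neg h4]
        have hneg : (moebius d : ℝ) * ((N : ℝ) / d - (N / d : ℕ)) ≤ 0 := by
          have : d = 1 ∨ d = 2 ∨ d = 3 := by omega
          rcases this with rfl | rfl | rfl
          · simp
          · rw [moebius_apply_prime Nat.prime_two]
            push_cast
            push_cast at hfr0
            linarith
          · rw [moebius_apply_prime Nat.prime_three]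
            push_cast
            push_cast at hfr0
            linarith
        linarith
      · rw [if_neg hd3, if_neg h4]
        have hm : (moebius d : ℝ) ≤ 1 := by
          have := (abs_le.1 (abs_moebius_le_one (n := d))).2
          exact_mod_cast this
        nlinarith
  have h3 := Finset.sum_le_sum h2
  have e1 : ∑ d ∈ Finset.Ioc 0 N, (if d ≤ 3 then (1 : ℝ) else 0) = 3 := by
    rw [← Finset.sum_filter]
    have : (Finset.Ioc 0 N).filter (fun d => d ≤ 3) = Finset.Ioc 0 3 := by
      ext d
      simp only [Finset.mem_filter, Finset.mem_Ioc]
      omega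
    rw [this]
    simp
  have e2 : ∑ d ∈ Finset.Ioc 0 N, (if 4 ∣ d then (1 : ℝ) else 0) = (N / 4 : ℕ) := by
    rw [← Finset.sum_filter, Finset.sum_const, Nat.Ioc_filter_dvd_card_eq_div]
    simp
  rw [Finset.sum_sub_distrib, Finset.sum_sub_distrib, e1, e2] at h3
  have e3 : ∑ d ∈ Finset.Ioc 0 N, (moebius d : ℝ) * ((N : ℝ) / d - (N / d : ℕ)) =
      N * (∑ d ∈ Finset.Ioc 0 N, (moebius d : ℝ) / d) - 1 := by
    rw [← h1, Finset.mul_sum, ← Finset.sum_sub_distrib]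
    refine Finset.sum_congr rfl fun d _ => ?_
    ring
  rw [e3] at h3
  simp only [Finset.sum_const, Nat.card_Ioc, Nat.sub_zero, nsmul_eq_mul, mul_one] at h3
  have h4 : (N : ℝ) ≤ 4 * (N / 4 : ℕ) + 3 := by
    have : N ≤ 4 * (N / 4) + 3 := by omega
    exact_mod_cast this
  have h5 : N * (∑ d ∈ Finset.Ioc 0 N, (moebius d : ℝ) / d) ≤ N * (3 / 4 - 5 / (4 * N)) := by
    have : (N : ℝ) * (3 / 4 - 5 / (4 * N)) = 3 / 4 * N - 5 / 4 := by field_simp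
    rw [this]
    linarith
  exact le_of_mul_le_mul_left h5 hN0

lemma sum_filter_dvd_inv (N k : ℕ) (hk : 0 < k) :
    ∑ d ∈ Finset.Ioc 0 N, (if k ∣ d then (1 : ℝ) / d else 0) = (harmonic (N / k) : ℝ) / k := by
  rw [← Finset.sum_filter, harmonic_eq_sum_Icc]
  push_cast
  rw [Finset.sum_div]
  symm
  refine Finset.sum_bij (fun m _ => k * m) ?_ ?_ ?_ ?_
  · intro m hm
    rw [Finset.mem_Icc] at hm
    rw [Finset.mem_filter, Finset.mem_Ioc]
    refine ⟨⟨Nat.mul_pos hk hm.1, ?_⟩, dvd_mul_right _ _⟩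
    calc k * m ≤ k * (N / k) := Nat.mul_le_mul_left _ hm.2
      _ ≤ N := Nat.mul_div_le N k
  · intro a _ b _ h
    exact Nat.eq_of_mul_eq_mul_left hk h
  · intro d hd
    rw [Finset.mem_filter, Finset.mem_Ioc] at hd
    obtain ⟨⟨h1, h2⟩, m, rfl⟩ := hd
    refine ⟨m, Finset.mem_Icc.2 ⟨Nat.pos_of_mul_pos_left h1, ?_⟩, rfl⟩
    rw [Nat.le_div_iff_mul_le hk, mul_comm]
    exact h2
  · intro m _
    push_cast
    rw [one_div, mul_inv, div_eq_mul_inv, mul_comm]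

open ArithmeticFunction in
lemma sum_abs_moebius_div_le (N : ℕ) :
    ∑ d ∈ Finset.Ioc 0 N, |(moebius d : ℝ)| / d ≤
      harmonic N - (harmonic (N / 4) : ℝ) / 4 - (harmonic (N / 9) : ℝ) / 9 +
        (harmonic (N / 36) : ℝ) / 36 := by
  have h := sum_filter_dvd_inv N
  have h1 := h 1 (by norm_num)
  have h4 := h 4 (by norm_num)
  have h9 := h 9 (by norm_num)
  have h36 := h 36 (by norm_num)
  push_cast at h1 h4 h9 h36
  rw [Nat.div_one, div_one] at h1
  rw [← h1, ← h4, ← h9, ← h36, ← Finset.sum_sub_distrib, ← Finset.sum_sub_distrib,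
    ← Finset.sum_add_distrib]
  refine Finset.sum_le_sum fun d hd => ?_
  have hd0 : (0 : ℝ) < d := by exact_mod_cast (Finset.mem_Ioc.1 hd).1
  have hinv : (0 : ℝ) < 1 / d := by positivity
  have h36 : 36 ∣ d ↔ 4 ∣ d ∧ 9 ∣ d := by omega
  have hm4 : 4 ∣ d → moebius d = 0 := fun h4 =>
    moebius_eq_zero_of_not_squarefree fun hsq => by
      have := hsq 2 (by simpa using h4)
      simp at this
  have hm9 : 9 ∣ d → moebius d = 0 := fun h9 =>
    moebius_eq_zero_of_not_squarefree fun hsq => by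
      have := hsq 3 (by simpa using h9)
      simp at this
  have hle : |(moebius d : ℝ)| / d ≤ 1 / d := by
    refine div_le_div_of_nonneg_right ?_ hd0.le
    exact_mod_cast abs_moebius_le_one (n := d)
  by_cases h4 : 4 ∣ d <;> by_cases h9 : 9 ∣ d
  · simp [h4, h9, h36, hm4 h4]
  · simp [h4, h9, h36, hm4 h4]
  · simp [h4, h9, h36, hm9 h9]
  · simp only [h36, h4, h9, one_dvd, if_true, if_false, and_self]
    linarith

open ArithmeticFunction in
lemma le_sum_moebius_div_sq (N : ℕ) :
    6 / π ^ 2 - 1 / (N + 1 / 2) ≤ ∑ d ∈ Finset.Ioc 0 N, (moebius d : ℝ) / (d : ℝ) ^ 2 := by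
  have hs : LSeriesSummable (fun n => ((moebius n : ℤ) : ℂ)) 2 :=
    LSeriesSummable_moebius_iff.2 (by norm_num)
  have hL : LSeries (fun n => ((moebius n : ℤ) : ℂ)) 2 = (((6 : ℝ) / π ^ 2 : ℝ) : ℂ) := by
    have h := LSeries_zeta_mul_Lseries_moebius (s := 2) (by norm_num)
    rw [LSeries_zeta_eq_riemannZeta (by norm_num), riemannZeta_two] at h
    have hpi : (π : ℂ) ≠ 0 := by exact_mod_cast Real.pi_ne_zero
    push_cast
    field_simp
    field_simp at h
    linear_combination h
  have hsum : HasSum (fun n : ℕ => (moebius n : ℝ) / (n : ℝ) ^ 2) (6 / π ^ 2) := by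
    have h := hs.LSeriesHasSum
    rw [LSeriesHasSum, hL] at h
    rw [← Complex.hasSum_ofReal]
    convert h using 2 with n
    rcases Nat.eq_zero_or_pos n with rfl | hn
    · simp
    · rw [LSeries.term_of_ne_zero hn.ne']
      push_cast
      congr 1
      exact_mod_cast (Complex.cpow_natCast (n : ℂ) 2).symm
  have htend := hsum.tendsto_sum_nat
  have hmono : ∀ M, N ≤ M → ∑ d ∈ Finset.range (M + 1), (moebius d : ℝ) / (d : ℝ) ^ 2 ≤
      ∑ d ∈ Finset.range (N + 1), (moebius d : ℝ) / (d : ℝ) ^ 2 +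
        (1 / (N + 1 / 2) - 1 / (M + 1 / 2)) := by
    intro M hM
    induction M, hM using Nat.le_induction with
    | base => simp
    | succ M hM ih =>
      rw [Finset.sum_range_succ]
      have hstep : (moebius (M + 1) : ℝ) / ((M + 1 : ℕ) : ℝ) ^ 2 ≤
          1 / (M + 1 / 2) - 1 / ((M + 1 : ℕ) + 1 / 2) := by
        have hm : (moebius (M + 1) : ℝ) ≤ 1 := by
          have := (abs_le.1 (abs_moebius_le_one (n := M + 1))).2
          exact_mod_cast this
        push_cast
        have hM0 : (0 : ℝ) ≤ M := by positivity
        rw [div_sub_div _ _ (by positivity) (by positivity)]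
        refine (div_le_div_of_nonneg_right hm (by positivity)).trans ?_
        rw [div_le_div_iff₀ (by positivity) (by positivity)]
        nlinarith
      linarith
  have hN : ∑ d ∈ Finset.range (N + 1), (moebius d : ℝ) / (d : ℝ) ^ 2 =
      ∑ d ∈ Finset.Ioc 0 N, (moebius d : ℝ) / (d : ℝ) ^ 2 := by
    rw [Finset.sum_range_eq_add_Ico _ (by omega)]
    simp
    rfl
  rw [← hN, sub_le_iff_le_add]
  refine le_of_tendsto ((Filter.tendsto_add_atTop_iff_nat 1).2 htend) ?_
  filter_upwards [Filter.eventually_ge_atTop N] with M hM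
  have := hmono M hM
  have h0 : (0 : ℝ) ≤ 1 / (M + 1 / 2) := by positivity
  linarith

lemma abs_floor_sum_sub_le (Y : ℝ) (hY : 1 ≤ Y) :
    |(2 * Y * ⌊Y⌋₊ - (⌊Y⌋₊ : ℝ) * (⌊Y⌋₊ + 1) / 2) - (3 / 2 * Y ^ 2 - Y)| ≤ Y / 2 := by
  have h1 : (⌊Y⌋₊ : ℝ) ≤ Y := Nat.floor_le (by linarith)
  have h2 : Y < ⌊Y⌋₊ + 1 := Nat.lt_floor_add_one Y
  have h3 : (1 : ℝ) ≤ ⌊Y⌋₊ := by exact_mod_cast (Nat.one_le_floor_iff Y).2 hY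
  set M : ℝ := (⌊Y⌋₊ : ℝ)
  rw [abs_le]
  constructor <;> nlinarith

open ArithmeticFunction in
lemma sum_abs_moebius_div_le_log (X a : ℝ) (hX : 1 ≤ X)
    (ha : (harmonic ⌊X⌋₊ : ℝ) ≤ a + Real.log X) :
    ∑ d ∈ Finset.Ioc 0 ⌊X⌋₊, |(moebius d : ℝ)| / d ≤ 2 / 3 * Real.log X + a + 0.5917 := by
  have h := sum_abs_moebius_div_le ⌊X⌋₊
  have h4 : Real.log X - Real.log 4 ≤ harmonic (⌊X⌋₊ / 4) := by
    have := log_le_harmonic_floor (X / 4) (by positivity)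
    rw [Real.log_div (by positivity) (by norm_num)] at this
    have e : ⌊X / 4⌋₊ = ⌊X⌋₊ / 4 := by exact_mod_cast Nat.floor_div_natCast X 4
    rwa [e] at this
  have h9 : Real.log X - Real.log 9 ≤ harmonic (⌊X⌋₊ / 9) := by
    have := log_le_harmonic_floor (X / 9) (by positivity)
    rw [Real.log_div (by positivity) (by norm_num)] at this
    have e : ⌊X / 9⌋₊ = ⌊X⌋₊ / 9 := by exact_mod_cast Nat.floor_div_natCast X 9
    rwa [e] at this
  have hl2 := Real.log_two_lt_d9
  have h36 : (harmonic (⌊X⌋₊ / 36) : ℝ) ≤ Real.log X := by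
    have e : ⌊X / 36⌋₊ = ⌊X⌋₊ / 36 := by exact_mod_cast Nat.floor_div_natCast X 36
    rw [← e]
    rcases le_or_gt 36 X with h36 | h36
    · have := harmonic_floor_le_one_add_log (X / 36) (by rw [le_div_iff₀] <;> linarith)
      rw [Real.log_div (by positivity) (by norm_num)] at this
      have : 1 ≤ Real.log 36 := by
        rw [Real.le_log_iff_exp_le (by norm_num)]
        linarith [Real.exp_one_lt_d9]
      linarith
    · have : ⌊X / 36⌋₊ = 0 := by
        rw [Nat.floor_eq_zero, div_lt_one (by norm_num)]
        exact h36
      rw [this]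
      simpa using Real.log_nonneg hX
  have l4 : Real.log 4 = 2 * Real.log 2 := by
    rw [show (4 : ℝ) = 2 ^ 2 by norm_num, Real.log_pow]; norm_num
  have l9 : Real.log 9 ≤ 3 * Real.log 2 + 1 / 8 := by
    have e : (9 : ℝ) = 2 ^ 3 * (9 / 8) := by norm_num
    rw [e, Real.log_mul (by norm_num) (by norm_num), Real.log_pow]
    have := Real.log_le_sub_one_of_pos (show (0 : ℝ) < 9 / 8 by norm_num)
    push_cast
    linarith
  linarith

open ArithmeticFunction in
/-- A lower bound for the weighted totient sum counting Farey arcs. -/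
theorem le_sum_totient (X : ℝ) (hX : 3.8 ≤ X) :
    9 / π ^ 2 * X ^ 2 - X * (Real.log X + 9) / 3 ≤
      ∑ q ∈ Finset.Ioc 0 ⌊X⌋₊, (q.totient : ℝ) * (2 * X / q - 1) := by
  have hX0 : 0 < X := by linarith
  rw [sum_totient_mul_eq]
  set N := ⌊X⌋₊ with hN
  have hN3 : 3 ≤ N := Nat.le_floor (by norm_num; linarith)
  have hXN : X < N + 1 := Nat.lt_floor_add_one X
  have hNX : (N : ℝ) ≤ X := Nat.floor_le hX0.le
  have hN3' : (3 : ℝ) ≤ N := by exact_mod_cast hN3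
  have hterm : ∀ d ∈ Finset.Ioc 0 N, 3 / 2 * X ^ 2 * ((moebius d : ℝ) / (d : ℝ) ^ 2) -
      X * ((moebius d : ℝ) / d) - X / 2 * (|(moebius d : ℝ)| / d) ≤
      (moebius d : ℝ) * (2 * X / d * (N / d : ℕ) - ((N / d : ℕ) : ℝ) * ((N / d : ℕ) + 1) / 2) := by
    intro d hd
    rw [Finset.mem_Ioc] at hd
    have hd0 : (0 : ℝ) < d := by exact_mod_cast hd.1
    have hY : 1 ≤ X / d := by
      rw [le_div_iff₀ hd0, one_mul]
      exact le_trans (by exact_mod_cast hd.2) hNX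
    have h := abs_floor_sum_sub_le (X / d) hY
    rw [Nat.floor_div_natCast] at h
    rw [← hN] at h
    set F := (2 * (X / d) * (N / d : ℕ) - ((N / d : ℕ) : ℝ) * ((N / d : ℕ) + 1) / 2) with hF
    have h1 : (moebius d : ℝ) * (3 / 2 * (X / d) ^ 2 - X / d) - (moebius d : ℝ) * F ≤
        |(moebius d : ℝ)| * (X / d / 2) := by
      rw [← mul_sub]
      refine (le_abs_self _).trans ?_
      rw [abs_mul, abs_sub_comm]
      exact mul_le_mul_of_nonneg_left h (abs_nonneg _)
    have h2 : (moebius d : ℝ) *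
        (2 * X / d * (N / d : ℕ) - ((N / d : ℕ) : ℝ) * ((N / d : ℕ) + 1) / 2) =
        (moebius d : ℝ) * F := by rw [hF]; ring
    rw [h2]
    have h3 : 3 / 2 * X ^ 2 * ((moebius d : ℝ) / (d : ℝ) ^ 2) -
      X * ((moebius d : ℝ) / d) - X / 2 * (|(moebius d : ℝ)| / d) =
      (moebius d : ℝ) * (3 / 2 * (X / d) ^ 2 - X / d) - |(moebius d : ℝ)| * (X / d / 2) := by
      field_simp
    rw [h3]
    linarith
  refine le_trans ?_ (Finset.sum_le_sum hterm)
  rw [Finset.sum_sub_distrib, Finset.sum_sub_distrib, ← Finset.mul_sum, ← Finset.mul_sum,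
    ← Finset.mul_sum]
  have hG := le_sum_moebius_div_sq N
  have hσ := sum_moebius_div_le N hN3
  set G := ∑ d ∈ Finset.Ioc 0 N, (moebius d : ℝ) / (d : ℝ) ^ 2
  set σ := ∑ d ∈ Finset.Ioc 0 N, (moebius d : ℝ) / d
  set Q := ∑ d ∈ Finset.Ioc 0 N, |(moebius d : ℝ)| / d with hQ
  have hQle : 3 / 2 * (X / (N + 1 / 2)) + (3 / 4 - 5 / (4 * N)) + Q / 2 ≤ Real.log X / 3 + 3 := by
    have hfrac : X / (N + 1 / 2) ≤ 1 + 1 / 2 / (N + 1 / 2) := by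
      have : (1 : ℝ) + 1 / 2 / (N + 1 / 2) = (N + 1) / (N + 1 / 2) := by field_simp; ring
      rw [this]
      exact div_le_div_of_nonneg_right hXN.le (by positivity)
    have hcmp : 1 / 2 / ((N : ℝ) + 1 / 2) ≤ 1 / 2 / N :=
      div_le_div_of_nonneg_left (by norm_num) (by linarith) (by linarith)
    have e1 : (1 : ℝ) / 2 / N = 1 / 2 * (1 / N) := by ring
    have e2 : (5 : ℝ) / (4 * N) = 5 / 4 * (1 / N) := by field_simp
    rw [e1] at hcmp
    rw [e2]
    rcases Nat.lt_or_ge N 6 with h6 | h6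
    · have hQ1 := sum_abs_moebius_div_le_log X 1 (by linarith)
        (harmonic_floor_le_one_add_log X (by linarith))
      rw [← hN, ← hQ] at hQ1
      have hN5 : (N : ℝ) ≤ 5 := by exact_mod_cast (by omega : N ≤ 5)
      have h5 : (1 : ℝ) / 5 ≤ 1 / N := by
        exact div_le_div_of_nonneg_left (by norm_num) (by linarith) hN5
      linarith
    · have hh : (harmonic N : ℝ) ≤ 2 / 3 + Real.log X := by
        have h1 : eulerMascheroniSeq' N ≤ eulerMascheroniSeq' 6 :=
          strictAnti_eulerMascheroniSeq'.antitone h6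
        have h2 := eulerMascheroniSeq'_six_lt_two_thirds
        rw [eulerMascheroniSeq', if_neg (by omega)] at h1
        have h3 : Real.log N ≤ Real.log X := Real.log_le_log (by linarith) hNX
        linarith
      have hQ1 := sum_abs_moebius_div_le_log X (2 / 3) (by linarith) hh
      rw [← hN, ← hQ] at hQ1
      have h0 : (0 : ℝ) ≤ 1 / N := by positivity
      linarith
  have h1 : 3 / 2 * X ^ 2 * (6 / π ^ 2 - 1 / (N + 1 / 2)) ≤ 3 / 2 * X ^ 2 * G :=
    mul_le_mul_of_nonneg_left hG (by positivity)
  have h2 : X * σ ≤ X * (3 / 4 - 5 / (4 * N)) := mul_le_mul_of_nonneg_left hσ hX0.le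
  have h3 := mul_le_mul_of_nonneg_left hQle hX0.le
  have e : 3 / 2 * X ^ 2 * (6 / π ^ 2 - 1 / (N + 1 / 2)) =
      9 / π ^ 2 * X ^ 2 - X * (3 / 2 * (X / (N + 1 / 2))) := by ring
  rw [e] at h1
  linarith

lemma exists_coprime_congr_of_squarefree {D : ℕ} (hD : Squarefree D) (q : ℕ) :
    ∃ q' : ℕ, q'.Coprime D ∧ ∀ l : ℕ, l.Prime → l ∣ D → ¬ l ∣ q → (l : ℤ) ∣ (q' : ℤ) - q := by
  have hmul : D.gcd q * (D / D.gcd q) = D := Nat.mul_div_cancel' (Nat.gcd_dvd_left D q)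
  have hcop : Nat.Coprime (D.gcd q) (D / D.gcd q) :=
    Nat.coprime_of_squarefree_mul (hmul.symm ▸ hD)
  refine ⟨q + D / D.gcd q, ?_, ?_⟩
  · refine Nat.Coprime.symm (Nat.coprime_of_dvd fun l hl hlD hlq => ?_)
    by_cases h : l ∣ q
    · have h1 : l ∣ D / D.gcd q := (Nat.dvd_add_right h).1 hlq
      have h2 : l ∣ D.gcd q := Nat.dvd_gcd hlD h
      exact hl.one_lt.ne' (Nat.dvd_one.1 (hcop ▸ Nat.dvd_gcd h2 h1))
    · have h1 : l ∣ D / D.gcd q := by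
        rcases (hl.dvd_mul.1 (hmul.symm ▸ hlD : l ∣ D.gcd q * (D / D.gcd q))) with h2 | h2
        · exact absurd (h2.trans (Nat.gcd_dvd_right D q)) h
        · exact h2
      exact h ((Nat.dvd_add_left h1).1 hlq)
  · intro l hl hlD h
    have h1 : l ∣ D / D.gcd q := by
      rcases (hl.dvd_mul.1 (hmul.symm ▸ hlD : l ∣ D.gcd q * (D / D.gcd q))) with h2 | h2
      · exact absurd (h2.trans (Nat.gcd_dvd_right D q)) h
      · exact h2
    push_cast
    rw [add_sub_cancel_left]
    exact_mod_cast h1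

/-- Among `k` consecutive blocks of `D` integers, at least `k * φ(D)` of the values `q * x - a`
are coprime to `D`. -/
lemma totient_mul_le_card_filter_coprime {D : ℕ} (hD : Squarefree D) (q : ℕ) (a : ℤ)
    (ha : ∀ l : ℕ, l.Prime → l ∣ D → l ∣ q → ¬ (l : ℤ) ∣ a) (x₀ : ℤ) (k : ℕ) :
    k * D.totient ≤
      ((Finset.Ico x₀ (x₀ + k * D)).filter fun x => IsCoprime ((q : ℤ) * x - a) D).card := by
  obtain ⟨q', hq', hqq⟩ := exists_coprime_congr_of_squarefree hD q
  have hDpos : 0 < D := Nat.pos_of_ne_zero hD.ne_zero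
  have hDZ : (0 : ℤ) < D := by exact_mod_cast hDpos
  obtain ⟨c, d, hcd⟩ : IsCoprime (q' : ℤ) D := Nat.isCoprime_iff_coprime.2 hq'
  have hcard : k * D.totient = (Finset.range k ×ˢ (Finset.range D).filter D.Coprime).card := by
    rw [Finset.card_product, Finset.card_range, Nat.totient]
  rw [hcard]
  refine Finset.card_le_card_of_injOn
    (fun y => x₀ + D * (y.1 : ℤ) + (c * ((y.2 : ℤ) + a) - x₀) % D) ?_ ?_
  · rintro ⟨j, v⟩ hy
    simp only [Finset.coe_product, Set.mem_prod, Finset.mem_coe, Finset.mem_range,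
      Finset.mem_filter] at hy
    obtain ⟨hj, hv, hvD⟩ := hy
    have hm0 := Int.emod_nonneg (c * ((v : ℤ) + a) - x₀) hDZ.ne'
    have hm1 := Int.emod_lt_of_pos (c * ((v : ℤ) + a) - x₀) hDZ
    have hmd := Int.emod_add_mul_ediv (c * ((v : ℤ) + a) - x₀) D
    set m := (c * ((v : ℤ) + a) - x₀) % D
    set e := (c * ((v : ℤ) + a) - x₀) / D
    have hjk : (j : ℤ) + 1 ≤ k := by exact_mod_cast hj
    simp only [Finset.coe_filter, Finset.mem_Ico, Set.mem_ofPred_eq]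
    refine ⟨⟨by nlinarith [mul_nonneg hDZ.le (Int.natCast_nonneg j)], by nlinarith⟩, ?_⟩
    have hx : x₀ + D * (j : ℤ) + m = c * (v + a) + D * (j - e) := by linarith
    rw [hx, Int.isCoprime_iff_gcd_eq_one]
    by_contra hne
    obtain ⟨l, hl, hl1, hl2⟩ := Nat.Prime.not_coprime_iff_dvd.1 hne
    have hl1' : (l : ℤ) ∣ (q : ℤ) * (c * (v + a) + D * (j - e)) - a := Int.natCast_dvd.2 hl1
    have hl2' : (l : ℤ) ∣ D := Int.natCast_dvd.2 hl2
    by_cases hlq : l ∣ q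
    · have h3 : (l : ℤ) ∣ (q : ℤ) * (c * (v + a) + D * (j - e)) :=
        (Int.natCast_dvd_natCast.2 hlq).mul_right _
      refine ha l hl hl2 hlq ?_
      simpa using dvd_sub h3 hl1'
    · have h3 := hqq l hl hl2 hlq
      have h4 : (v : ℤ) = ((q : ℤ) * (c * (v + a) + D * (j - e)) - a)
          + ((q' : ℤ) - q) * (c * (v + a) + D * (j - e))
          + D * (d * (v + a) - q' * (j - e)) := by
        linear_combination -((v : ℤ) + a) * hcd
      have h5 : (l : ℤ) ∣ v := by
        rw [h4]
        exact dvd_add (dvd_add hl1' (h3.mul_right _)) (hl2'.mul_right _)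
      exact Nat.Prime.not_coprime_iff_dvd.2 ⟨l, hl, hl2, Int.natCast_dvd_natCast.1 h5⟩ hvD
  · rintro ⟨j, v⟩ hy ⟨j', v'⟩ hy' heq
    simp only [Finset.coe_product, Set.mem_prod, Finset.mem_coe, Finset.mem_range,
      Finset.mem_filter] at hy hy'
    simp only at heq
    have hm0 := Int.emod_nonneg (c * ((v : ℤ) + a) - x₀) hDZ.ne'
    have hm1 := Int.emod_lt_of_pos (c * ((v : ℤ) + a) - x₀) hDZ
    have hm0' := Int.emod_nonneg (c * ((v' : ℤ) + a) - x₀) hDZ.ne'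
    have hm1' := Int.emod_lt_of_pos (c * ((v' : ℤ) + a) - x₀) hDZ
    have hjj : (j : ℤ) = j' := by
      rcases lt_trichotomy (j : ℤ) j' with h | h | h
      · have : (j : ℤ) + 1 ≤ j' := h
        nlinarith
      · exact h
      · have : (j' : ℤ) + 1 ≤ j := h
        nlinarith
    have hmm : (c * ((v : ℤ) + a) - x₀) % D = (c * ((v' : ℤ) + a) - x₀) % D := by
      rw [hjj] at heq
      linarith
    have hdvd : (D : ℤ) ∣ (c * ((v' : ℤ) + a) - x₀) - (c * ((v : ℤ) + a) - x₀) :=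
      Int.ModEq.dvd hmm
    have hvv : (v : ℤ) ≡ v' [ZMOD D] := by
      rw [Int.modEq_iff_dvd]
      have h6 : (v' : ℤ) - v = q' * ((c * ((v' : ℤ) + a) - x₀) - (c * ((v : ℤ) + a) - x₀))
          + D * (d * (v' - v)) := by
        linear_combination -((v' : ℤ) - v) * hcd
      rw [h6]
      exact dvd_add (hdvd.mul_left _) (dvd_mul_right _ _)
    have hvv' : v = v' := Nat.ModEq.eq_of_lt_of_lt (Int.natCast_modEq_iff.1 hvv) hy.2.1 hy'.2.1
    rw [hvv', Int.natCast_inj.1 hjj]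

/-- Arithmetic progressions `x, x + D, …, x + (h - 1) D` all of whose images under
`y ↦ q * y - a` are in `[1, H]`, or all in `[-H, -1]`, and coprime to `D`: there are many. -/
lemma exists_finset_progressions {D : ℕ} (hD : Squarefree D) (q : ℕ) (hq : 0 < q) (a : ℤ)
    (ha : ∀ l : ℕ, l.Prime → l ∣ D → l ∣ q → ¬ (l : ℤ) ∣ a) (h : ℕ) (hh : 0 < h) (H : ℝ) :
    ∃ G : Finset ℤ, (∀ x ∈ G, IsCoprime ((q : ℤ) * x - a) D ∧
      ∃ ε : ℤ, (ε = 1 ∨ ε = -1) ∧ ∀ m : ℕ, m < h →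
        0 < ε * (q * (x + m * D) - a) ∧ ((ε * (q * (x + m * D) - a) : ℤ) : ℝ) ≤ H) ∧
      2 * ((H / q - h * D) * (D.totient / D)) ≤ (G.card : ℝ) := by
  have hDpos : 0 < D := Nat.pos_of_ne_zero hD.ne_zero
  have hDR : (0 : ℝ) < D := by exact_mod_cast hDpos
  have hDZ : (0 : ℤ) < D := by exact_mod_cast hDpos
  have hqR : (0 : ℝ) < q := by exact_mod_cast hq
  have hqZ : (0 : ℤ) < q := by exact_mod_cast hq
  set y : ℝ := H / (q * D) - (h - 1) with hy
  set k : ℕ := ⌊y⌋₊ with hk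
  set e : ℤ := a / q with he
  have he1 : q * e ≤ a := Int.mul_ediv_self_le hqZ.ne'
  have he2 : a < q * (e + 1) := by
    have := Int.lt_mul_ediv_self_add (x := a) hqZ
    linarith
  have hkH : 0 < k → (q : ℝ) * ((k + h - 1) * D) ≤ H := by
    intro hk0
    have h1 : (k : ℝ) ≤ y := Nat.floor_le (Nat.pos_of_floor_pos hk0).le
    have h2 : (k : ℝ) + h - 1 ≤ H / (q * D) := by rw [hy] at h1; linarith
    rw [le_div_iff₀ (by positivity)] at h2
    linarith
  have hkHZ : 0 < k → ∀ N : ℤ, N ≤ q * ((k + h - 1) * D) → (N : ℝ) ≤ H := by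
    intro hk0 N hN
    have : (N : ℝ) ≤ ((q * ((k + h - 1) * D) : ℤ) : ℝ) := by exact_mod_cast hN
    push_cast at this
    exact this.trans (hkH hk0)
  set f : ℤ := -(-a / q) with hf
  have hf1 : a ≤ q * f := by
    have := Int.mul_ediv_self_le (x := -a) hqZ.ne'
    rw [hf]
    linarith
  have hf2 : q * (f - 1) < a := by
    have := Int.lt_mul_ediv_self_add (x := -a) hqZ
    rw [hf]
    linarith
  set P := (Finset.Ico (e + 1) (e + 1 + k * D)).filter
    fun x => IsCoprime ((q : ℤ) * x - a) D with hP
  set x₁ : ℤ := f - (h - 1) * D - k * D with hx₁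
  set M := (Finset.Ico x₁ (x₁ + k * D)).filter fun x => IsCoprime ((q : ℤ) * x - a) D with hM
  have hPc := totient_mul_le_card_filter_coprime hD q a ha (e + 1) k
  have hMc := totient_mul_le_card_filter_coprime hD q a ha x₁ k
  rw [← hP] at hPc
  rw [← hM] at hMc
  have hdisj : Disjoint P M := by
    rw [Finset.disjoint_left]
    intro x hx hx'
    simp only [hP, hM, Finset.mem_filter, Finset.mem_Ico] at hx hx'
    have h1 : (1 : ℤ) ≤ h := by exact_mod_cast hh
    have h2 : x < f := by nlinarith
    have h3 : e + 1 ≤ x := hx.1.1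
    have h4 : (q : ℤ) * (e + 1) ≤ q * (f - 1) := by
      refine mul_le_mul_of_nonneg_left ?_ hqZ.le
      omega
    linarith
  refine ⟨P ∪ M, ?_, ?_⟩
  · intro x hx
    rcases Finset.mem_union.1 hx with hx | hx
    · simp only [hP, Finset.mem_filter, Finset.mem_Ico] at hx
      obtain ⟨⟨hxl, hxu⟩, hxc⟩ := hx
      refine ⟨hxc, 1, Or.inl rfl, fun m hm => ?_⟩
      have hk0 : 0 < k := by
        rcases Nat.eq_zero_or_pos k with h0 | h0
        · rw [h0] at hxu
          simp at hxu
          omega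
        · exact h0
      have hm0 : (0 : ℤ) ≤ m := Int.natCast_nonneg m
      have hm1 : (m : ℤ) ≤ h - 1 := by omega
      have hmD : (m : ℤ) * D ≤ (h - 1) * D := mul_le_mul_of_nonneg_right hm1 hDZ.le
      have hmD0 : (0 : ℤ) ≤ m * D := mul_nonneg hm0 hDZ.le
      rw [one_mul]
      constructor
      · have : (q : ℤ) * (e + 1) ≤ q * (x + m * D) :=
          mul_le_mul_of_nonneg_left (by linarith) hqZ.le
        linarith
      · refine hkHZ hk0 _ ?_
        have h5 : x + m * D ≤ e + (k + h - 1) * D := by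
          have : x ≤ e + k * D := by omega
          linarith
        have : (q : ℤ) * (x + m * D) ≤ q * (e + (k + h - 1) * D) :=
          mul_le_mul_of_nonneg_left h5 hqZ.le
        linarith
    · simp only [hM, Finset.mem_filter, Finset.mem_Ico] at hx
      obtain ⟨⟨hxl, hxu⟩, hxc⟩ := hx
      refine ⟨hxc, -1, Or.inr rfl, fun m hm => ?_⟩
      have hk0 : 0 < k := by
        rcases Nat.eq_zero_or_pos k with h0 | h0
        · rw [h0] at hxu
          simp at hxu
          omega
        · exact h0
      have hm0 : (0 : ℤ) ≤ m := Int.natCast_nonneg m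
      have hm1 : (m : ℤ) ≤ h - 1 := by omega
      have hmD : (m : ℤ) * D ≤ (h - 1) * D := mul_le_mul_of_nonneg_right hm1 hDZ.le
      have hmD0 : (0 : ℤ) ≤ m * D := mul_nonneg hm0 hDZ.le
      constructor
      · have h5 : x + m * D ≤ f - 1 := by
          have : x < f - (h - 1) * D := by rw [hx₁] at hxu; linarith
          have : x + (h - 1) * D < f := by linarith
          omega
        have : (q : ℤ) * (x + m * D) ≤ q * (f - 1) :=
          mul_le_mul_of_nonneg_left h5 hqZ.le
        linarith
      · refine hkHZ hk0 _ ?_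
        have h5 : f - (k + h - 1) * D ≤ x + m * D := by
          rw [hx₁] at hxl
          linarith
        have : (q : ℤ) * (f - (k + h - 1) * D) ≤ q * (x + m * D) :=
          mul_le_mul_of_nonneg_left h5 hqZ.le
        linarith
  · rw [Finset.card_union_of_disjoint hdisj]
    have h6 : y - 1 ≤ k := by
      have := Nat.lt_floor_add_one y
      linarith
    have h7 : (H / q - h * D) * (D.totient / D) = (y - 1) * D.totient := by
      rw [hy]
      field_simp
      ring
    have h8 : (y - 1) * D.totient ≤ k * D.totient :=
      mul_le_mul_of_nonneg_right h6 (Nat.cast_nonneg _)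
    have h9 : ((k * D.totient : ℕ) : ℝ) ≤ P.card := by exact_mod_cast hPc
    have h10 : ((k * D.totient : ℕ) : ℝ) ≤ M.card := by exact_mod_cast hMc
    push_cast at h9 h10 ⊢
    rw [h7]
    linarith

lemma le_norm_sum_mulChar_progression (p : ℕ) [Fact p.Prime] (χ : MulChar (ZMod p) ℂ) (u : ℕ)
    (H : ℝ) (hone : ∀ m : ℕ, 0 < m → (m : ℝ) ≤ H → Nat.Coprime m u → χ (m : ZMod p) = 1)
    (D : ℕ) (S : Finset ℕ) (hu : ∀ l : ℕ, l.Prime → l ∣ u → l ∣ D ∨ l ∈ S)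
    (h : ℕ) (hS : ∀ l ∈ S, l.Prime ∧ h < l ∧ ¬ l ∣ D ∧ l ≠ p)
    (q t : ℕ) (hq : 0 < q) (hqp : q < p) (hqt : q.Coprime t) (x : ℤ)
    (hx : IsCoprime ((q : ℤ) * x - (p * t : ℕ)) D) (ε : ℤ) (hε : ε = 1 ∨ ε = -1)
    (hN : ∀ m : ℕ, m < h → 0 < ε * (q * (x + m * D) - (p * t : ℕ)) ∧
      ((ε * (q * (x + m * D) - (p * t : ℕ)) : ℤ) : ℝ) ≤ H) :
    (h : ℝ) - 2 * S.card ≤ ‖∑ m : Fin h, χ ((x : ZMod p) + (m : ℕ) * (D : ZMod p))‖ := by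
  classical
  set B : Finset (Fin h) := S.biUnion fun l =>
    Finset.univ.filter fun m : Fin h => (l : ℤ) ∣ q * (x + (m : ℕ) * D) - (p * t : ℕ) with hB
  have hBc : B.card ≤ S.card := by
    refine Finset.card_biUnion_le.trans ?_
    refine (Finset.sum_le_card_nsmul S _ 1 fun l hl => ?_).trans (by simp)
    obtain ⟨hlp, hlh, hlD, hlne⟩ := hS l hl
    rw [Finset.card_le_one]
    intro m hm m' hm'
    simp only [Finset.mem_filter, Finset.mem_univ, true_and] at hm hm'
    have hlpZ : Prime (l : ℤ) := Nat.prime_iff_prime_int.1 hlp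
    have hdvd : (l : ℤ) ∣ (q * D : ℤ) * ((m : ℕ) - (m' : ℕ)) := by
      have h1 : (q * D : ℤ) * ((m : ℕ) - (m' : ℕ)) =
          q * (x + (m : ℕ) * D) - (p * t : ℕ) - (q * (x + (m' : ℕ) * D) - (p * t : ℕ)) := by ring
      rw [h1]
      exact dvd_sub hm hm'
    have hlq : ¬ (l : ℤ) ∣ q := by
      intro hlq
      have h1 : (l : ℤ) ∣ (p * t : ℕ) := by
        have := dvd_sub (hlq.mul_right (x + (m : ℕ) * D)) hm
        simpa using this
      have h2 := (Nat.Prime.dvd_mul hlp).1 (Int.natCast_dvd_natCast.1 h1)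
      rcases h2 with h2 | h2
      · exact hlne ((Nat.prime_dvd_prime_iff_eq hlp Fact.out).1 h2)
      · have h3 := Nat.dvd_gcd (Int.natCast_dvd_natCast.1 hlq) h2
        rw [hqt] at h3
        exact hlp.one_lt.ne' (Nat.dvd_one.1 h3)
    have hlD' : ¬ (l : ℤ) ∣ D := fun h1 => hlD (Int.natCast_dvd_natCast.1 h1)
    rcases hlpZ.dvd_or_dvd hdvd with h1 | h1
    · rcases hlpZ.dvd_or_dvd h1 with h1 | h1
      · exact absurd h1 hlq
      · exact absurd h1 hlD'
    · have h2 := Int.eq_zero_of_abs_lt_dvd h1 (by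
        rw [abs_lt]
        have := m.2
        have := m'.2
        constructor <;> omega)
      apply Fin.ext
      omega
  set w : ℂ := χ ((ε * q : ℤ) : ZMod p) with hw
  have hεn : ‖χ ((ε : ℤ) : ZMod p)‖ = 1 := by
    have : IsUnit ((ε : ℤ) : ZMod p) := by
      rcases hε with rfl | rfl <;> simp
    obtain ⟨v, hv⟩ := this
    rw [← hv]
    exact DirichletCharacter.unit_norm_eq_one χ v
  have hqn : ‖χ (q : ZMod p)‖ = 1 := by
    have : IsUnit (q : ZMod p) := by
      rw [isUnit_iff_ne_zero]
      intro h0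
      rw [ZMod.natCast_eq_zero_iff] at h0
      exact absurd (Nat.le_of_dvd hq h0) (by omega)
    obtain ⟨v, hv⟩ := this
    rw [← hv]
    exact DirichletCharacter.unit_norm_eq_one χ v
  have hwn : ‖w‖ = 1 := by
    rw [hw]
    push_cast
    rw [map_mul, norm_mul, hεn, hqn, one_mul]
  have hgood : ∀ m : Fin h, m ∉ B → w * χ ((x : ZMod p) + (m : ℕ) * (D : ZMod p)) = 1 := by
    intro m hm
    obtain ⟨hN0, hN1⟩ := hN m m.2
    set N : ℤ := ε * (q * (x + (m : ℕ) * D) - (p * t : ℕ)) with hNdef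
    obtain ⟨N', hN'⟩ := Int.eq_ofNat_of_zero_le hN0.le
    have hcop : N'.Coprime u := by
      refine Nat.coprime_of_dvd fun l hl hlN hlu => ?_
      have hlN1 : (l : ℤ) ∣ N := by rw [hN']; exact Int.natCast_dvd_natCast.2 hlN
      have hlN2 : (l : ℤ) ∣ q * (x + (m : ℕ) * D) - (p * t : ℕ) := by
        rw [hNdef] at hlN1
        rcases hε with rfl | rfl
        · simpa using hlN1
        · rw [neg_one_mul] at hlN1
          exact (dvd_neg.1 hlN1)
      rcases hu l hl hlu with hlD | hlS
      · have hlDZ : (l : ℤ) ∣ D := Int.natCast_dvd_natCast.2 hlD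
        have h1 : (l : ℤ) ∣ (q : ℤ) * x - (p * t : ℕ) := by
          have h2 : (q : ℤ) * x - (p * t : ℕ) =
              q * (x + (m : ℕ) * D) - (p * t : ℕ) - (q : ℤ) * (m : ℕ) * D := by ring
          rw [h2]
          exact dvd_sub hlN2 (hlDZ.mul_left ((q : ℤ) * (m : ℕ)))
        have h2 := hx.isUnit_of_dvd' h1 hlDZ
        exact (Nat.prime_iff_prime_int.1 hl).not_isUnit h2
      · apply hm
        rw [hB, Finset.mem_biUnion]
        exact ⟨l, hlS, by simpa using hlN2⟩
    have h1 := hone N' (by omega) (by rw [hN'] at hN1; exact_mod_cast hN1) hcop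
    rw [hw, ← map_mul, ← h1]
    congr 1
    have h2 : ((N : ℤ) : ZMod p) = (N' : ZMod p) := by rw [hN']; simp
    rw [← h2, hNdef]
    push_cast
    simp
    ring
  have hre : ∀ m : Fin h, (1 : ℝ) - (if m ∈ B then 2 else 0) ≤
      (w * χ ((x : ZMod p) + (m : ℕ) * (D : ZMod p))).re := by
    intro m
    split_ifs with hm
    · have h1 : ‖w * χ ((x : ZMod p) + (m : ℕ) * (D : ZMod p))‖ ≤ 1 := by
        rw [norm_mul, hwn, one_mul]
        exact DirichletCharacter.norm_le_one χ _
      have h2 := (abs_le.1 ((Complex.abs_re_le_norm _).trans h1)).1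
      linarith
    · rw [hgood m hm]
      simp
  have hnorm : ‖∑ m : Fin h, χ ((x : ZMod p) + (m : ℕ) * (D : ZMod p))‖ =
      ‖∑ m : Fin h, w * χ ((x : ZMod p) + (m : ℕ) * (D : ZMod p))‖ := by
    rw [← Finset.mul_sum, norm_mul, hwn, one_mul]
  rw [hnorm]
  refine le_trans ?_ (Complex.re_le_norm _)
  rw [Complex.re_sum]
  refine le_trans ?_ (Finset.sum_le_sum fun m _ => hre m)
  rw [Finset.sum_sub_distrib, Finset.sum_ite_mem]
  simp only [Finset.univ_inter, Finset.sum_const, Finset.card_univ, Fintype.card_fin, nsmul_eq_mul,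
    mul_one]
  have : (B.card : ℝ) ≤ S.card := by exact_mod_cast hBc
  linarith

lemma int_eq_of_zmod_eq_of_near (p : ℕ) (H X : ℝ) (hHX : 2 * H * X < p) (q t q' t' : ℕ)
    (hq : 0 < q) (hq' : 0 < q') (hqX : (q : ℝ) ≤ X) (hqX' : (q' : ℝ) ≤ X)
    (hqt : q.Coprime t) (hqt' : q'.Coprime t') (ht : t < q) (ht' : t' < q') (x x' : ℤ)
    (hx : |(((q : ℤ) * x - (p * t : ℕ) : ℤ) : ℝ)| ≤ H)
    (hx' : |(((q' : ℤ) * x' - (p * t' : ℕ) : ℤ) : ℝ)| ≤ H) (hxx : (x : ZMod p) = x') :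
    q = q' ∧ t = t' ∧ x = x' := by
  obtain ⟨k, hk⟩ : (p : ℤ) ∣ x' - x := (ZMod.intCast_eq_intCast_iff_dvd_sub x x' p).1 hxx
  have hH : 0 ≤ H := (abs_nonneg _).trans hx
  have hqR : (0 : ℝ) < q := by exact_mod_cast hq
  have hqR' : (0 : ℝ) < q' := by exact_mod_cast hq'
  have hzero : (q : ℤ) * t' - q' * t - q * q' * k = 0 := by
    rw [← Int.abs_lt_one_iff]
    set Z : ℤ := (q : ℤ) * t' - q' * t - q * q' * k with hZ
    have hid : (p : ℤ) * Z = q' * ((q : ℤ) * x - (p * t : ℕ)) - q * (q' * x' - (p * t' : ℕ)) := by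
      push_cast
      rw [hZ]
      linear_combination ((q : ℤ) * q') * hk
    have hidR : (p : ℝ) * Z = q' * (((q : ℤ) * x - (p * t : ℕ) : ℤ) : ℝ)
        - q * (((q' : ℤ) * x' - (p * t' : ℕ) : ℤ) : ℝ) := by exact_mod_cast hid
    have hp0 : (0 : ℝ) < p := 
      lt_of_le_of_lt (mul_nonneg (by positivity) (hqR.le.trans hqX)) hHX
    have habs : |(p : ℝ) * Z| < p := by
      refine lt_of_le_of_lt ?_ hHX
      rw [hidR]
      refine (abs_sub _ _).trans ?_
      rw [abs_mul, abs_mul, abs_of_pos hqR, abs_of_pos hqR']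
      have h1 := mul_le_mul hqX' hx (abs_nonneg _) (hqR'.le.trans hqX')
      have h2 := mul_le_mul hqX hx' (abs_nonneg _) (hqR.le.trans hqX)
      linarith
    rw [abs_mul, abs_of_pos hp0] at habs
    have h3 : |(Z : ℝ)| < 1 := by
      by_contra h4
      push Not at h4
      nlinarith
    exact_mod_cast h3
  have hqq : q ∣ q' := by
    refine hqt.dvd_of_dvd_mul_right (Int.natCast_dvd_natCast.1 ?_)
    refine ⟨t' - q' * k, ?_⟩
    push_cast
    linear_combination -hzero
  have hqq' : q' ∣ q := by
    refine hqt'.dvd_of_dvd_mul_right (Int.natCast_dvd_natCast.1 ?_)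
    refine ⟨t + q * k, ?_⟩
    push_cast
    linear_combination hzero
  have hqe : q = q' := Nat.dvd_antisymm hqq hqq'
  subst hqe
  have hqZ : (q : ℤ) ≠ 0 := by exact_mod_cast hq.ne'
  have h5 : (t' : ℤ) - t = q * k := by
    apply mul_left_cancel₀ hqZ
    linear_combination hzero
  have h6 : (t' : ℤ) - t = 0 := by
    refine Int.eq_zero_of_abs_lt_dvd (Dvd.intro k h5.symm) ?_
    rw [abs_lt]
    constructor <;> omega
  have h7 : k = 0 := by
    rw [h6] at h5
    rcases mul_eq_zero.1 h5.symm with h | h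
    · exact absurd h hqZ
    · exact h
  refine ⟨rfl, by omega, ?_⟩
  rw [h7, mul_zero] at hk
  omega

/-- Lower bound for the `2r`-th moment of the character sums along progressions. -/
lemma sum_totient_le_moment (p : ℕ) [Fact p.Prime] (χ : MulChar (ZMod p) ℂ) (u : ℕ)
    (H : ℝ) (hone : ∀ m : ℕ, 0 < m → (m : ℝ) ≤ H → Nat.Coprime m u → χ (m : ZMod p) = 1)
    (D : ℕ) (hD : Squarefree D) (hDp : D.Coprime p) (S : Finset ℕ)
    (hu : ∀ l : ℕ, l.Prime → l ∣ u → l ∣ D ∨ l ∈ S)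
    (h : ℕ) (hh : 0 < h) (hS : ∀ l ∈ S, l.Prime ∧ h < l ∧ ¬ l ∣ D ∧ l ≠ p)
    (hSh : 2 * S.card ≤ h) (X : ℝ) (hXp : X < p) (hHX : 2 * H * X < p) (r : ℕ) :
    (∑ q ∈ Finset.Ioc 0 ⌊X⌋₊, (q.totient : ℝ) * (2 * ((H / q - h * D) * (D.totient / D)))) *
      ((h : ℝ) - 2 * S.card) ^ (2 * r) ≤
    ∑ x : ZMod p, ‖∑ m : Fin h, χ (x + (m : ℕ) * (D : ZMod p))‖ ^ (2 * r) := by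
  classical
  have key : ∀ q t : ℕ, ∃ G : Finset ℤ, 0 < q → q.Coprime t → ((∀ x ∈ G,
      IsCoprime ((q : ℤ) * x - (p * t : ℕ)) D ∧
      ∃ ε : ℤ, (ε = 1 ∨ ε = -1) ∧ ∀ m : ℕ, m < h →
        0 < ε * (q * (x + m * D) - (p * t : ℕ)) ∧
        ((ε * (q * (x + m * D) - (p * t : ℕ)) : ℤ) : ℝ) ≤ H) ∧
      2 * ((H / q - h * D) * (D.totient / D)) ≤ (G.card : ℝ)) := by
    intro q t
    by_cases hc : 0 < q ∧ q.Coprime t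
    · obtain ⟨G, hG⟩ := exists_finset_progressions hD q hc.1 (p * t : ℕ) (by
        intro l hl hlD hlq hla
        rcases (Nat.Prime.dvd_mul hl).1 (Int.natCast_dvd_natCast.1 hla) with h1 | h1
        · have h2 := Nat.dvd_gcd hlD h1
          rw [hDp] at h2
          exact hl.one_lt.ne' (Nat.dvd_one.1 h2)
        · have h2 := Nat.dvd_gcd hlq h1
          rw [hc.2] at h2
          exact hl.one_lt.ne' (Nat.dvd_one.1 h2)) h hh H
      exact ⟨G, fun _ _ => hG⟩
    · exact ⟨∅, fun h1 h2 => absurd ⟨h1, h2⟩ hc⟩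
  choose G hG using key
  set I : Finset (Σ _ : (Σ _ : ℕ, ℕ), ℤ) :=
    ((Finset.Ioc 0 ⌊X⌋₊).sigma fun q => (Finset.range q).filter q.Coprime).sigma
      fun y => G y.1 y.2 with hI
  have hmem : ∀ y ∈ I, 0 < y.1.1 ∧ (y.1.1 : ℝ) ≤ X ∧ y.1.2 < y.1.1 ∧ y.1.1.Coprime y.1.2 ∧
      y.2 ∈ G y.1.1 y.1.2 := by
    rintro ⟨⟨q, t⟩, x⟩ hy
    simp only [hI, Finset.mem_sigma, Finset.mem_Ioc, Finset.mem_filter, Finset.mem_range] at hy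
    obtain ⟨⟨⟨h1, h2⟩, h3, h4⟩, h5⟩ := hy
    refine ⟨h1, ?_, h3, h4, h5⟩
    have : ⌊X⌋₊ ≠ 0 := by omega
    exact (Nat.le_floor_iff' h1.ne').1 h2
  have hinj : Set.InjOn (fun y : (Σ _ : (Σ _ : ℕ, ℕ), ℤ) => ((y.2 : ℤ) : ZMod p)) I := by
    rintro ⟨⟨q, t⟩, x⟩ hy ⟨⟨q', t'⟩, x'⟩ hy' heq
    obtain ⟨h1, h2, h3, h4, h5⟩ := hmem _ hy
    obtain ⟨h1', h2', h3', h4', h5'⟩ := hmem _ hy'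
    have habs : ∀ (q t : ℕ) (x : ℤ), 0 < q → q.Coprime t → x ∈ G q t →
        |(((q : ℤ) * x - (p * t : ℕ) : ℤ) : ℝ)| ≤ H := by
      intro q t x hq hqt hx
      obtain ⟨-, ε, hε, hm⟩ := (hG q t hq hqt).1 x hx
      obtain ⟨ha, hb⟩ := hm 0 hh
      simp only [Nat.cast_zero, zero_mul, add_zero] at ha hb
      rcases hε with rfl | rfl
      · rw [one_mul] at ha hb
        rw [abs_of_pos (by exact_mod_cast ha)]
        exact hb
      · rw [neg_one_mul] at ha hb
        rw [abs_of_neg (by exact_mod_cast (neg_pos.1 ha))]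
        rw [Int.cast_neg] at hb
        exact hb
    obtain ⟨rfl, rfl, rfl⟩ := int_eq_of_zmod_eq_of_near p H X hHX q t q' t' h1 h1' h2 h2' h4 h4'
      h3 h3' x x' (habs q t x h1 h4 h5) (habs q' t' x' h1' h4' h5') heq
    rfl
  have hlow : ∀ y ∈ I, ((h : ℝ) - 2 * S.card) ^ (2 * r) ≤
      ‖∑ m : Fin h, χ (((y.2 : ℤ) : ZMod p) + (m : ℕ) * (D : ZMod p))‖ ^ (2 * r) := by
    intro y hy
    obtain ⟨h1, h2, h3, h4, h5⟩ := hmem _ hy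
    obtain ⟨hc, ε, hε, hm⟩ := (hG _ _ h1 h4).1 _ h5
    have hSh' : (2 : ℝ) * S.card ≤ h := by exact_mod_cast hSh
    refine pow_le_pow_left₀ (by linarith) ?_ _
    exact le_norm_sum_mulChar_progression p χ u H hone D S hu h hS _ _ h1
      (by exact_mod_cast h2.trans_lt hXp) h4 _ hc ε hε hm
  have hcard : (∑ q ∈ Finset.Ioc 0 ⌊X⌋₊, (q.totient : ℝ) *
      (2 * ((H / q - h * D) * (D.totient / D)))) ≤ (I.card : ℝ) := by
    rw [hI, Finset.card_sigma, Finset.sum_sigma]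
    push_cast
    refine Finset.sum_le_sum fun q hq => ?_
    rw [Nat.totient, ← nsmul_eq_mul]
    refine Finset.card_nsmul_le_sum _ _ _ fun t ht => ?_
    exact (hG q t (Finset.mem_Ioc.1 hq).1 (Finset.mem_filter.1 ht).2).2
  calc _ ≤ (I.card : ℝ) * ((h : ℝ) - 2 * S.card) ^ (2 * r) := by
        refine mul_le_mul_of_nonneg_right hcard ?_
        rw [pow_mul]
        positivity
    _ = I.card • ((h : ℝ) - 2 * S.card) ^ (2 * r) := by rw [nsmul_eq_mul]
    _ ≤ ∑ y ∈ I, ‖∑ m : Fin h, χ (((y.2 : ℤ) : ZMod p) + (m : ℕ) * (D : ZMod p))‖ ^ (2 * r) :=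
        Finset.card_nsmul_le_sum _ _ _ hlow
    _ = ∑ x ∈ I.image (fun y : (Σ _ : (Σ _ : ℕ, ℕ), ℤ) => ((y.2 : ℤ) : ZMod p)),
          ‖∑ m : Fin h, χ (x + (m : ℕ) * (D : ZMod p))‖ ^ (2 * r) := by
        rw [Finset.sum_image hinj]
    _ ≤ _ := Finset.sum_le_univ_sum_of_nonneg fun x => by positivity

/-- Comparison of the lower and upper bounds for the moment. -/
lemma moment_comparison (p : ℕ) [Fact p.Prime] (ℓ : ℕ) (hℓ : ℓ.Prime) (χ : MulChar (ZMod p) ℂ)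
    (hχ : χ ≠ 1) (hχℓ : χ ^ ℓ = 1) (u : ℕ) (H : ℝ)
    (hone : ∀ m : ℕ, 0 < m → (m : ℝ) ≤ H → Nat.Coprime m u → χ (m : ZMod p) = 1)
    (D : ℕ) (hD : Squarefree D) (hDp : D.Coprime p) (S : Finset ℕ)
    (hu : ∀ l : ℕ, l.Prime → l ∣ u → l ∣ D ∨ l ∈ S)
    (h : ℕ) (hh : 0 < h) (hhp : h < p) (hS : ∀ l ∈ S, l.Prime ∧ h < l ∧ ¬ l ∣ D ∧ l ≠ p)
    (hSh : 2 * S.card ≤ h) (r : ℕ) (hr : 0 < r) (K c : ℝ) (hK : h * D ≤ K)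
    (hcK : c * K ≤ D.totient / D * (1 - 2 * S.card / h) ^ (2 * r))
    (hX : 3.8 ≤ H / (2 * K)) (hXp : H / (2 * K) < p) (hHK : H ^ 2 / K < p)
    (hE : 0 ≤ 1 - π ^ 2 / 9 * (log (H / (2 * K)) + 9) / (3 * (H / (2 * K)))) :
    9 / (2 * π ^ 2) * c * H ^ 2 *
      (1 - π ^ 2 / 9 * (log (H / (2 * K)) + 9) / (3 * (H / (2 * K)))) ≤
    √p * ((2 * r - 1).doubleFactorial * √p / (h : ℝ) ^ r + (2 * r - 1)) := by
  have hDpos : 0 < D := Nat.pos_of_ne_zero hD.ne_zero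
  have hDR : (0 : ℝ) < D := by exact_mod_cast hDpos
  have hhR : (0 : ℝ) < h := by exact_mod_cast hh
  have hK0 : 0 < K := lt_of_lt_of_le (by positivity) hK
  set X := H / (2 * K) with hXdef
  have hX0 : 0 < X := by linarith
  have hHX : H = 2 * K * X := by rw [hXdef]; field_simp
  set W : ℝ := D.totient / D * (1 - 2 * S.card / h) ^ (2 * r) with hW
  have hφ : (0 : ℝ) ≤ D.totient / D := by positivity
  have hinj : Function.Injective fun m : Fin h => (((m : ℕ) : ZMod p) * (D : ZMod p)) := by
    intro m m' hmm
    have hDu : (D : ZMod p) ≠ 0 := by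
      intro h0
      rw [ZMod.natCast_eq_zero_iff] at h0
      have := Nat.dvd_gcd h0 (dvd_refl p)
      rw [hDp] at this
      exact (Fact.out : p.Prime).one_lt.ne' (Nat.dvd_one.1 this)
    have h1 := mul_right_cancel₀ hDu hmm
    rw [ZMod.natCast_eq_natCast_iff] at h1
    exact Fin.ext (Nat.ModEq.eq_of_lt_of_lt h1 (m.2.trans hhp) (m'.2.trans hhp))
  have hup := moment_bound p ℓ hℓ χ hχ hχℓ h r hr _ hinj
  have hlow := sum_totient_le_moment p χ u H hone D hD hDp S hu h hh hS hSh X hXp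
    (by rw [hHX]; rw [hHX] at hHK; convert hHK using 1; field_simp) r
  have hpow : ((h : ℝ) - 2 * S.card) ^ (2 * r) =
      h ^ (2 * r) * (1 - 2 * S.card / h) ^ (2 * r) := by
    rw [← mul_pow]
    congr 1
    field_simp
  have htot := le_sum_totient X hX
  have hsum : (2 * K * (D.totient / D)) *
      ∑ q ∈ Finset.Ioc 0 ⌊X⌋₊, (q.totient : ℝ) * (2 * X / q - 1) ≤
      ∑ q ∈ Finset.Ioc 0 ⌊X⌋₊, (q.totient : ℝ) * (2 * ((H / q - h * D) * (D.totient / D))) := by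
    rw [Finset.mul_sum]
    refine Finset.sum_le_sum fun q hq => ?_
    have h1 : H / q - K ≤ H / q - h * D := by linarith
    have h2 : 2 * K * (D.totient / D) * ((q.totient : ℝ) * (2 * X / q - 1)) =
        (q.totient : ℝ) * (2 * ((H / q - K) * (D.totient / D))) := by
      rw [hHX]; ring
    rw [h2]
    gcongr
  have hpw0 : (0 : ℝ) ≤ (1 - 2 * S.card / h) ^ (2 * r) := by
    rw [pow_mul]; positivity
  set F : ℝ := 9 / π ^ 2 * X ^ 2 - X * (log X + 9) / 3 with hF
  set Eo : ℝ := 1 - π ^ 2 / 9 * (log X + 9) / (3 * X) with hEo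
  have hFE : F = 9 / π ^ 2 * X ^ 2 * Eo := by
    rw [hF, hEo]
    field_simp
  have hF0 : 0 ≤ F := by rw [hFE]; positivity
  have hmain : 2 * K * F * W * h ^ (2 * r) ≤
      (2 * r - 1).doubleFactorial * (h : ℝ) ^ r * p + (2 * r - 1) * √p * (h : ℝ) ^ (2 * r) := by
    refine le_trans ?_ (hlow.trans hup)
    rw [hpow]
    calc 2 * K * F * W * h ^ (2 * r)
        = (2 * K * (D.totient / D) * F) * (h ^ (2 * r) * (1 - 2 * S.card / h) ^ (2 * r)) := by
          rw [hW]; ring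
      _ ≤ _ := by
          refine mul_le_mul_of_nonneg_right ?_ (by positivity)
          refine le_trans ?_ hsum
          exact mul_le_mul_of_nonneg_left htot (by positivity)
  have hmain2 : 2 * K * F * W ≤ √p * ((2 * r - 1).doubleFactorial * √p / (h : ℝ) ^ r
      + (2 * r - 1)) := by
    have hsq : √(p : ℝ) * √p = p := Real.mul_self_sqrt (Nat.cast_nonneg p)
    refine le_of_mul_le_mul_right (hmain.trans_eq ?_) (by positivity : (0 : ℝ) < h ^ (2 * r))
    have hhr : (h : ℝ) ^ (2 * r) = h ^ r * h ^ r := by rw [two_mul, pow_add]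
    rw [hhr]
    field_simp
    linear_combination (-((2 * r - 1).doubleFactorial : ℝ)) * hsq
  refine le_trans ?_ hmain2
  have h3 : 9 / (2 * π ^ 2) * c * H ^ 2 * Eo = 2 * K * F * (c * K) := by
    rw [hFE, hHX]
    field_simp
  rw [h3]
  exact mul_le_mul_of_nonneg_left hcK (by positivity)

lemma doubleFactorial_two_mul_sub_one_le (r : ℕ) (hr : 0 < r) :
    ((2 * r - 1).doubleFactorial : ℝ) ≤ √2 * (2 * r / exp 1) ^ r := by
  have hmono : Stirling.stirlingSeq (2 * r) ≤ Stirling.stirlingSeq r := by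
    have := Stirling.stirlingSeq'_antitone (show r - 1 ≤ 2 * r - 1 by omega)
    simpa [Function.comp, Nat.succ_eq_add_one, Nat.sub_add_cancel (show 1 ≤ 2 * r by omega),
      Nat.sub_add_cancel (show 1 ≤ r by omega)] using this
  have hrR : (0 : ℝ) < r := by exact_mod_cast hr
  unfold Stirling.stirlingSeq at hmono
  have hdf := doubleFactorial_two_mul_sub_one r
  rw [← hdf] at hmono
  rw [div_le_div_iff₀ (by positivity) (by positivity)] at hmono
  have hs : √(2 * ((2 * r : ℕ) : ℝ)) = √2 * √(2 * r) := by
    rw [← Real.sqrt_mul (by norm_num)]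
    push_cast
    ring_nf
  rw [hs] at hmono
  have hpos : (0 : ℝ) < r.factorial * √(2 * r) * (r / exp 1) ^ r * 2 ^ r := by positivity
  refine le_of_mul_le_mul_right ?_ hpos
  calc ((2 * r - 1).doubleFactorial : ℝ) * (r.factorial * √(2 * r) * (r / exp 1) ^ r * 2 ^ r)
      = (2 * r - 1).doubleFactorial * (2 ^ r * r.factorial) * (√(2 * r) * (r / exp 1) ^ r) := by
        ring
    _ ≤ _ := hmono
    _ = _ := by
        push_cast
        rw [two_mul r, pow_add]
        have : (2 * (r : ℝ) / exp 1) = 2 * (r / exp 1) := by ring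
        rw [this, mul_pow 2]
        ring_nf

lemma exp_eight_thirds_gt : (14.39 : ℝ) < exp (8 / 3) := by
  by_contra hle
  push Not at hle
  have h1 : exp (8 / 3) ^ 3 ≤ 14.39 ^ 3 := pow_le_pow_left₀ (exp_pos _).le hle 3
  have h2 : exp (8 / 3) ^ 3 = exp 1 ^ 8 := by
    rw [← exp_nat_mul, ← exp_nat_mul]
    norm_num
  have h3 : (2.7182818283 : ℝ) ^ 8 < exp 1 ^ 8 :=
    pow_lt_pow_left₀ exp_one_gt_d9 (by norm_num) (by norm_num)
  rw [h2] at h1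
  norm_num at h1 h3
  linarith

/-- Elementary facts on the length `h` and the exponent `r` used in the moment method. -/
lemma parameter_facts (n : ℕ) (hn : 1 ≤ n) (Λ : ℝ) (h14 : 14.39 < Λ) (h8 : 8 * ((n : ℝ) - 1) < Λ)
    (b L : ℝ) (hb : b = n / (n + 1)) (hL : L = b * exp (1 / n) * Λ) (h r : ℕ) (hh : h = ⌊L⌋₊)
    (hr : r = ⌊b * Λ / 2⌋₊) :
    1 / 2 ≤ b ∧ b < 1 ∧ Λ ≤ L ∧ 14 ≤ h ∧ (h : ℝ) ≤ L ∧ L < h + 1 ∧ 8 * (n - 1) ≤ h ∧ 2 * r ≤ h ∧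
      3 ≤ r ∧ 2 * (r : ℝ) ≤ b * Λ ∧ b * Λ < 2 * r + 2 := by
  have hnR : (1 : ℝ) ≤ n := by exact_mod_cast hn
  have hb1 : 1 / 2 ≤ b := by
    rw [hb, div_le_div_iff₀ (by norm_num) (by positivity)]
    linarith
  have hb2 : b < 1 := by
    rw [hb, div_lt_one (by positivity)]
    linarith
  have hbe : 1 ≤ b * exp (1 / n) := by
    have h1 := Real.add_one_le_exp (1 / (n : ℝ))
    have h2 : b * (1 / n + 1) = 1 := by
      rw [hb]
      field_simp
      ring
    nlinarith
  have hΛL : Λ ≤ L := by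
    rw [hL]
    nlinarith
  have hhL : (h : ℝ) ≤ L := by rw [hh]; exact Nat.floor_le (by linarith)
  have hLh : L < h + 1 := by rw [hh]; exact Nat.lt_floor_add_one L
  have hh14 : 14 ≤ h := by
    rw [hh]
    apply Nat.le_floor
    push_cast
    linarith
  have hr1 : (r : ℝ) ≤ b * Λ / 2 := by
    rw [hr]
    exact Nat.floor_le (by nlinarith)
  have hr2 : b * Λ / 2 < r + 1 := by
    rw [hr]
    exact Nat.lt_floor_add_one _
  have hr3 : 3 ≤ r := by
    rw [hr]
    apply Nat.le_floor
    push_cast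
    nlinarith
  refine ⟨hb1, hb2, hΛL, hh14, hhL, hLh, ?_, ?_, hr3, by linarith, by linarith⟩
  · have h1 : ((8 * (n - 1) : ℕ) : ℝ) < (h + 1 : ℕ) := by
      push_cast [Nat.cast_sub hn]
      linarith
    have := Nat.cast_lt.1 h1
    omega
  · have h1 : b * Λ = Λ - Λ / (n + 1) := by
      rw [hb]
      field_simp
      ring
    have h2 : 1 ≤ Λ / (n + 1) := by
      rw [one_le_div (by positivity)]
      by_cases h5 : (n : ℝ) ≤ 10
      · linarith
      · push Not at h5
        linarith
    have h3 : ((2 * r : ℕ) : ℝ) < (h + 1 : ℕ) := by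
      push_cast
      linarith
    have := Nat.cast_lt.1 h3
    omega

lemma sub_sq_half_le_log_one_add (x : ℝ) (hx : 0 ≤ x) : x - x ^ 2 / 2 ≤ log (1 + x) := by
  refine le_trans ?_ (Real.le_log_one_add_of_nonneg hx)
  rw [le_div_iff₀ (by linarith)]
  nlinarith [pow_nonneg hx 3]

lemma diagonal_term_le (n : ℕ) (hn : 1 ≤ n) (Λ : ℝ) (hΛ : 0 < Λ)
    (b L : ℝ) (hb : b = n / (n + 1)) (hL : L = b * exp (1 / n) * Λ) (h r : ℕ) (hh : 0 < h)
    (hr : 0 < r) (δ : ℝ) (hδ : δ = b * Λ / 2 - r) (hδ0 : 0 ≤ δ) :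
    ((2 * r - 1).doubleFactorial : ℝ) * exp (Λ / 2) / (h : ℝ) ^ r ≤
      √2 * exp (δ / n + δ ^ 2 / (2 * r) + r * log (L / h)) := by
  have hnR : (1 : ℝ) ≤ n := by exact_mod_cast hn
  have hrR : (0 : ℝ) < r := by exact_mod_cast hr
  have hhR : (0 : ℝ) < h := by exact_mod_cast hh
  have hb0 : 0 < b := by rw [hb]; positivity
  have hL0 : 0 < L := by rw [hL]; positivity
  have h1 : ((2 * r - 1).doubleFactorial : ℝ) * exp (Λ / 2) / (h : ℝ) ^ r ≤
      √2 * (2 * r / exp 1) ^ r * exp (Λ / 2) / (h : ℝ) ^ r := by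
    gcongr
    exact doubleFactorial_two_mul_sub_one_le r hr
  refine h1.trans ?_
  have hLlog : log L = log (b * Λ) + 1 / n := by
    rw [hL, show b * exp (1 / n) * Λ = (b * Λ) * exp (1 / n) by ring,
      log_mul (by positivity) (by positivity), log_exp]
  have hbΛ : b * Λ = 2 * r * (1 + δ / r) := by
    rw [hδ]
    field_simp
    ring
  have hlog2 : log (b * Λ) = log (2 * r) + log (1 + δ / r) := by
    rw [hbΛ, log_mul (by positivity) (by positivity)]
  have hΛe : Λ / 2 = (r + δ) * (1 + 1 / n) := by
    rw [hδ, hb]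
    field_simp
    ring
  have hlow := sub_sq_half_le_log_one_add (δ / r) (by positivity)
  have hpow : (2 * r / exp 1) ^ r / (h : ℝ) ^ r = exp (r * (log (2 * r) - 1 - log h)) := by
    rw [← div_pow, exp_nat_mul, exp_sub, exp_sub, exp_log (by positivity), exp_log hhR]
  have h2 : √2 * (2 * r / exp 1) ^ r * exp (Λ / 2) / (h : ℝ) ^ r =
      √2 * exp (r * (log (2 * r) - 1 - log h) + Λ / 2) := by
    rw [exp_add, ← hpow]
    ring
  rw [h2]
  refine mul_le_mul_of_nonneg_left (exp_le_exp.2 ?_) (by positivity)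
  rw [log_div hL0.ne' hhR.ne', hLlog, hlog2, hΛe]
  have h3 : r * (δ / r - (δ / r) ^ 2 / 2) ≤ r * log (1 + δ / r) :=
    mul_le_mul_of_nonneg_left hlow hrR.le
  have h4 : r * (δ / r - (δ / r) ^ 2 / 2) = δ - δ ^ 2 / (2 * r) := by
    field_simp
  rw [h4] at h3
  have h5 : (r + δ) * (1 + 1 / (n : ℝ)) = r + r * (1 / n) + δ + δ / n := by ring
  rw [h5]
  linarith

lemma sqrt_two_bounds : (1.41421 : ℝ) < √2 ∧ √2 < 1.41422 := by
  constructor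
  · exact Real.lt_sqrt_of_sq_lt (by norm_num)
  · rw [Real.sqrt_lt' (by norm_num)]
    norm_num

lemma exp_mul_le_chord (a t : ℝ) (ht0 : 0 ≤ t) (ht1 : t ≤ 1) :
    exp (t * a) ≤ 1 + t * (exp a - 1) := by
  have h := convexOn_exp.2 (Set.mem_univ 0) (Set.mem_univ a) (sub_nonneg.2 ht1) ht0 (by ring)
  simp only [smul_eq_mul, mul_zero, zero_add, exp_zero, mul_one] at h
  linarith

lemma convex_combination_pos {x y t : ℝ} (hx : 0 < x) (hy : 0 < y) (ht0 : 0 ≤ t) (ht1 : t ≤ 1) :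
    0 < (1 - t) * x + t * y := by
  rcases eq_or_lt_of_le ht0 with rfl | ht
  · simpa using hx
  · have := mul_pos ht hy
    have := mul_nonneg (sub_nonneg.2 ht1) hx.le
    linarith

lemma corner_inequality_one (δ y w : ℝ) (hδ0 : 0 ≤ δ) (hδ1 : δ ≤ 1) (hy0 : 0 ≤ y) (hy1 : y ≤ 0.2)
    (hw0 : 0 ≤ w) (hw1 : w ≤ 1 / 6) :
    √2 * exp (δ + δ ^ 2 * w + y) < √2 + 1 + 2 * δ + 2 * y + 3 * √2 * (w * (1 + w)) := by
  obtain ⟨hs1, hs2⟩ := sqrt_two_bounds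
  have he1 := exp_one_lt_d9
  have he6 : exp (1 / 6) ≤ 1.18137 := by
    by_contra hlt
    push Not at hlt
    have h1 := pow_le_pow_left₀ (by norm_num) hlt.le 6
    rw [← exp_nat_mul] at h1
    norm_num at h1
    linarith
  have he5 : exp 0.2 ≤ 1.22141 := by
    by_contra hlt
    push Not at hlt
    have h1 := pow_le_pow_left₀ (by norm_num) hlt.le 5
    rw [← exp_nat_mul] at h1
    norm_num at h1
    linarith
  have hw : exp w ≤ 1 + 1.08823 * w := by
    have := exp_mul_le_chord (1 / 6) (6 * w) (by linarith) (by linarith)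
    rw [show 6 * w * (1 / 6) = w by ring] at this
    nlinarith
  have hy : exp y ≤ 1 + 1.10706 * y := by
    have := exp_mul_le_chord 0.2 (5 * y) (by linarith) (by linarith)
    rw [show 5 * y * 0.2 = y by ring] at this
    nlinarith
  have hδ : exp (δ + δ ^ 2 * w) ≤ 1 + δ * (1.7183 + 2.9582 * w) := by
    have h1 : exp (δ + δ ^ 2 * w) ≤ exp (δ * (1 + w)) := by
      apply exp_le_exp.2
      nlinarith [mul_nonneg hδ0 hw0]
    have h2 := exp_mul_le_chord (1 + w) δ hδ0 hδ1
    have h3 : exp (1 + w) ≤ 2.7182818286 * (1 + 1.08823 * w) := by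
      rw [exp_add]
      exact mul_le_mul he1.le hw (exp_pos _).le (by norm_num)
    nlinarith
  have hprod : exp (δ + δ ^ 2 * w + y) ≤
      (1 + δ * (1.7183 + 2.9582 * w)) * (1 + 1.10706 * y) := by
    rw [exp_add]
    exact mul_le_mul hδ hy (exp_pos _).le (by positivity)
  have hA : √2 * exp (δ + δ ^ 2 * w + y) ≤
      √2 * ((1 + δ * (1.7183 + 2.9582 * w)) * (1 + 1.10706 * y)) :=
    mul_le_mul_of_nonneg_left hprod (by positivity)
  refine hA.trans_lt ?_
  -- reduce to the endpoints of `y`, then of `δ`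
  have hcorner : ∀ v : ℝ, (v = 0 ∨ v = 0.2) →
      0 < 1 + 2 * δ + 2 * v + √2 * (1 + 3 * (w * (1 + w))
        - (1 + δ * (1.7183 + 2.9582 * w)) * (1 + 1.10706 * v)) := by
    intro v hv
    have e0 : 0 < 1 + 2 * v + √2 * (1 + 3 * (w * (1 + w)) - (1 + 1.10706 * v)) := by
      rcases hv with rfl | rfl <;> nlinarith [mul_nonneg hw0 hw0]
    have e1 : 0 < 3 + 2 * v + √2 * (1 + 3 * (w * (1 + w))
        - (2.7183 + 2.9582 * w) * (1 + 1.10706 * v)) := by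
      rcases hv with rfl | rfl
      · nlinarith [mul_nonneg hw0 hw0]
      · nlinarith [mul_nonneg hw0 hw0, sq_nonneg (w - 0.1)]
    exact (convex_combination_pos e0 e1 hδ0 hδ1).trans_eq (by ring)
  have hy5 := convex_combination_pos (hcorner 0 (Or.inl rfl)) (hcorner 0.2 (Or.inr rfl))
    (by linarith : 0 ≤ 5 * y) (by linarith)
  rw [← sub_pos]
  exact hy5.trans_eq (by ring)

lemma corner_inequality_two (δ y : ℝ) (hδ0 : 0 ≤ δ) (hδ1 : δ ≤ 1) (hy0 : 0 ≤ y)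
    (hy1 : y ≤ 1 / 2) : √2 * exp (2 / 3 * δ + y) < √2 + 1 + 2 * δ + 4 * y := by
  obtain ⟨hs1, hs2⟩ := sqrt_two_bounds
  have he : exp (7 / 6) ≤ 3.22 := by
    by_contra hlt
    push Not at hlt
    have h1 := pow_le_pow_left₀ (by norm_num) hlt.le 6
    rw [← exp_nat_mul] at h1
    have h2 : exp (((6 : ℕ) : ℝ) * (7 / 6)) = exp 1 ^ 7 := by
      rw [← exp_nat_mul]
      norm_num
    rw [h2] at h1
    have h3 : exp 1 ^ 7 ≤ 2.7182818286 ^ 7 :=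
      pow_le_pow_left₀ (exp_pos _).le exp_one_lt_d9.le 7
    norm_num at h1 h3
    linarith
  have h := exp_mul_le_chord (7 / 6) (6 / 7 * (2 / 3 * δ + y)) (by linarith) (by linarith)
  rw [show 6 / 7 * (2 / 3 * δ + y) * (7 / 6) = 2 / 3 * δ + y by ring] at h
  have h2 : exp (2 / 3 * δ + y) ≤ 1 + 1.91 * (2 / 3 * δ + y) := by nlinarith
  have h3 : √2 * exp (2 / 3 * δ + y) ≤ √2 * (1 + 1.91 * (2 / 3 * δ + y)) :=
    mul_le_mul_of_nonneg_left h2 (by positivity)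
  nlinarith

lemma exponent_inequality (n : ℕ) (hn : 1 ≤ n) (δ y r : ℝ) (hδ0 : 0 ≤ δ) (hδ1 : δ ≤ 1)
    (hy0 : 0 ≤ y) (hy1 : n = 1 → y ≤ 0.2) (hy2 : y ≤ 1 / 2) (hr : 3 ≤ r) :
    √2 * exp (δ / n + δ ^ 2 / (2 * r) + y) < √2 + 1 + 2 * δ + 2 * n * y
      + 3 * √2 * (1 / (2 * r) * (1 + 1 / (2 * r))) := by
  have hδ2 : δ ^ 2 / (2 * r) ≤ δ / 6 := by
    rw [div_le_div_iff₀ (by positivity) (by norm_num)]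
    nlinarith [mul_nonneg hδ0 (by linarith : (0 : ℝ) ≤ r - 3)]
  have hw0 : 0 ≤ 3 * √2 * (1 / (2 * r) * (1 + 1 / (2 * r))) := by positivity
  rcases eq_or_lt_of_le hn with h1 | h1
  · have hn1 : (n : ℝ) = 1 := by exact_mod_cast h1.symm
    have h2 := corner_inequality_one δ y (1 / (2 * r)) hδ0 hδ1 hy0 (hy1 h1.symm) (by positivity) (by
      apply one_div_le_one_div_of_le <;> linarith)
    rw [hn1, div_one, mul_one, div_eq_mul_one_div (δ ^ 2)]
    exact h2
  · have hn2 : (2 : ℝ) ≤ n := by exact_mod_cast h1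
    have hδn : δ / n ≤ δ / 2 := div_le_div_of_nonneg_left hδ0 (by norm_num) hn2
    have h3 := corner_inequality_two δ y hδ0 hδ1 hy0 hy2
    have h4 : √2 * exp (δ / n + δ ^ 2 / (2 * r) + y) ≤ √2 * exp (2 / 3 * δ + y) :=
      mul_le_mul_of_nonneg_left (exp_le_exp.2 (by linarith)) (Real.sqrt_nonneg 2)
    have h5 : 2 * 2 * y ≤ 2 * n * y := by gcongr
    linarith

lemma moment_coefficient_lt (n : ℕ) (hn : 1 ≤ n) (Λ : ℝ) (h14 : 14.39 < Λ)
    (h8 : 8 * ((n : ℝ) - 1) < Λ) (b L : ℝ) (hb : b = n / (n + 1))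
    (hL : L = b * exp (1 / n) * Λ) (h r : ℕ) (hh : h = ⌊L⌋₊) (hr : r = ⌊b * Λ / 2⌋₊) :
    ((2 * r - 1).doubleFactorial : ℝ) * exp (Λ / 2) / (h : ℝ) ^ r + (2 * r - 1) <
      (L / h) ^ n * (b * Λ * (1 + √2 / (b * Λ - 3))) := by
  obtain ⟨hb1, hb2, hΛL, hh14, hhL, hLh, -, h2r, hr3, hr1, hr2⟩ :=
    parameter_facts n hn Λ h14 h8 b L hb hL h r hh hr
  have hnR : (1 : ℝ) ≤ n := by exact_mod_cast hn
  have hrR : (3 : ℝ) ≤ r := by exact_mod_cast hr3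
  have hhR : (14 : ℝ) ≤ h := by exact_mod_cast hh14
  have h2rR : 2 * (r : ℝ) ≤ h := by exact_mod_cast h2r
  have hs0 : 0 ≤ √2 := Real.sqrt_nonneg 2
  obtain ⟨δ, hδ⟩ : ∃ δ, δ = b * Λ / 2 - r := ⟨_, rfl⟩
  have hδ0 : 0 ≤ δ := by linarith
  have hδ1 : δ ≤ 1 := by linarith
  have hdiag := diagonal_term_le n hn Λ (by linarith) b L hb hL h r (by omega) (by omega) δ hδ hδ0
  set y := r * log (L / h) with hy
  have hlog0 : 0 ≤ log (L / h) := log_nonneg (by rw [le_div_iff₀ (by linarith)]; linarith)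
  have hy0 : 0 ≤ y := by positivity
  have hyh : y * h ≤ r := by
    have h1 : log (L / h) ≤ L / h - 1 := log_le_sub_one_of_pos (by
      apply div_pos <;> linarith)
    have h2 : (L / h - 1) * h ≤ 1 := by
      rw [sub_mul, div_mul_cancel₀ _ (by linarith)]
      linarith
    have h3 : log (L / h) * h ≤ 1 :=
      (mul_le_mul_of_nonneg_right h1 (by linarith)).trans h2
    rw [hy]
    nlinarith
  have hw : 1 / (2 * (r : ℝ)) * (1 + 1 / (2 * r)) ≤ 1 / (b * Λ - 3) := by
    have h1 : 1 / (2 * (r : ℝ) - 1) ≤ 1 / (b * Λ - 3) := by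
      apply one_div_le_one_div_of_le <;> nlinarith
    refine le_trans ?_ h1
    rw [le_div_iff₀ (by linarith)]
    have h2 : 1 / (2 * (r : ℝ)) * (1 + 1 / (2 * r)) * (2 * r - 1) =
        1 - (1 / (2 * (r : ℝ))) ^ 2 := by
      field_simp
      ring
    rw [h2]
    nlinarith [sq_nonneg (1 / (2 * (r : ℝ)))]
  have hbΛ3 : 0 < b * Λ - 3 := by nlinarith
  have hQ : b * Λ * (1 + √2 / (b * Λ - 3)) = 2 * r + 2 * δ + √2 + 3 * √2 * (1 / (b * Λ - 3)) := by
    have : 2 * r + 2 * δ = b * Λ := by rw [hδ]; ring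
    rw [this]
    field_simp
    ring
  have hQ' : 2 * r + 2 * δ + √2 + 3 * √2 * (1 / (2 * r) * (1 + 1 / (2 * r))) ≤
      b * Λ * (1 + √2 / (b * Λ - 3)) := by
    rw [hQ]
    have := mul_le_mul_of_nonneg_left hw (by positivity : 0 ≤ 3 * √2)
    linarith
  have hpow : 1 + n * log (L / h) ≤ (L / h) ^ n := by
    have h1 : (L / h) ^ n = exp (n * log (L / h)) := by
      rw [exp_nat_mul, exp_log (by apply div_pos <;> linarith)]
    rw [h1]
    linarith [Real.add_one_le_exp (n * log (L / h))]
  set Q := b * Λ * (1 + √2 / (b * Λ - 3)) with hQdef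
  have hwpos : 0 ≤ 3 * √2 * (1 / (2 * (r : ℝ)) * (1 + 1 / (2 * r))) := by positivity
  have hRHS : Q + 2 * n * y ≤ (L / h) ^ n * Q := by
    have hQ2 : 2 * (r : ℝ) ≤ Q := by linarith
    have h1 : (1 + n * log (L / h)) * Q ≤ (L / h) ^ n * Q :=
      mul_le_mul_of_nonneg_right hpow (by linarith)
    have h2 : n * log (L / h) * (2 * r) ≤ n * log (L / h) * Q :=
      mul_le_mul_of_nonneg_left hQ2 (by positivity)
    rw [hy]
    linarith
  refine lt_of_lt_of_le ?_ hRHS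
  have hfin : √2 * exp (δ / n + δ ^ 2 / (2 * r) + y) < √2 + 1 + 2 * δ + 2 * n * y
      + 3 * √2 * (1 / (2 * r) * (1 + 1 / (2 * r))) := by
    refine exponent_inequality n hn δ y r hδ0 hδ1 hy0 (fun hn1 => ?_) ?_ hrR
    · have hn1 : (n : ℝ) = 1 := by exact_mod_cast hn1
      have h5r : 5 * (r : ℝ) ≤ h := by
        have hbh : b = 1 / 2 := by rw [hb, hn1]; norm_num
        rw [hn1, hbh] at hL
        norm_num at hL
        rw [hbh] at hr1
        have := mul_le_mul_of_nonneg_right exp_one_gt_d9.le (by linarith : 0 ≤ Λ)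
        linarith
      exact le_of_mul_le_mul_right (by linarith : y * h ≤ 0.2 * h) (by linarith)
    · exact le_of_mul_le_mul_right (by linarith : y * h ≤ 1 / 2 * h) (by linarith)
  linarith

lemma exp_neg_le_one_sub (x : ℝ) (hx0 : 0 ≤ x) (hx1 : x ≤ 1 / 4) : exp (-(1.151 * x)) ≤ 1 - x := by
  have h1 := exp_mul_le_chord (-0.28775) (4 * x) (by linarith) (by linarith)
  rw [show 4 * x * (-0.28775) = -(1.151 * x) by ring] at h1
  have h2 : exp (-0.28775) ≤ 3 / 4 := by
    rw [exp_neg]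
    have h3 := Real.sum_le_exp_of_nonneg (by norm_num : (0 : ℝ) ≤ 0.28775) 5
    have h4 : (4 / 3 : ℝ) ≤ exp 0.28775 := by
      refine le_trans ?_ h3
      norm_num [Finset.sum_range_succ, Nat.factorial]
    rw [inv_le_comm₀ (exp_pos _) (by norm_num)]
    linarith
  nlinarith

lemma exp_neg_le_one_sub_pow (s h r : ℕ) (hh : 0 < h) (hs : 8 * s ≤ h) (ρ : ℝ)
    (hρ : 2 * (r : ℝ) ≤ ρ * h) :
    exp (-(2.302 * ρ)) ^ s ≤ (1 - 2 * (s : ℝ) / h) ^ (2 * r) := by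
  have hhR : (0 : ℝ) < h := by exact_mod_cast hh
  have hsR : 8 * (s : ℝ) ≤ h := by exact_mod_cast hs
  have h1 := exp_neg_le_one_sub (2 * s / h) (by positivity) (by
    rw [div_le_div_iff₀ hhR (by norm_num)]
    linarith)
  have h2 := pow_le_pow_left₀ (exp_pos _).le h1 (2 * r)
  refine le_trans ?_ h2
  rw [← exp_nat_mul, ← exp_nat_mul]
  apply exp_le_exp.2
  have h3 : 2 * (r : ℝ) / h ≤ ρ := by rw [div_le_iff₀ hhR]; exact hρ
  have h4 : ((2 * r : ℕ) : ℝ) * -(1.151 * (2 * s / h)) = -(2.302 * s * (2 * r / h)) := by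
    push_cast
    ring
  rw [h4]
  have := mul_le_mul_of_nonneg_left h3 (by positivity : (0 : ℝ) ≤ 2.302 * s)
  linarith

lemma totient_prod_primes_div (T : Finset ℕ) (hT : ∀ l ∈ T, l.Prime) :
    (((∏ l ∈ T, l).totient : ℝ)) / ((∏ l ∈ T, l : ℕ) : ℝ) = ∏ l ∈ T, (1 - 1 / (l : ℝ)) := by
  have h1 := Nat.totient_eq_mul_prod_factors (∏ l ∈ T, l)
  rw [Nat.primeFactors_prod hT] at h1
  have h2 : ((∏ l ∈ T, l : ℕ) : ℝ) ≠ 0 := by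
    exact_mod_cast Finset.prod_ne_zero_iff.2 fun l hl => (hT l hl).ne_zero
  have h3 : (((∏ l ∈ T, l).totient : ℝ)) =
      ((∏ l ∈ T, l : ℕ) : ℝ) * ∏ l ∈ T, (1 - (l : ℝ)⁻¹) := by
    have h4 := congrArg (fun x : ℚ => (x : ℝ)) h1
    simp only [Rat.cast_natCast, Rat.cast_mul, Rat.cast_prod, Rat.cast_sub, Rat.cast_one,
      Rat.cast_inv] at h4
    exact h4
  rw [h3, mul_div_cancel_left₀ _ h2]
  simp

lemma small_primes_bounds (T : Finset ℕ) (h : ℕ) (b : ℝ) (hh : 2 ≤ h) (hb0 : 0 < b)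
    (hb : b ≤ 1 - 1 / (h : ℝ)) (hT : ∀ l ∈ T, l.Prime ∧ l ≤ h) :
    ((∏ l ∈ T, l : ℕ) : ℝ) ≤ (h : ℝ) ^ T.card ∧
    ((∏ l ∈ T, l : ℕ) : ℝ) * b ^ T.card ≤
      (h : ℝ) ^ T.card * (((∏ l ∈ T, l).totient : ℝ) / ((∏ l ∈ T, l : ℕ) : ℝ)) ∧
    (1 / 2 : ℝ) ^ T.card ≤ ((∏ l ∈ T, l).totient : ℝ) / ((∏ l ∈ T, l : ℕ) : ℝ) := by
  have hhR : (2 : ℝ) ≤ h := by exact_mod_cast hh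
  have hl2 : ∀ l ∈ T, (2 : ℝ) ≤ l ∧ (l : ℝ) ≤ h := fun l hl =>
    ⟨by exact_mod_cast (hT l hl).1.two_le, by exact_mod_cast (hT l hl).2⟩
  rw [totient_prod_primes_div T fun l hl => (hT l hl).1]
  push_cast
  refine ⟨?_, ?_, ?_⟩
  · rw [← Finset.prod_const]
    exact Finset.prod_le_prod (fun l _ => Nat.cast_nonneg l) fun l hl => (hl2 l hl).2
  · rw [← Finset.prod_const, ← Finset.prod_const, ← Finset.prod_mul_distrib,
      ← Finset.prod_mul_distrib]
    refine Finset.prod_le_prod (fun l _ => by positivity) fun l hl => ?_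
    obtain ⟨h2, h3⟩ := hl2 l hl
    have h4 : (l : ℝ) * b ≤ l * (1 - 1 / h) := mul_le_mul_of_nonneg_left hb (by linarith)
    refine h4.trans ?_
    have h5 : (h : ℝ) * (1 - 1 / l) - l * (1 - 1 / h) = (h - l) * (h * l - h - l) / (h * l) := by
      have : (l : ℝ) ≠ 0 := by linarith
      have : (h : ℝ) ≠ 0 := by linarith
      field_simp
      ring
    have h6 : 0 ≤ (h - l) * (h * l - h - l) / ((h : ℝ) * l) := by
      apply div_nonneg
      · apply mul_nonneg <;> nlinarith
      · positivity
    linarith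
  · rw [← Finset.prod_const]
    refine Finset.prod_le_prod (fun _ _ => by norm_num) fun l hl => ?_
    have := one_div_le_one_div_of_le (by norm_num) (hl2 l hl).1
    linarith

lemma weight_bounds (T : Finset ℕ) (h r s n : ℕ) (b ρ : ℝ) (hn : n = T.card + s + 1)
    (hh : 14 ≤ h) (hhn : 8 * (n - 1) ≤ h) (hb : b = n / (n + 1))
    (hT : ∀ l ∈ T, l.Prime ∧ l ≤ h) (hρ : 2 * (r : ℝ) ≤ ρ * h) (hρ0 : 0.4 ≤ ρ) (hρ1 : ρ ≤ 1)
    (W : ℝ) (hW : W = ((∏ l ∈ T, l).totient : ℝ) / ((∏ l ∈ T, l : ℕ) : ℝ) *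
      (1 - 2 * (s : ℝ) / h) ^ (2 * r)) :
    h * ((∏ l ∈ T, l : ℕ) : ℝ) * b ^ (n - 1) ≤ (h : ℝ) ^ n * min W (b ^ (n - 1)) ∧
    exp (-(2.302 * ρ)) ^ (n - 1) ≤ min W (b ^ (n - 1)) := by
  have hhR : (14 : ℝ) ≤ h := by exact_mod_cast hh
  have hn1 : (1 : ℝ) ≤ n := by exact_mod_cast (by omega : 1 ≤ n)
  have hb0 : 0 < b := by rw [hb]; positivity
  have hb1 : b ≤ 1 := by rw [hb, div_le_one (by positivity)]; linarith
  have hb2 : 1 / 2 ≤ b := by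
    rw [hb, div_le_div_iff₀ (by norm_num) (by positivity)]
    linarith
  have hbh : b ≤ 1 - 1 / (h : ℝ) := by
    have h1 : (n : ℝ) + 1 ≤ h := by exact_mod_cast (by omega : n + 1 ≤ h)
    have h2 := one_div_le_one_div_of_le (by positivity) h1
    have h3 : b = 1 - 1 / (n + 1) := by
      rw [hb]
      field_simp
      ring
    linarith
  obtain ⟨hD1, hD2, hD3⟩ := small_primes_bounds T h b (by omega) hb0 hbh hT
  set D : ℝ := ((∏ l ∈ T, l : ℕ) : ℝ)
  set φ : ℝ := ((∏ l ∈ T, l).totient : ℝ) / D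
  have hφ0 : 0 ≤ φ := le_trans (by positivity) hD3
  have hpw := exp_neg_le_one_sub_pow s h r (by omega) (by omega) ρ hρ
  set V : ℝ := (1 - 2 * (s : ℝ) / h) ^ (2 * r)
  set c : ℝ := exp (-(2.302 * ρ)) with hc
  have hc0 : 0 < c := exp_pos _
  have hc1 : c ≤ 1 / 2 := by
    have h1 : c ≤ exp (-0.7) := exp_le_exp.2 (by linarith)
    have h2 : exp (-0.7) ≤ 1 / 2 := by
      rw [exp_neg, inv_le_comm₀ (exp_pos _) (by norm_num)]
      have h3 := Real.sum_le_exp_of_nonneg (by norm_num : (0 : ℝ) ≤ 0.7) 5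
      refine le_trans ?_ h3
      norm_num [Finset.sum_range_succ, Nat.factorial]
    exact h1.trans h2
  have hc2 : 1 ≤ c * h := by
    have h1 : exp (-2.302) ≤ c := exp_le_exp.2 (by linarith)
    have h2 : 1 / 14 ≤ exp (-2.302) := by
      rw [exp_neg, one_div, inv_le_inv₀ (by norm_num) (exp_pos _)]
      have h3 : exp 2.302 ≤ exp 1 * exp 1 * exp 0.302 := by
        rw [← exp_add, ← exp_add]
        norm_num
      have h4 : exp 0.302 ≤ 1.5 := by
        have := Real.exp_bound_div_one_sub_of_interval (x := 0.302) (by norm_num) (by norm_num)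
        refine this.trans ?_
        norm_num
      have h5 := exp_one_lt_d9
      have h6 := exp_pos 1
      have h7 : exp 1 * exp 1 ≤ 2.72 * 2.72 := by
        apply mul_le_mul <;> linarith
      have h8 : exp 1 * exp 1 * exp 0.302 ≤ 2.72 * 2.72 * 1.5 :=
        mul_le_mul h7 h4 (exp_pos _).le (by norm_num)
      norm_num at h8
      linarith
    nlinarith
  have hns : n - 1 = T.card + s := by omega
  have hWV : W = φ * V := hW
  constructor
  · have hpow : (h : ℝ) ^ n = h * (h ^ T.card * h ^ s) := by
      rw [hn, pow_succ, pow_add]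
      ring
    rw [hpow, mul_assoc, mul_assoc]
    refine mul_le_mul_of_nonneg_left ?_ (by linarith)
    rw [mul_min_of_nonneg _ _ (by positivity)]
    refine le_min ?_ ?_
    · have hV1 : 1 ≤ (h : ℝ) ^ s * V := by
        have h1 : 1 ≤ (c * h) ^ s := one_le_pow₀ hc2
        rw [mul_pow] at h1
        have h2 := mul_le_mul_of_nonneg_left hpw (by positivity : (0 : ℝ) ≤ h ^ s)
        linarith
      have h3 : b ^ (n - 1) ≤ b ^ T.card :=
        pow_le_pow_of_le_one hb0.le hb1 (by omega)
      calc D * b ^ (n - 1) ≤ D * b ^ T.card := by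
            exact mul_le_mul_of_nonneg_left h3 (Nat.cast_nonneg _)
        _ ≤ h ^ T.card * φ := hD2
        _ ≤ h ^ T.card * φ * (h ^ s * V) := le_mul_of_one_le_right (by positivity) hV1
        _ = _ := by rw [hWV]; ring
    · refine mul_le_mul_of_nonneg_right (hD1.trans ?_) (by positivity)
      exact le_mul_of_one_le_right (by positivity) (one_le_pow₀ (by linarith))
  · refine le_min ?_ ?_
    · rw [hns, pow_add, hWV]
      refine mul_le_mul ?_ hpw (by positivity) hφ0
      exact (pow_le_pow_left₀ hc0.le hc1 _).trans hD3
    · exact pow_le_pow_left₀ hc0.le (hc1.trans hb2) _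

lemma ratio_pow_le (n h : ℕ) (L : ℝ) (hh : 0 < h) (hL0 : 1 ≤ L) (hnL : 16 * (n : ℝ) ≤ 3 * L)
    (hLh : L < h + 1) : (L / h) ^ n ≤ 16 / 13 := by
  have hhR : (0 : ℝ) < h := by exact_mod_cast hh
  have h1 : 1 - 1 / L ≤ h / L := by
    rw [one_sub_div (by linarith)]
    gcongr
    linarith
  have h10 : 0 ≤ 1 - 1 / L := by
    rw [sub_nonneg, div_le_one (by linarith)]
    exact hL0
  have h2 := one_add_mul_le_pow (a := -(1 / L)) (by linarith) n
  have h3 : (1 - 1 / L) ^ n ≤ (h / L) ^ n := pow_le_pow_left₀ h10 h1 n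
  have h4 : n * (1 / L) ≤ 3 / 16 := by
    rw [mul_one_div, div_le_div_iff₀ (by linarith) (by norm_num)]
    linarith
  have h5 : 13 / 16 ≤ ((h : ℝ) / L) ^ n := by
    rw [← sub_eq_add_neg] at h2
    linarith
  have h6 : (L / h) ^ n = ((h / L) ^ n)⁻¹ := by rw [← inv_pow, inv_div]
  rw [h6, inv_le_comm₀ (by positivity) (by norm_num)]
  norm_num
  exact h5

lemma exp_neg_two_three_gt : (0.094 : ℝ) ≤ exp (-(2.302 * 1)) := by
  rw [exp_neg]
  rw [le_inv_comm₀ (by norm_num) (exp_pos _)]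
  have h3 : exp (2.302 * 1) = exp 1 * exp 1 * exp 0.302 := by
    rw [← exp_add, ← exp_add]
    norm_num
  have h4 : exp 0.302 ≤ 1.4327 := by
    have := Real.exp_bound_div_one_sub_of_interval (x := 0.302) (by norm_num) (by norm_num)
    refine this.trans ?_
    norm_num
  have h5 := exp_one_lt_d9
  have h7 : exp 1 * exp 1 ≤ 2.7183 * 2.7183 := by
    apply mul_le_mul <;> first | linarith | positivity
  have h8 : exp 1 * exp 1 * exp 0.302 ≤ 2.7183 * 2.7183 * 1.4327 :=
    mul_le_mul h7 h4 (exp_pos _).le (by norm_num)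
  rw [h3]
  norm_num at h8 ⊢
  linarith

lemma weighted_modulus_gt (n : ℕ) (hn : 1 ≤ n) (Λ : ℝ) (h14 : 14.39 < Λ)
    (h8 : 8 * ((n : ℝ) - 1) < Λ) (b L : ℝ) (hb : b = n / (n + 1))
    (hL : L = b * exp (1 / n) * Λ) (h r : ℕ) (hh : h = ⌊L⌋₊) (hr : r = ⌊b * Λ / 2⌋₊)
    (hP : 71.5 * b ^ (2 * (n - 1)) * Λ ^ (n - 1) ≤ exp (Λ / 2)) (w : ℝ)
    (hw : ∀ ρ : ℝ, 0.4 ≤ ρ → ρ ≤ 1 → 2 * (r : ℝ) ≤ ρ * h → exp (-(2.302 * ρ)) ^ (n - 1) ≤ w) :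
    9.18 * Λ * b < exp (Λ / 2) * w := by
  obtain ⟨hb1, hb2, hΛL, hh14, hhL, hLh, -, h2r, hr3, hr1, hr2⟩ :=
    parameter_facts n hn Λ h14 h8 b L hb hL h r hh hr
  have hw1 : 0.094 ^ (n - 1) ≤ w :=
    (pow_le_pow_left₀ (by norm_num) exp_neg_two_three_gt _).trans
      (hw 1 (by norm_num) le_rfl (by rw [one_mul]; exact_mod_cast h2r))
  have hE0 := exp_pos (Λ / 2)
  have hΛ0 : 0 < Λ := by linarith
  rcases (by omega : n ≤ 2 ∨ n = 3 ∨ n = 4 ∨ 5 ≤ n) with h1 | h1 | h1 | h1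
  · have hw2 : 0.094 ≤ w := by
      refine le_trans ?_ hw1
      exact (pow_one (0.094 : ℝ)).symm.le.trans
        (pow_le_pow_of_le_one (by norm_num) (by norm_num) (by omega))
    have hb3 : b ≤ 2 / 3 := by
      have : (n : ℝ) ≤ 2 := by exact_mod_cast h1
      rw [hb, div_le_div_iff₀ (by positivity) (by norm_num)]
      linarith
    have he : 1096 * (Λ / 2 - 6) ≤ exp (Λ / 2) := by
      have h2 : exp (Λ / 2) = exp 1 ^ 7 * exp (Λ / 2 - 7) := by
        rw [← exp_nat_mul, ← exp_add]
        congr 1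
        push_cast
        ring
      have h3 : (1096 : ℝ) ≤ exp 1 ^ 7 :=
        le_trans (by norm_num) (pow_le_pow_left₀ (by norm_num) exp_one_gt_d9.le 7)
      have h4 := Real.add_one_le_exp (Λ / 2 - 7)
      rw [h2]
      apply mul_le_mul h3 (by linarith) (by linarith) (by positivity)
    have h5 : exp (Λ / 2) * 0.094 ≤ exp (Λ / 2) * w := mul_le_mul_of_nonneg_left hw2 hE0.le
    have h6 : Λ * b ≤ Λ * (2 / 3) := mul_le_mul_of_nonneg_left hb3 hΛ0.le
    linarith
  · subst h1
    have hbv : b = 3 / 4 := by rw [hb]; norm_num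
    have hΛ16 : 16 < Λ := by norm_num at h8; exact h8
    have hρ : 2 * (r : ℝ) ≤ 0.78 * h := by
      have h2 : (1.395 : ℝ) ≤ exp (1 / (3 : ℕ)) := by
        refine le_trans ?_ (Real.sum_le_exp_of_nonneg (by norm_num) 4)
        norm_num [Finset.sum_range_succ, Nat.factorial]
      have h3 : 3 / 4 * 1.395 * Λ ≤ L := by
        rw [hL, hbv]
        gcongr
      rw [hbv] at hr1
      linarith
    have hw2 := hw 0.78 (by norm_num) (by norm_num) hρ
    have hc : (1 / 6.5 : ℝ) ≤ exp (-(2.302 * 0.78)) := by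
      rw [exp_neg, one_div, inv_le_inv₀ (by norm_num) (exp_pos _)]
      by_contra hlt
      push Not at hlt
      have h2 : exp (2.302 * 0.78) ≤ exp (9 / 5) := exp_le_exp.2 (by norm_num)
      have h3 := pow_le_pow_left₀ (by norm_num) (hlt.le.trans h2) 5
      rw [← exp_nat_mul] at h3
      have h4 : exp (((5 : ℕ) : ℝ) * (9 / 5)) = exp 1 ^ 9 := by
        rw [← exp_nat_mul]
        norm_num
      have h5 : exp 1 ^ 9 ≤ 2.7182818286 ^ 9 :=
        pow_le_pow_left₀ (exp_pos _).le exp_one_lt_d9.le 9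
      rw [h4] at h3
      norm_num at h3 h5
      linarith
    have hw3 : (0.0236 : ℝ) ≤ w := by
      refine le_trans ?_ ((pow_le_pow_left₀ (by norm_num) hc (3 - 1)).trans hw2)
      norm_num
    rw [hbv] at hP ⊢
    norm_num at hP
    have h5 : exp (Λ / 2) * 0.0236 ≤ exp (Λ / 2) * w := mul_le_mul_of_nonneg_left hw3 hE0.le
    nlinarith
  · subst h1
    have hbv : b = 4 / 5 := by rw [hb]; norm_num
    have hΛ24 : 24 < Λ := by norm_num at h8; exact h8
    have hw3 : (0.00083 : ℝ) ≤ w := by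
      refine le_trans ?_ hw1
      norm_num
    rw [hbv] at hP ⊢
    norm_num at hP
    have h5 : exp (Λ / 2) * 0.00083 ≤ exp (Λ / 2) * w := mul_le_mul_of_nonneg_left hw3 hE0.le
    have h6 : 576 * Λ ≤ Λ ^ 3 := by nlinarith [mul_pos hΛ0 hΛ0]
    nlinarith
  · have hnR : (5 : ℝ) ≤ n := by exact_mod_cast h1
    have hbe : exp (-(1 / n)) ≤ b := by
      have h2 := Real.add_one_le_exp (1 / (n : ℝ))
      rw [exp_neg, inv_le_comm₀ (exp_pos _) (by linarith)]
      refine le_trans (le_of_eq ?_) h2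
      rw [hb, inv_div]
      field_simp
      ring
    have hbp : 0.135 ≤ b ^ (2 * (n - 1)) := by
      refine le_trans ?_ (pow_le_pow_left₀ (exp_pos _).le hbe _)
      rw [← exp_nat_mul]
      have h2 : exp (-2) ≤ exp (((2 * (n - 1) : ℕ) : ℝ) * -(1 / n)) := by
        apply exp_le_exp.2
        push_cast [Nat.cast_sub hn]
        have : 2 * ((n : ℝ) - 1) * -(1 / n) = -2 + 2 / n := by
          field_simp
          ring
        rw [this]
        have : 0 ≤ 2 / (n : ℝ) := by positivity
        linarith
      refine le_trans ?_ h2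
      rw [exp_neg, le_inv_comm₀ (by norm_num) (exp_pos _)]
      have h3 : exp 2 = exp 1 ^ 2 := by rw [← exp_nat_mul]; norm_num
      rw [h3]
      refine (pow_le_pow_left₀ (exp_pos _).le exp_one_lt_d9.le 2).trans ?_
      norm_num
    have hΛ32 : 32 ≤ Λ := by linarith
    have hpw : (27 : ℝ) ≤ (0.094 * Λ) ^ (n - 2) := by
      have h2 : (3 : ℝ) ≤ 0.094 * Λ := by linarith
      calc (27 : ℝ) = 3 ^ 3 := by norm_num
        _ ≤ 3 ^ (n - 2) := pow_le_pow_right₀ (by norm_num) (by omega)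
        _ ≤ _ := pow_le_pow_left₀ (by norm_num) h2 _
    have hpos : (0 : ℝ) ≤ Λ ^ (n - 1) := by positivity
    have h3 : 71.5 * 0.135 * Λ ^ (n - 1) ≤ exp (Λ / 2) := by
      refine le_trans ?_ hP
      gcongr
    have h4 : 71.5 * 0.135 * Λ ^ (n - 1) * 0.094 ^ (n - 1) ≤ exp (Λ / 2) * w :=
      mul_le_mul h3 hw1 (by positivity) hE0.le
    have h5 : 71.5 * 0.135 * Λ ^ (n - 1) * 0.094 ^ (n - 1) =
        71.5 * 0.135 * (0.094 * Λ) * (0.094 * Λ) ^ (n - 2) := by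
      rw [show n - 1 = n - 2 + 1 by omega, pow_succ, pow_succ, mul_pow]
      ring
    have h6 : Λ * b ≤ Λ * 1 := mul_le_mul_of_nonneg_left hb2.le hΛ0.le
    have h7 : 71.5 * 0.135 * (0.094 * Λ) * 27 ≤
        71.5 * 0.135 * (0.094 * Λ) * (0.094 * Λ) ^ (n - 2) :=
      mul_le_mul_of_nonneg_left hpw (by positivity)
    linarith

lemma pi_sq_lt : π ^ 2 < 9.8697 := by
  have h1 := Real.pi_lt_d6
  have h2 := Real.pi_pos
  nlinarith

lemma log_add_nine_div_antitone (x y : ℝ) (hx : 1 ≤ x) (hxy : x ≤ y) :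
    π ^ 2 / 9 * (log y + 9) / (3 * y) ≤ π ^ 2 / 9 * (log x + 9) / (3 * x) := by
  have hx0 : 0 < x := by linarith
  have hy0 : 0 < y := by linarith
  have h1 : log y ≤ log x + (y / x - 1) := by
    have h2 := log_le_sub_one_of_pos (div_pos hy0 hx0)
    rw [log_div hy0.ne' hx0.ne'] at h2
    linarith
  have h2 : 0 ≤ log x := log_nonneg hx
  have h3 : x * (log y + 9) ≤ y * (log x + 9) := by
    have h4 : x * log y ≤ x * (log x + (y / x - 1)) := mul_le_mul_of_nonneg_left h1 hx0.le
    have h5 : x * (log x + (y / x - 1)) = x * log x + y - x := by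
      field_simp
      ring
    nlinarith
  rw [div_le_div_iff₀ (by positivity) (by positivity)]
  have := mul_le_mul_of_nonneg_left h3 (by positivity : 0 ≤ π ^ 2 / 9 * 3)
  linarith

lemma error_term_lt_one (x : ℝ) (hx : 3.8 ≤ x) : π ^ 2 / 9 * (log x + 9) / (3 * x) < 1 := by
  refine (log_add_nine_div_antitone 3.8 x (by norm_num) hx).trans_lt ?_
  have h1 : log 3.8 ≤ 1.3363 := by
    have h2 : log (3.8 : ℝ) = log 2 + log 2 + log 0.95 := by
      rw [← log_mul (by norm_num) (by norm_num), ← log_mul (by norm_num) (by norm_num)]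
      norm_num
    have h3 := log_le_sub_one_of_pos (by norm_num : (0 : ℝ) < 0.95)
    have h4 := Real.log_two_lt_d9
    rw [h2]
    linarith
  have h2 := pi_sq_lt
  have h3 : π ^ 2 / 9 * (log 3.8 + 9) ≤ 9.8697 / 9 * (1.3363 + 9) := by
    have : 0 ≤ log (3.8 : ℝ) := log_nonneg (by norm_num)
    gcongr
  rw [div_lt_one (by norm_num)]
  norm_num at h3 ⊢
  linarith

lemma error_term_le_of_seven_le (x : ℝ) (hx : 7 ≤ x) :
    π ^ 2 / 9 * (log x + 9) / (3 * x) ≤ 0.58 := by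
  refine (log_add_nine_div_antitone 7 x (by norm_num) hx).trans ?_
  have h1 : log 7 ≤ 1.96 := by
    have h2 : log (7 : ℝ) = log 2 + log 2 + log 2 + log (7 / 8) := by
      rw [← log_mul (by norm_num) (by norm_num), ← log_mul (by norm_num) (by norm_num),
        ← log_mul (by norm_num) (by norm_num)]
      norm_num
    have h3 := log_le_sub_one_of_pos (by norm_num : (0 : ℝ) < 7 / 8)
    have h4 := Real.log_two_lt_d9
    rw [h2]
    linarith
  have h2 := pi_sq_lt
  have h3 : π ^ 2 / 9 * (log 7 + 9) ≤ 9.8697 / 9 * (1.96 + 9) := by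
    have : 0 ≤ log (7 : ℝ) := log_nonneg (by norm_num)
    gcongr
  rw [div_le_iff₀ (by norm_num)]
  norm_num at h3 ⊢
  linarith

/-- The moment method applied to intervals of length `H₀ * √γ`. -/
lemma moment_method (p : ℕ) [Fact p.Prime] (ℓ : ℕ) (hℓ : ℓ.Prime) (χ : MulChar (ZMod p) ℂ)
    (hχ : χ ≠ 1) (hχℓ : χ ^ ℓ = 1) (u : ℕ) (hu0 : 0 < u) (husq : Squarefree u)
    (hufac : ∀ q : ℕ, q.Prime → q ∣ u → q < p) (n : ℕ) (hn : n = u.primeFactors.card + 1)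
    (Λ : ℝ) (hΛ : exp Λ = p) (h14 : 14.39 < Λ) (h8 : 8 * ((n : ℝ) - 1) < Λ)
    (b L : ℝ) (hb : b = n / (n + 1)) (hL : L = b * exp (1 / n) * Λ) (H₀ X γ : ℝ)
    (hH₀ : 0 < H₀)
    (hH₀sq : H₀ ^ 2 * b ^ (n - 1) = exp (Λ / 2) * Λ * (2 * π ^ 2 / 9) * b * L ^ n)
    (hX : 3.8 < X) (hXH : X ≤ H₀ / (2 * L ^ n))
    (hP : 71.5 * b ^ (2 * (n - 1)) * Λ ^ (n - 1) ≤ exp (Λ / 2))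
    (hγ1 : 1 ≤ γ) (hγ2 : γ ≤ 3.4)
    (hone : ∀ m : ℕ, 0 < m → (m : ℝ) ≤ H₀ * √γ → Nat.Coprime m u → χ (m : ZMod p) = 1) :
    ∃ Y : ℝ, √γ * X ≤ Y ∧
      γ * (1 - π ^ 2 / 9 * (log Y + 9) / (3 * Y)) < 1 + √2 / (b * Λ - 3) := by
  have hn1 : 1 ≤ n := by omega
  obtain ⟨h, hh⟩ : ∃ h : ℕ, h = ⌊L⌋₊ := ⟨_, rfl⟩
  obtain ⟨r, hr⟩ : ∃ r : ℕ, r = ⌊b * Λ / 2⌋₊ := ⟨_, rfl⟩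
  obtain ⟨hb1, hb2, hΛL, hh14, hhL, hLh, hhn, h2r, hr3, -, -⟩ :=
    parameter_facts n hn1 Λ h14 h8 b L hb hL h r hh hr
  have hnR : (1 : ℝ) ≤ n := by exact_mod_cast hn1
  have hhR : (14 : ℝ) ≤ h := by exact_mod_cast hh14
  have hb0 : 0 < b := by linarith
  have hΛ0 : 0 < Λ := by linarith
  have hL0 : 0 < L := by linarith
  set T := u.primeFactors.filter (· ≤ h) with hT
  set S := u.primeFactors.filter (fun l => ¬ l ≤ h) with hS
  have hTS : T.card + S.card = u.primeFactors.card :=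
    Finset.card_filter_add_card_filter_not (s := u.primeFactors) (· ≤ h)
  have hTp : ∀ l ∈ T, l.Prime ∧ l ≤ h := fun l hl =>
    ⟨Nat.prime_of_mem_primeFactors (Finset.mem_filter.1 hl).1, (Finset.mem_filter.1 hl).2⟩
  obtain ⟨D, hD⟩ : ∃ D : ℕ, D = ∏ l ∈ T, l := ⟨_, rfl⟩
  have hDu : D ∣ u := by
    rw [hD]
    exact (Finset.prod_dvd_prod_of_subset _ _ _ (Finset.filter_subset _ _)).trans
      (Nat.prod_primeFactors_dvd u)
  have hDsq : Squarefree D := husq.squarefree_of_dvd hDu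
  have hDp : D.Coprime p := by
    rw [hD]
    refine Nat.Coprime.prod_left fun l hl => ?_
    have hlm := (Finset.mem_filter.1 hl).1
    have hlp := Nat.prime_of_mem_primeFactors hlm
    exact (Nat.coprime_primes hlp Fact.out).2 (hufac l hlp (Nat.dvd_of_mem_primeFactors hlm)).ne
  obtain ⟨W, hW⟩ : ∃ W : ℝ, W = (D.totient : ℝ) / D * (1 - 2 * (S.card : ℝ) / h) ^ (2 * r) :=
    ⟨_, rfl⟩
  have hwb : ∀ ρ : ℝ, 0.4 ≤ ρ → ρ ≤ 1 → 2 * (r : ℝ) ≤ ρ * h →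
      h * (D : ℝ) * b ^ (n - 1) ≤ (h : ℝ) ^ n * min W (b ^ (n - 1)) ∧
      exp (-(2.302 * ρ)) ^ (n - 1) ≤ min W (b ^ (n - 1)) := by
    intro ρ h1 h2 h3
    rw [hD]
    exact weight_bounds T h r S.card n b ρ (by omega) hh14 hhn hb hTp h3 h1 h2 W (by rw [hW, hD])
  obtain ⟨hK1, hw0⟩ := hwb 1 (by norm_num) le_rfl (by rw [one_mul]; exact_mod_cast h2r)
  have hmod := weighted_modulus_gt n hn1 Λ h14 h8 b L hb hL h r hh hr hP
    (min W (b ^ (n - 1))) fun ρ h1 h2 h3 => (hwb ρ h1 h2 h3).2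
  have hwW : min W (b ^ (n - 1)) ≤ W := min_le_left _ _
  have hwβ : min W (b ^ (n - 1)) ≤ b ^ (n - 1) := min_le_right _ _
  set w := min W (b ^ (n - 1)) with hw
  have hwpos : 0 < w := lt_of_lt_of_le (by positivity) hw0
  have hβ : 0 < b ^ (n - 1) := by positivity
  set β := b ^ (n - 1) with hβdef
  have hhn0 : (0 : ℝ) < (h : ℝ) ^ n := by positivity
  obtain ⟨K, hK⟩ : ∃ K : ℝ, K = (h : ℝ) ^ n * w / β := ⟨_, rfl⟩
  have hK0 : 0 < K := by rw [hK]; positivity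
  have hDK : h * (D : ℝ) ≤ K := by rw [hK, le_div_iff₀ hβ]; exact hK1
  have hKL : K ≤ L ^ n := by
    have h1 : K ≤ (h : ℝ) ^ n := by
      rw [hK, div_le_iff₀ hβ]
      exact mul_le_mul_of_nonneg_left hwβ hhn0.le
    exact h1.trans (pow_le_pow_left₀ (by linarith) hhL n)
  have hγs : 1 ≤ √γ := Real.one_le_sqrt.2 hγ1
  have hγsq : √γ ^ 2 = γ := Real.sq_sqrt (by linarith)
  obtain ⟨H, hH⟩ : ∃ H : ℝ, H = H₀ * √γ := ⟨_, rfl⟩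
  have hH0 : 0 < H := by rw [hH]; positivity
  rw [← hH] at hone
  have hY : √γ * X ≤ H / (2 * K) := by
    have h1 : H₀ / (2 * L ^ n) ≤ H₀ / (2 * K) := by gcongr
    have h2 := mul_le_mul_of_nonneg_left (hXH.trans h1) (by linarith : 0 ≤ √γ)
    refine h2.trans_eq ?_
    rw [hH]
    ring
  have hY38 : 3.8 ≤ H / (2 * K) := by
    exact hX.le.trans ((le_mul_of_one_le_left (by linarith) hγs).trans hY)
  have hHsq : H ^ 2 = γ * H₀ ^ 2 := by rw [hH, mul_pow, hγsq]; ring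
  have hHK : H ^ 2 / K < p := by
    have hratio := ratio_pow_le n h L (by omega) (by linarith) (by
      rcases (by omega : n ≤ 2 ∨ 3 ≤ n) with h1 | h1
      · have : (n : ℝ) ≤ 2 := by exact_mod_cast h1
        linarith
      · have : (3 : ℝ) ≤ n := by exact_mod_cast h1
        linarith) hLh
    rw [div_pow, div_le_iff₀ hhn0] at hratio
    rw [div_lt_iff₀ hK0, hK, mul_div_assoc', lt_div_iff₀ hβ, hHsq, mul_assoc, hH₀sq, ← hΛ]
    have he : exp Λ = exp (Λ / 2) * exp (Λ / 2) := by
      rw [← exp_add]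
      congr 1
      ring
    rw [he]
    have hπ : γ * (2 * π ^ 2 / 9) * (16 / 13) ≤ 9.18 := by
      have h1 := pi_sq_lt
      have h2 : γ * π ^ 2 ≤ 3.4 * 9.8697 := mul_le_mul hγ2 h1.le (by positivity) (by norm_num)
      norm_num at h2 ⊢
      linarith
    have hE0 := exp_pos (Λ / 2)
    calc γ * (exp (Λ / 2) * Λ * (2 * π ^ 2 / 9) * b * L ^ n)
        = γ * (2 * π ^ 2 / 9) * (exp (Λ / 2) * Λ * b) * L ^ n := by ring
      _ ≤ γ * (2 * π ^ 2 / 9) * (exp (Λ / 2) * Λ * b) * (16 / 13 * h ^ n) := by gcongr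
      _ = γ * (2 * π ^ 2 / 9) * (16 / 13) * (exp (Λ / 2) * Λ * b * h ^ n) := by ring
      _ ≤ 9.18 * (exp (Λ / 2) * Λ * b * h ^ n) :=
          mul_le_mul_of_nonneg_right hπ (by positivity)
      _ = exp (Λ / 2) * h ^ n * (9.18 * Λ * b) := by ring
      _ < exp (Λ / 2) * h ^ n * (exp (Λ / 2) * w) :=
          mul_lt_mul_of_pos_left hmod (by positivity)
      _ = _ := by ring
  have hDpos : (1 : ℝ) ≤ D := by
    exact_mod_cast Nat.one_le_iff_ne_zero.2 hDsq.ne_zero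
  have hXp : H / (2 * K) < p := by
    have h1 : 1 ≤ 2 * H := by
      have h38 := (le_div_iff₀ (by positivity)).1 hY38
      have h14D := mul_le_mul hhR hDpos (by norm_num) (by linarith)
      have hK14 := h14D.trans hDK
      linarith
    have h2 : 2 * H * (H / (2 * K)) = H ^ 2 / K := by
      field_simp
    have h3 : H / (2 * K) ≤ 2 * H * (H / (2 * K)) := le_mul_of_one_le_left (by positivity) h1
    linarith
  have hhp : h < p := by
    have h1 : (h : ℝ) < p := by
      refine hhL.trans_lt ?_
      rw [← hΛ, hL]
      have h2 : exp (1 / (n : ℝ)) ≤ exp 1 := by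
        apply exp_le_exp.2
        rw [div_le_one (by linarith)]
        exact hnR
      have h3 : exp Λ = exp 1 * exp (Λ - 1) := by
        rw [← exp_add]
        congr 1
        ring
      have h4 := Real.add_one_le_exp (Λ - 1)
      have h5 : exp 1 * Λ ≤ exp Λ := by
        rw [h3]
        exact mul_le_mul_of_nonneg_left (by linarith) (exp_pos _).le
      have h6 : exp (1 / (n : ℝ)) * Λ ≤ exp 1 * Λ := mul_le_mul_of_nonneg_right h2 hΛ0.le
      have h7 : b * (exp (1 / (n : ℝ)) * Λ) < 1 * (exp (1 / (n : ℝ)) * Λ) :=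
        mul_lt_mul_of_pos_right hb2 (by positivity)
      linarith
    exact_mod_cast h1
  have hcard : 8 * S.card ≤ h := by omega
  have hEY := error_term_lt_one _ hY38
  have hmain := moment_comparison p ℓ hℓ χ hχ hχℓ u H hone D hDsq hDp S
    (by
      intro l hl hlu
      have hlm : l ∈ u.primeFactors := Nat.mem_primeFactors.2 ⟨hl, hlu, hu0.ne'⟩
      by_cases hlh : l ≤ h
      · left
        rw [hD]
        exact Finset.dvd_prod_of_mem (fun l => l) (Finset.mem_filter.2 ⟨hlm, hlh⟩)
      · exact Or.inr (Finset.mem_filter.2 ⟨hlm, hlh⟩)) h (by omega) hhp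
    (by
      intro l hl
      obtain ⟨hlm, hlh⟩ := Finset.mem_filter.1 hl
      have hlp := Nat.prime_of_mem_primeFactors hlm
      refine ⟨hlp, by omega, fun hlD => ?_, (hufac l hlp (Nat.dvd_of_mem_primeFactors hlm)).ne⟩
      rw [hD] at hlD
      obtain ⟨l', hl', hll⟩ := (hlp.prime.dvd_finsetProd_iff _).1 hlD
      have := (Nat.prime_dvd_prime_iff_eq hlp (hTp l' hl').1).1 hll
      exact hlh (this ▸ (hTp l' hl').2)) (by omega) r (by omega) K (β / h ^ n) hDK
    (by
      have h1 : β / (h : ℝ) ^ n * K = w := by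
        rw [hK]
        field_simp
      rw [h1, ← hW]
      exact hwW) hY38 hXp hHK (by linarith)
  refine ⟨H / (2 * K), hY, ?_⟩
  have hcoef := moment_coefficient_lt n hn1 Λ h14 h8 b L hb hL h r hh hr
  have hsqrt : √(p : ℝ) = exp (Λ / 2) := by rw [← hΛ, Real.exp_half]
  rw [hsqrt] at hmain
  set ε := 1 - π ^ 2 / 9 * (log (H / (2 * K)) + 9) / (3 * (H / (2 * K))) with hε
  have hE0 := exp_pos (Λ / 2)
  have hleft : 9 / (2 * π ^ 2) * (β / h ^ n) * H ^ 2 * ε =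
      exp (Λ / 2) * ((L / h) ^ n * (b * Λ) * (γ * ε)) := by
    calc 9 / (2 * π ^ 2) * (β / h ^ n) * H ^ 2 * ε
        = 9 / (2 * π ^ 2) * γ * ε / h ^ n * (H₀ ^ 2 * β) := by rw [hHsq]; ring
      _ = _ := by
          rw [hH₀sq, div_pow]
          field_simp
  rw [hleft] at hmain
  have h1 := lt_of_le_of_lt (le_of_mul_le_mul_left hmain hE0) hcoef
  have hpos : 0 < (L / h) ^ n * (b * Λ) := by
    have : 0 < L / h := div_pos hL0 (by linarith)
    positivity
  refine lt_of_mul_lt_mul_left ?_ hpos.le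
  linarith

/-- Every nontrivial character has a nontrivial power of prime order. -/
lemma exists_pow_prime_order (p : ℕ) [Fact p.Prime] (χ : MulChar (ZMod p) ℂ) (hχ : χ ≠ 1) :
    ∃ (ℓ : ℕ) (ψ : MulChar (ZMod p) ℂ), ℓ.Prime ∧ ψ ≠ 1 ∧ ψ ^ ℓ = 1 ∧
      ∀ a : ZMod p, χ a = 1 → ψ a = 1 := by
  have hk0 : 0 < orderOf χ := χ.orderOf_pos
  have hk1 : orderOf χ ≠ 1 := fun h => hχ (orderOf_eq_one_iff.1 h)
  have hℓ := Nat.minFac_prime hk1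
  have hdvd := Nat.minFac_dvd (orderOf χ)
  have hpos : 0 < orderOf χ / (orderOf χ).minFac :=
    Nat.div_pos (Nat.le_of_dvd hk0 hdvd) hℓ.pos
  refine ⟨(orderOf χ).minFac, χ ^ (orderOf χ / (orderOf χ).minFac), hℓ, ?_, ?_, ?_⟩
  · exact pow_ne_one_of_lt_orderOf hpos.ne' (Nat.div_lt_self hk0 hℓ.one_lt)
  · rw [← pow_mul, Nat.div_mul_cancel hdvd, pow_orderOf_eq_one]
  · intro a ha
    rw [MulChar.pow_apply' _ hpos.ne', ha, one_pow]

/-- The square of the main factor of the bound, and its relation to `Xstar`. -/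
lemma main_factor_facts (n : ℕ) (hn : 1 ≤ n) (Λ P b L H₀ : ℝ) (hΛ0 : 0 < Λ)
    (hΛ : exp Λ = P) (hb : b = n / (n + 1)) (hL : L = b * exp (1 / n) * Λ)
    (hH₀ : H₀ = P ^ ((1 : ℝ) / 4) * Λ ^ (((n : ℝ) + 1) / 2) * (π / 3 * √(2 * exp 1) * b)) :
    0 < H₀ ∧ H₀ ^ 2 * b ^ (n - 1) = exp (Λ / 2) * Λ * (2 * π ^ 2 / 9) * b * L ^ n ∧
      Xstar n P = H₀ / (2 * L ^ n) * (1 - 1 / L) := by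
  obtain ⟨m, rfl⟩ : ∃ m, n = m + 1 := ⟨n - 1, by omega⟩
  have hn0 : (0 : ℝ) < ((m + 1 : ℕ) : ℝ) := by positivity
  have hb0 : 0 < b := by rw [hb]; positivity
  have hP0 : 0 < P := hΛ ▸ exp_pos Λ
  have hlog : log P = Λ := by rw [← hΛ, log_exp]
  have hLn : L ^ (m + 1) = b ^ (m + 1) * exp 1 * Λ ^ (m + 1) := by
    rw [hL, mul_pow, mul_pow, ← exp_nat_mul]
    congr 3
    field_simp
  have hP2 : (P ^ ((1 : ℝ) / 4)) ^ 2 = exp (Λ / 2) := by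
    rw [← hΛ, ← exp_mul, ← exp_nat_mul]
    congr 1
    push_cast
    ring
  have hΛ2 : (Λ ^ ((((m + 1 : ℕ) : ℝ) + 1) / 2)) ^ 2 = Λ ^ (m + 2) := by
    rw [← rpow_natCast, ← rpow_mul hΛ0.le, ← rpow_natCast]
    congr 1
    push_cast
    ring
  have hs2 : √(2 * exp 1) ^ 2 = 2 * exp 1 := Real.sq_sqrt (by positivity)
  have hs0 : 0 < √(2 * exp 1) := by positivity
  refine ⟨by rw [hH₀]; positivity, ?_, ?_⟩
  · calc H₀ ^ 2 * b ^ (m + 1 - 1)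
        = (P ^ ((1 : ℝ) / 4)) ^ 2 * (Λ ^ ((((m + 1 : ℕ) : ℝ) + 1) / 2)) ^ 2 *
            (π ^ 2 / 9 * √(2 * exp 1) ^ 2 * b ^ 2) * b ^ m := by
          rw [hH₀, Nat.add_sub_cancel]; ring
      _ = _ := by rw [hP2, hΛ2, hs2, hLn]; ring
  · have h1 : (2 * exp 1) ^ (-(1 : ℝ) / 2) = (√(2 * exp 1))⁻¹ := by
      rw [Real.sqrt_eq_rpow, ← rpow_neg (by positivity)]
      congr 1
      ring
    have h2 : (((m + 1 : ℕ) : ℝ) + 1) / ((m + 1 : ℕ) : ℝ) = b⁻¹ := by rw [hb, inv_div]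
    have h3 : Λ ^ ((((m + 1 : ℕ) : ℝ) + 1) / 2) =
        Λ ^ ((((m + 1 : ℕ) : ℝ) - 1) / 2) * Λ := by
      nth_rewrite 3 [← rpow_one Λ]
      rw [← rpow_add hΛ0]
      congr 1
      ring
    have h4 : (Λ ^ ((((m + 1 : ℕ) : ℝ) - 1) / 2)) ^ 2 = Λ ^ m := by
      rw [← rpow_natCast, ← rpow_mul hΛ0.le, ← rpow_natCast]
      congr 1
      push_cast
      ring
    have h5 : b⁻¹ * exp (-1 / ((m + 1 : ℕ) : ℝ)) / Λ = 1 / L := by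
      rw [hL, neg_div, exp_neg]
      field_simp
    have hq0 : 0 < Λ ^ ((((m + 1 : ℕ) : ℝ) - 1) / 2) := by positivity
    rw [Xstar, hlog, h1, h2, h5, hH₀, h3, hLn, Nat.add_sub_cancel, inv_pow]
    congr 1
    set q := Λ ^ ((((m + 1 : ℕ) : ℝ) - 1) / 2)
    set s := √(2 * exp 1)
    have he : exp 1 = s ^ 2 / 2 := by rw [hs2]; ring
    rw [he, pow_succ Λ, ← h4, pow_succ b]
    field_simp

/-- The lower bound for `p` implied by `Xstar n p > 3.8`. -/
lemma exp_half_ge (n : ℕ) (hn : 1 ≤ n) (Λ b L H₀ : ℝ) (hΛ0 : 0 < Λ) (hb0 : 0 < b)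
    (hL : L = b * exp (1 / n) * Λ)
    (hH₀sq : H₀ ^ 2 * b ^ (n - 1) = exp (Λ / 2) * Λ * (2 * π ^ 2 / 9) * b * L ^ n)
    (hX : 3.8 ≤ H₀ / (2 * L ^ n)) :
    71.5 * b ^ (2 * (n - 1)) * Λ ^ (n - 1) ≤ exp (Λ / 2) := by
  obtain ⟨m, rfl⟩ : ∃ m, n = m + 1 := ⟨n - 1, by omega⟩
  rw [Nat.add_sub_cancel] at *
  have hLn : L ^ (m + 1) = b ^ (m + 1) * exp 1 * Λ ^ (m + 1) := by
    rw [hL, mul_pow, mul_pow, ← exp_nat_mul]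
    congr 3
    field_simp
  have hL0 : 0 < L := by rw [hL]; positivity
  have h1 := (le_div_iff₀ (by positivity)).1 hX
  have h2 : (3.8 * (2 * L ^ (m + 1))) ^ 2 ≤ H₀ ^ 2 := pow_le_pow_left₀ (by positivity) h1 2
  have h3 := mul_le_mul_of_nonneg_right h2 (by positivity : 0 ≤ b ^ m)
  rw [hH₀sq] at h3
  have h4 : L ^ (m + 1) * (b * Λ) * (57.76 * exp 1 * (b ^ (2 * m) * Λ ^ m)) ≤
      L ^ (m + 1) * (b * Λ) * (exp (Λ / 2) * (2 * π ^ 2 / 9)) := by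
    refine le_trans (le_of_eq ?_) (h3.trans (le_of_eq ?_))
    · rw [show (3.8 * (2 * L ^ (m + 1))) ^ 2 * b ^ m =
        57.76 * L ^ (m + 1) * b ^ m * L ^ (m + 1) by ring]
      nth_rewrite 3 [hLn]
      ring
    · ring
  have h5 := le_of_mul_le_mul_left h4 (by positivity)
  have h6 := pi_sq_lt
  have h7 := Real.exp_one_gt_d9
  have hB : 0 ≤ b ^ (2 * m) * Λ ^ m := by positivity
  have h8 : exp (Λ / 2) * (2 * π ^ 2 / 9) ≤ exp (Λ / 2) * (2 * 9.8697 / 9) := by gcongr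
  have h9 : 57.76 * 2.7182818283 * (b ^ (2 * m) * Λ ^ m) ≤
      57.76 * exp 1 * (b ^ (2 * m) * Λ ^ m) := by gcongr
  rw [mul_assoc]
  norm_num at h8 h9 ⊢
  linarith

/-- Main theorem: let `χ` be a nonprincipal Dirichlet character modulo a prime `p`, let `u`
be a squarefree positive integer all of whose prime factors are less than `p`, and set
`n = ω(u) + 1`.  Suppose `χ(m) = 1` whenever `0 < m ≤ H < p` and `gcd(m,u) = 1`.  If
`X* > 3.8` and `log p > max{exp(8/3), 8(n-1)}`, then `H ≤ p^(1/4) (log p)^((n+1)/2) g(n,p)`. -/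
theorem stmt_0 (p : ℕ) (hp : p.Prime) (χ : DirichletCharacter ℂ p) (hχ : χ ≠ 1)
    (u : ℕ) (hu : 0 < u) (husq : Squarefree u)
    (hufac : ∀ q : ℕ, q.Prime → q ∣ u → q < p)
    (n : ℕ) (hn : n = u.primeFactors.card + 1)
    (H : ℝ) (hHp : H < p)
    (hone : ∀ m : ℕ, 0 < m → (m : ℝ) ≤ H → Nat.Coprime m u → χ ((m : ZMod p)) = 1)
    (hX : Xstar n p > 3.8)
    (hlog : Real.log p > max (Real.exp (8 / 3)) (8 * ((n : ℝ) - 1))) :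
    H ≤ (p : ℝ) ^ ((1 : ℝ) / 4) * Real.log p ^ (((n : ℝ) + 1) / 2) * gconst n p := by
  have : Fact p.Prime := ⟨hp⟩
  have hn1 : 1 ≤ n := by omega
  obtain ⟨Λ, hΛdef⟩ : ∃ Λ : ℝ, Λ = log p := ⟨_, rfl⟩
  obtain ⟨b, hb⟩ : ∃ b : ℝ, b = (n : ℝ) / (n + 1) := ⟨_, rfl⟩
  obtain ⟨L, hL⟩ : ∃ L : ℝ, L = b * exp (1 / n) * Λ := ⟨_, rfl⟩
  obtain ⟨X, hXdef⟩ : ∃ X : ℝ, X = Xstar n p := ⟨_, rfl⟩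
  have hp0 : (0 : ℝ) < p := by exact_mod_cast hp.pos
  have hΛ : exp Λ = p := by rw [hΛdef, exp_log hp0]
  rw [← hΛdef] at hlog ⊢
  rw [← hXdef] at hX
  have h14 : 14.39 < Λ := exp_eight_thirds_gt.trans ((le_max_left _ _).trans_lt hlog)
  have h8 : 8 * ((n : ℝ) - 1) < Λ := (le_max_right _ _).trans_lt hlog
  have hΛ0 : 0 < Λ := by linarith
  obtain ⟨hb1, hb2, hΛL, -⟩ := parameter_facts n hn1 Λ h14 h8 b L hb hL _ _ rfl rfl
  have hL0 : 0 < L := by linarith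
  obtain ⟨H₀, hH₀⟩ : ∃ H₀ : ℝ, H₀ = (p : ℝ) ^ ((1 : ℝ) / 4) * Λ ^ (((n : ℝ) + 1) / 2) *
    (π / 3 * √(2 * exp 1) * b) := ⟨_, rfl⟩
  obtain ⟨hH₀0, hH₀sq, hXeq⟩ := main_factor_facts n hn1 Λ p b L H₀ hΛ0 hΛ hb hL hH₀
  rw [← hXdef] at hXeq
  have hXH : X ≤ H₀ / (2 * L ^ n) := by
    rw [hXeq]
    refine mul_le_of_le_one_right (by positivity) ?_
    have : 0 < 1 / L := by positivity
    linarith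
  have hP := exp_half_ge n hn1 Λ b L H₀ hΛ0 (by linarith) hL hH₀sq (hX.le.trans hXH)
  obtain ⟨A, hA⟩ : ∃ A : ℝ, A = 1 + √2 / (b * Λ - 3) := ⟨_, rfl⟩
  obtain ⟨E, hE⟩ : ∃ E : ℝ, E = π ^ 2 / 9 * (log X + 9) / (3 * X) := ⟨_, rfl⟩
  have hgoal : (p : ℝ) ^ ((1 : ℝ) / 4) * Λ ^ (((n : ℝ) + 1) / 2) * gconst n p =
      H₀ * √(A / (1 - E)) := by
    have h2B : 2 * ((n : ℝ) / (2 * ((n : ℝ) + 1))) = b := by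
      rw [hb]
      field_simp
    rw [gconst, ← hΛdef, ← hXdef, h2B, ← hA, ← hE, ← Real.sqrt_eq_rpow, hH₀, hb]
    ring
  rw [hgoal]
  have hbΛ : 7.195 ≤ b * Λ := by
    have := mul_le_mul hb1 h14.le (by norm_num) (by linarith)
    norm_num at this ⊢
    linarith
  have hA1 : 1 ≤ A := by
    have : 0 ≤ √2 / (b * Λ - 3) := div_nonneg (Real.sqrt_nonneg _) (by linarith)
    linarith
  have hA2 : A ≤ 1.34 := by
    have h1 : √2 / (b * Λ - 3) ≤ 0.34 := by
      rw [div_le_iff₀ (by linarith)]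
      have := sqrt_two_bounds.2
      norm_num at this ⊢
      linarith
    norm_num at h1 ⊢
    linarith
  have hE1 : E < 1 := hE ▸ error_term_lt_one X hX.le
  have hE0 : 0 ≤ E := by
    have : 0 ≤ log X := log_nonneg (by linarith)
    rw [hE]
    have : 0 < X := by linarith
    positivity
  have hg1 : 1 ≤ A / (1 - E) := by
    rw [le_div_iff₀ (by linarith)]
    linarith
  obtain ⟨ℓ, ψ, hℓ, hψ, hψℓ, hψχ⟩ := exists_pow_prime_order p χ hχ
  by_contra hcon
  push Not at hcon
  obtain ⟨γ, hγ⟩ : ∃ γ : ℝ, γ = min (A / (1 - E)) 3.4 := ⟨_, rfl⟩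
  have hγ1 : 1 ≤ γ := hγ ▸ le_min hg1 (by norm_num)
  have hγs : 1 ≤ √γ := Real.one_le_sqrt.2 hγ1
  obtain ⟨Y, hXY, hY⟩ := moment_method p ℓ hℓ ψ hψ hψℓ u hu husq hufac n hn Λ hΛ h14 h8 b L hb hL
    H₀ X γ hH₀0 hH₀sq hX hXH hP hγ1 (hγ ▸ min_le_right _ _) fun m hm hmH hmu =>
      hψχ _ (hone m hm (hmH.trans (le_trans (mul_le_mul_of_nonneg_left
        (Real.sqrt_le_sqrt (hγ ▸ min_le_left _ _)) hH₀0.le) hcon.le)) hmu)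
  rw [← hA] at hY
  have hXY' : X ≤ Y := (le_mul_of_one_le_left (by linarith) hγs).trans hXY
  rcases min_choice (A / (1 - E)) 3.4 with h | h
  · have hEY := log_add_nine_div_antitone X Y (by linarith) hXY'
    rw [← hE] at hEY
    have h1 : γ * (1 - E) = A := by
      rw [hγ, h, div_mul_cancel₀ _ (by linarith)]
    have h2 : γ * (1 - E) ≤ γ * (1 - π ^ 2 / 9 * (log Y + 9) / (3 * Y)) :=
      mul_le_mul_of_nonneg_left (by linarith) (by linarith)
    linarith
  · have hs : 1.843 ≤ √γ := by
      rw [hγ, h]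
      exact Real.le_sqrt_of_sq_le (by norm_num)
    have h7 : 7 ≤ Y := by
      have := mul_le_mul hs hX.le (by norm_num) (by linarith)
      norm_num at this ⊢
      linarith
    have hEY := error_term_le_of_seven_le Y h7
    have h2 : 3.4 * (1 - 0.58) ≤ γ * (1 - π ^ 2 / 9 * (log Y + 9) / (3 * Y)) := by
      rw [hγ, h]
      exact mul_le_mul_of_nonneg_left (by linarith) (by norm_num)
    norm_num at h2 hA2
    linarith
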